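/- Let q be a prime power, let n ≥ 5 be an integer, and let I, J be integers with 1 ≤ I < J ≤ n−1 and gcd(J−I, n) = 1. Suppose q ≥ 2^{(13/3)n + 4} and α ∈ F_{q^n} ∖ {0}. Then the binomial f(x) = x^{q^I} + α x^{q^J} is scattered over F_{q^n} if and only if I + J = n and N_{q^n/q}(α) ≠ 1. -/

import Mathlib

/-- An `F_q`-linearized map `f` on a field `F` (of size `q ^ n`) is *scattered* if for all
nonzero `x, y`, `f x / x = f y / y` implies that `x / y` lies in the subfield `F_q`,
identified with the set of fixed points of `z ↦ z ^ q`. -/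
def IsScattered (q : ℕ) {F : Type*} [Field F] (f : F → F) : Prop :=
  ∀ x y : F, x ≠ 0 → y ≠ 0 → f x / x = f y / y → (x / y) ^ q = x / y

open Polynomial

/-- An increasing multiplicative filtration, indexed by the integers, of an algebra by submodules.
-/
structure AlgFiltration (R A : Type*) [CommRing R] [CommRing A] [Algebra R A] where
  fil : ℤ → Submodule R A
  mono : ∀ {a b : ℤ}, a ≤ b → fil a ≤ fil b
  one_mem : 1 ∈ fil 0
  mul_mem : ∀ {a b : ℤ} {x y : A}, x ∈ fil a → y ∈ fil b → x * y ∈ fil (a + b)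

namespace AlgFiltration

variable {R A : Type*} [CommRing R] [CommRing A] [Algebra R A]

/-- The filtration with everything in degree zero. -/
def trivial (R A : Type*) [CommRing R] [CommRing A] [Algebra R A] : AlgFiltration R A where
  fil m := if 0 ≤ m then ⊤ else ⊥
  mono {a b} h := by
    split_ifs with h1 h2
    · exact le_rfl
    · omega
    · exact bot_le
    · exact le_rfl
  one_mem := by simp
  mul_mem {a b x y} hx hy := by
    by_cases ha : 0 ≤ a
    · by_cases hb : 0 ≤ b
      · simp [add_nonneg ha hb]
      · simp only [hb, if_false, Submodule.mem_bot] at hy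
        simp [hy]
    · simp only [ha, if_false, Submodule.mem_bot] at hx
      simp [hx]

/-- The filtration on polynomials in which the variable has weight `w`. -/
def poly (Φ : AlgFiltration R A) (w : ℤ) : AlgFiltration R A[X] where
  fil D :=
    { carrier := {p | ∀ i : ℕ, p.coeff i ∈ Φ.fil (D - w * i)}
      add_mem' := fun hp hq i => by
        rw [coeff_add]; exact add_mem (hp i) (hq i)
      zero_mem' := fun i => by simp
      smul_mem' := fun c p hp i => by
        rw [coeff_smul]; exact Submodule.smul_mem _ _ (hp i) }
  mono {a b} h p hp i := Φ.mono (by omega) (hp i)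
  one_mem i := by
    rw [coeff_one]
    split_ifs with h
    · subst h; simpa using Φ.one_mem
    · simp
  mul_mem {a b p r} hp hr i := by
    rw [coeff_mul]
    refine Submodule.sum_mem _ fun x hx => ?_
    rw [Finset.HasAntidiagonal.mem_antidiagonal] at hx
    have := Φ.mul_mem (hp x.1) (hr x.2)
    have h2 : a - w * (x.1 : ℤ) + (b - w * x.2) = a + b - w * i := by
      rw [← hx]; push_cast; ring
    rwa [h2] at this

variable (Φ : AlgFiltration R A) {w : ℤ}

theorem mem_poly {D : ℤ} {p : A[X]} :
    p ∈ (Φ.poly w).fil D ↔ ∀ i : ℕ, p.coeff i ∈ Φ.fil (D - w * i) := Iff.rfl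

theorem mem_trivial {D : ℤ} {a : A} : a ∈ (trivial R A).fil D ↔ (a ≠ 0 → 0 ≤ D) := by
  by_cases h : 0 ≤ D
  · simp [trivial, h]
  · simp only [trivial, h, if_false, Submodule.mem_bot]
    tauto

theorem pow_mem {a : ℤ} {x : A} (hx : x ∈ Φ.fil a) (k : ℕ) : x ^ k ∈ Φ.fil (k * a) := by
  induction k with
  | zero => simpa using Φ.one_mem
  | succ k ih =>
    rw [pow_succ]
    have := Φ.mul_mem ih hx
    convert this using 2
    push_cast; ring

theorem prod_mem {ι : Type*} (s : Finset ι) (x : ι → A) (a : ι → ℤ)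
    (h : ∀ i ∈ s, x i ∈ Φ.fil (a i)) : ∏ i ∈ s, x i ∈ Φ.fil (∑ i ∈ s, a i) := by
  classical
  induction s using Finset.induction_on with
  | empty => simpa using Φ.one_mem
  | insert i s hi ih =>
    rw [Finset.prod_insert hi, Finset.sum_insert hi]
    exact Φ.mul_mem (h i (Finset.mem_insert_self _ _))
      (ih fun j hj => h j (Finset.mem_insert_of_mem hj))

theorem algebraMap_mem (c : R) : algebraMap R A c ∈ Φ.fil 0 := by
  rw [Algebra.algebraMap_eq_smul_one]
  exact Submodule.smul_mem _ _ Φ.one_mem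

theorem C_mem {D : ℤ} {a : A} (h : a ∈ Φ.fil D) : C a ∈ (Φ.poly w).fil D := fun i => by
  rw [coeff_C]
  split_ifs with h0
  · subst h0; simpa using h
  · simp

theorem X_mem : (X : A[X]) ∈ (Φ.poly w).fil w := fun i => by
  rw [coeff_X]
  split_ifs with h0
  · subst h0; simpa using Φ.one_mem
  · simp

theorem C_mul_X_pow_mem {D : ℤ} {a : A} {k : ℕ} (h : a ∈ Φ.fil (D - w * k)) :
    C a * X ^ k ∈ (Φ.poly w).fil D := fun i => by
  rw [coeff_C_mul_X_pow]
  split_ifs with h0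
  · subst h0; exact h
  · simp

theorem exists_div [Nontrivial A] {g : A[X]} (hg : g.Monic) (hgw : g ∈ (Φ.poly w).fil (w *
    g.natDegree)) {D : ℤ} :
    ∀ (N : ℕ) (p : A[X]), p.natDegree < N → p ∈ (Φ.poly w).fil D →
    ∃ u r : A[X], r + g * u = p ∧ r.degree < g.degree ∧
      u ∈ (Φ.poly w).fil (D - w * g.natDegree) ∧ r ∈ (Φ.poly w).fil D := by
  intro N
  induction N with
  | zero => intro p hp; omega
  | succ N ih =>
    intro p hpN hp
    by_cases hlt : p.degree < g.degree
    · exact ⟨0, p, by simp, hlt, Submodule.zero_mem _, hp⟩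
    · rw [not_lt] at hlt
      have hp0 : p ≠ 0 := by
        rintro rfl
        rw [degree_zero, le_bot_iff, degree_eq_bot] at hlt
        exact hg.ne_zero hlt
      have hle : g.natDegree ≤ p.natDegree := natDegree_le_natDegree hlt
      set k := p.natDegree - g.natDegree with hk
      set t : A[X] := C p.leadingCoeff * X ^ k with ht
      have htm : t ∈ (Φ.poly w).fil (D - w * g.natDegree) := by
        refine Φ.C_mul_X_pow_mem ?_
        have : p.leadingCoeff ∈ Φ.fil (D - w * p.natDegree) := hp p.natDegree
        convert this using 2
        rw [hk]; push_cast [hle]; ring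
      have hdeg : (p - g * t).degree < p.degree := by
        have := div_wf_lemma ⟨hlt, hp0⟩ hg
        simpa [ht, hk] using this
      have hmem : p - g * t ∈ (Φ.poly w).fil D := by
        refine sub_mem hp ?_
        have := (Φ.poly w).mul_mem hgw htm
        rwa [add_sub_cancel] at this
      by_cases hz : p - g * t = 0
      · refine ⟨t, 0, by rw [zero_add]; exact (sub_eq_zero.mp hz).symm, ?_, htm,
          Submodule.zero_mem _⟩
        rw [degree_zero, bot_lt_iff_ne_bot, Ne, degree_eq_bot]
        exact hg.ne_zero
      · have := natDegree_lt_natDegree hz hdeg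
        obtain ⟨u, r, h1, h2, h3, h4⟩ := ih (p - g * t) (by omega) hmem
        refine ⟨u + t, r, ?_, h2, add_mem h3 htm, h4⟩
        rw [mul_add, ← add_assoc, h1]; ring

theorem divByMonic_mem [Nontrivial A] {g : A[X]} (hg : g.Monic) (hgw : g ∈ (Φ.poly w).fil (w *
    g.natDegree))
    {D : ℤ} {p : A[X]} (hp : p ∈ (Φ.poly w).fil D) :
    p /ₘ g ∈ (Φ.poly w).fil (D - w * g.natDegree) := by
  obtain ⟨u, r, h1, h2, h3, h4⟩ := Φ.exists_div hg hgw _ p (Nat.lt_succ_self _) hp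
  rwa [(div_modByMonic_unique u r hg ⟨h1, h2⟩).1]

theorem modByMonic_mem [Nontrivial A] {g : A[X]} (hg : g.Monic) (hgw : g ∈ (Φ.poly w).fil (w *
    g.natDegree))
    {D : ℤ} {p : A[X]} (hp : p ∈ (Φ.poly w).fil D) :
    p %ₘ g ∈ (Φ.poly w).fil D := by
  obtain ⟨u, r, h1, h2, h3, h4⟩ := Φ.exists_div hg hgw _ p (Nat.lt_succ_self _) hp
  rwa [(div_modByMonic_unique u r hg ⟨h1, h2⟩).2]

/-- The image filtration. -/
def map {B : Type*} [CommRing B] [Algebra R B] (π : A →ₐ[R] B) : AlgFiltration R B where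
  fil D := (Φ.fil D).map π.toLinearMap
  mono h := Submodule.map_mono (Φ.mono h)
  one_mem := ⟨1, Φ.one_mem, by simp⟩
  mul_mem := by
    rintro a b _ _ ⟨x, hx, rfl⟩ ⟨y, hy, rfl⟩
    exact ⟨x * y, Φ.mul_mem hx hy, by simp⟩

theorem map_mem {B : Type*} [CommRing B] [Algebra R B] (π : A →ₐ[R] B) {D : ℤ} {x : A}
    (hx : x ∈ Φ.fil D) : π x ∈ (Φ.map π).fil D := ⟨x, hx, rfl⟩

theorem det_mem {ι : Type*} [Fintype ι] [DecidableEq ι] (M : Matrix ι ι A) {E : ℤ}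
    (h : ∀ i j, M i j ∈ Φ.fil E) : M.det ∈ Φ.fil (Fintype.card ι * E) := by
  rw [Matrix.det_apply]
  refine Submodule.sum_mem _ fun σ _ => ?_
  have : ∏ i, M (σ i) i ∈ Φ.fil (Fintype.card ι * E) := by
    have := Φ.prod_mem Finset.univ (fun i => M (σ i) i) (fun _ => E) fun i _ => h _ _
    simpa using this
  rcases Int.units_eq_one_or (Equiv.Perm.sign σ) with h1 | h1 <;> rw [h1]
  · simpa using this
  · simpa using this

theorem resultant_mem {f g : A[X]} (m n : ℕ) {E : ℤ} (hf : ∀ i, f.coeff i ∈ Φ.fil E)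
    (hg : ∀ i, g.coeff i ∈ Φ.fil E) : f.resultant g m n ∈ Φ.fil ((m + n : ℕ) * E) := by
  have := Φ.det_mem (f.sylvester g m n) (E := E) ?_
  · rw [Fintype.card_fin] at this
    exact this
  · intro i j
    rw [sylvester, Matrix.of_apply]
    induction j using Fin.addCases with
    | left j => 
      simp only [Fin.addCases_left]
      split_ifs
      · apply hg
      · simp
    | right j =>
      simp only [Fin.addCases_right]
      split_ifs
      · apply hf
      · simp

end AlgFiltration

theorem Polynomial.Monic.resultant_ne_zero_of_irreducible {A : Type*} [CommRing A] [IsDomain A]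
    [IsIntegrallyClosed A] {f b : A[X]} (hf : f.Monic) (hirr : Irreducible f) (hb : b ≠ 0)
    (hdeg : b.natDegree < f.natDegree) : f.resultant b ≠ 0 := by
  intro h
  let K := FractionRing A
  have hinj : Function.Injective (algebraMap A K) := IsFractionRing.injective A K
  have h2 : (f.map (algebraMap A K)).resultant (b.map (algebraMap A K)) = 0 := by
    rw [natDegree_map_eq_of_injective hinj, natDegree_map_eq_of_injective hinj,
      resultant_map_map, h, map_zero]
  rw [resultant_eq_zero_iff] at h2
  refine h2.2 ?_
  rw [((hf.irreducible_iff_irreducible_map_fraction_map (K := K)).1 hirr).coprime_iff_not_dvd]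
  intro hdvd
  have hb' : b.map (algebraMap A K) ≠ 0 := by
    rwa [Ne, Polynomial.map_eq_zero_iff hinj]
  have := natDegree_le_of_dvd hdvd hb'
  rw [natDegree_map_eq_of_injective hinj, natDegree_map_eq_of_injective hinj] at this
  omega

theorem AlgFiltration.mem_poly_trivial {R A : Type*} [CommRing R] [CommRing A] [Algebra R A]
    {w D : ℤ} {p : A[X]} :
    p ∈ ((AlgFiltration.trivial R A).poly w).fil D ↔ ∀ i, p.coeff i ≠ 0 → w * i ≤ D := by
  rw [AlgFiltration.mem_poly]
  simp only [AlgFiltration.mem_trivial, sub_nonneg]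

theorem AlgFiltration.natDegree_le_of_mem {k : Type*} [Field k] {D : ℕ} {p : k[X]}
    (h : p ∈ ((AlgFiltration.trivial k k).poly 1).fil D) : p.natDegree ≤ D := by
  by_cases hp : p = 0
  · simp [hp]
  · have := AlgFiltration.mem_poly_trivial.1 h p.natDegree (by simpa using hp)
    omega

theorem AlgFiltration.mem_of_natDegree_le {k : Type*} [Field k] {D : ℕ} {p : k[X]}
    (h : p.natDegree ≤ D) : p ∈ ((AlgFiltration.trivial k k).poly 1).fil D := by
  rw [AlgFiltration.mem_poly_trivial]
  intro i hi
  have := le_natDegree_of_ne_zero hi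
  omega

theorem exists_elimination {k : Type*} [Field k] {f b : k[X][X]} (hf : f.Monic)
    (hirr : Irreducible f) (hb : b ≠ 0) (hdeg : b.natDegree < f.natDegree) {E : ℕ}
    (hfE : ∀ i, (f.coeff i).natDegree ≤ E) (hbE : ∀ i, (b.coeff i).natDegree ≤ E) :
    ∃ r : k[X], r ≠ 0 ∧ r.natDegree ≤ 2 * f.natDegree * E ∧ ∃ u v, f * u + b * v = C r := by
  obtain ⟨u, v, -, -, h⟩ := exists_mul_add_mul_eq_C_resultant f b le_rfl le_rfl
    (Or.inl (by omega))
  refine ⟨_, hf.resultant_ne_zero_of_irreducible hirr hb hdeg, ?_, u, v, h⟩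
  have := (((AlgFiltration.trivial k k).poly 1)).resultant_mem (f := f) (g := b) f.natDegree
    b.natDegree (E := E) (fun i => AlgFiltration.mem_of_natDegree_le (hfE i))
    (fun i => AlgFiltration.mem_of_natDegree_le (hbE i))
  rw [← Nat.cast_mul] at this
  refine (AlgFiltration.natDegree_le_of_mem this).trans (Nat.mul_le_mul_right _ (by omega))

theorem Polynomial.exists_eq_map_C_add {k : Type*} [Field k] (f : k[X][X]) (σ : k) :
    ∃ W, f = (f.map (evalRingHom σ)).map C + C (X - C σ) * W := by
  have : C (X - C σ) ∣ f - (f.map (evalRingHom σ)).map C := by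
    rw [C_dvd_iff_dvd_coeff]
    intro i
    rw [coeff_sub, coeff_map, coeff_map]
    exact X_sub_C_dvd_sub_C_eval
  obtain ⟨W, hW⟩ := this
  exact ⟨W, by rw [← hW]; ring⟩

theorem Polynomial.rootMultiplicity_le_natDegree' {k : Type*} [Field k] {p : k[X]} (hp : p ≠ 0)
    (a : k) : p.rootMultiplicity a ≤ p.natDegree := by
  simpa using natDegree_le_of_dvd (pow_rootMultiplicity_dvd p a) hp

theorem notMem_frobenius_power {k : Type*} [Field k] {f b : k[X][X]} (hf : f.Monic)
    (hirr : Irreducible f) (hb : b ≠ 0) (hdeg : b.natDegree < f.natDegree) {E : ℕ}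
    (hfE : ∀ i, (f.coeff i).natDegree ≤ E) (hbE : ∀ i, (b.coeff i).natDegree ≤ E)
    {q : ℕ} (hq : f.natDegree * (2 * f.natDegree * E + 1) ≤ q) {σ η : k}
    (hpt : f.evalEval σ η = 0) (A A' V : k[X][X])
    (h : b = C (X - C σ) ^ q * A + (X - C (C η)) ^ q * A' + f * V) : False := by
  obtain ⟨r, hr0, hrdeg, u, v, hr⟩ := exists_elimination hf hirr hb hdeg hfE hbE
  set N := 2 * f.natDegree * E + 1 with hN
  obtain ⟨W, hW⟩ := f.exists_eq_map_C_add σ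
  set f0 := f.map (evalRingHom σ) with hf0
  have hf0m : f0.Monic := hf.map _
  obtain ⟨h0, hh0, hnd⟩ := exists_eq_pow_rootMultiplicity_mul_and_not_dvd f0 hf0m.ne_zero η
  set μ := rootMultiplicity η f0 with hμ
  obtain ⟨r1, hr1, hr1nd⟩ := exists_eq_pow_rootMultiplicity_mul_and_not_dvd r hr0 σ
  set ν := rootMultiplicity σ r with hν
  have hμd : μ ≤ f.natDegree := by
    refine (rootMultiplicity_le_natDegree' (p := f0) hf0m.ne_zero η).trans ?_
    exact natDegree_map_le
  have hνN : ν < N := by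
    have := rootMultiplicity_le_natDegree' hr0 σ
    omega
  have hNq : N ≤ q := by
    have : 1 * N ≤ f.natDegree * N := Nat.mul_le_mul_right _ (by omega)
    omega
  have hμq : μ * N ≤ q := (Nat.mul_le_mul_right _ hμd).trans hq
  set e : k[X][X] := C (X - C σ) with he
  set t : k[X][X] := X - C (C η) with ht
  set H : k[X][X] := h0.map C with hH
  have hfe : f = t ^ μ * H + e * W := by
    conv_lhs => rw [hW, hh0]
    simp [ht, hH]
  have hCr : C r = e ^ ν * C r1 := by
    conv_lhs => rw [hr1]
    simp [he]
  -- powers of `e * W` appear modulo `f`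
  obtain ⟨V', hV'⟩ : f ∣ (t ^ μ * H) ^ N - (-(e * W)) ^ N := by
    have := sub_dvd_pow_sub_pow (t ^ μ * H) (-(e * W)) N
    have h2 : t ^ μ * H - -(e * W) = f := by rw [hfe]; ring
    rwa [h2] at this
  have hprime : Prime f := hirr.prime
  have hedvd : ¬ f ∣ e ^ ν := by
    intro hd
    have hd := hprime.dvd_of_dvd_pow hd
    have hne : e ≠ 0 := by rw [he, Ne, C_eq_zero]; exact X_sub_C_ne_zero σ
    have := natDegree_le_of_dvd hd hne
    rw [he, natDegree_C] at this
    omega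
  have hkey : f ∣ e ^ ν * (H ^ N * C r1 - e ^ (N - ν) *
      (H ^ N * e ^ (q - N) * A * v + t ^ (q - μ * N) * (-W) ^ N * A' * v)) := by
    have e1 : e ^ q = e ^ ν * (e ^ (N - ν) * e ^ (q - N)) := by
      rw [← pow_add, ← pow_add]; congr 1; omega
    have e2 : e ^ N = e ^ ν * e ^ (N - ν) := by rw [← pow_add]; congr 1; omega
    have e3 : t ^ q = t ^ (q - μ * N) * (t ^ μ) ^ N := by
      rw [← pow_mul, ← pow_add]; congr 1; omega
    have e4 : H ^ N * (e ^ ν * C r1) = H ^ N * (f * u + b * v) := by rw [hr, hCr]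
    have e5 : (t ^ μ) ^ N * H ^ N = e ^ ν * e ^ (N - ν) * (-W) ^ N + f * V' := by
      rw [← e2, ← hV', ← mul_pow, ← mul_pow]; ring
    have e6 : H ^ N * b = e ^ ν * (e ^ (N - ν) * e ^ (q - N)) * A * H ^ N +
        t ^ (q - μ * N) * (e ^ ν * e ^ (N - ν) * (-W) ^ N + f * V') * A' + f * V * H ^ N := by
      rw [← e5, ← e1, h, e3]; ring
    refine ⟨H ^ N * u + v * (t ^ (q - μ * N) * V' * A' + V * H ^ N), ?_⟩
    linear_combination e4 + v * e6
  obtain ⟨Z, hZ⟩ := (hprime.dvd_or_dvd hkey).resolve_left hedvd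
  have := congrArg (evalEvalRingHom σ η) hZ
  simp only [map_sub, map_mul, map_pow, coe_evalEvalRingHom, hpt, zero_mul] at this
  have hes : e.evalEval σ η = 0 := by rw [he, evalEval_C]; simp
  rw [hes, zero_pow (by omega), zero_mul, sub_zero, evalEval_C, hH, evalEval_map_C] at this
  rcases mul_eq_zero.1 this with h1 | h1
  · exact hnd (dvd_iff_isRoot.2 (pow_eq_zero_iff (M₀ := k) (by omega) |>.1 h1))
  · exact hr1nd (dvd_iff_isRoot.2 h1)

section aevalAeval

variable {k A B : Type*} [CommRing k] [CommRing A] [Algebra k A] [CommRing B] [Algebra k B]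

theorem Polynomial.map_aevalAeval (φ : A →ₐ[k] B) (a b : A) (c : k[X][X]) :
    φ (aevalAeval a b c) = aevalAeval (φ a) (φ b) c := by
  have : φ.comp (aevalAeval a b) = aevalAeval (φ a) (φ b) := by
    ext <;> simp
  exact DFunLike.congr_fun this c

theorem Polynomial.aevalAeval_sub_mem (a b a' b' : A) (c : k[X][X]) :
    ∃ U V : A, aevalAeval a b c - aevalAeval a' b' c = (a - a') * U + (b - b') * V := by
  have : aevalAeval a b c - aevalAeval a' b' c ∈ Ideal.span {a - a', b - b'} := by
    rw [← Ideal.Quotient.eq]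
    have h1 : Ideal.Quotient.mk (Ideal.span {a - a', b - b'}) a = Ideal.Quotient.mk _ a' := by
      rw [Ideal.Quotient.eq]; exact Ideal.subset_span (by simp)
    have h2 : Ideal.Quotient.mk (Ideal.span {a - a', b - b'}) b = Ideal.Quotient.mk _ b' := by
      rw [Ideal.Quotient.eq]; exact Ideal.subset_span (by simp)
    have h3 := map_aevalAeval (Ideal.Quotient.mkₐ k (Ideal.span {a - a', b - b'})) a b c
    have h4 := map_aevalAeval (Ideal.Quotient.mkₐ k (Ideal.span {a - a', b - b'})) a' b' c
    simp only [Ideal.Quotient.mkₐ_eq_mk] at h3 h4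
    rw [h3, h4, h1, h2]
  rw [Ideal.mem_span_pair] at this
  obtain ⟨U, V, h⟩ := this
  exact ⟨U, V, by rw [← h]; ring⟩

theorem Polynomial.aevalAeval_pow_expChar_pow {p e : ℕ} [ExpChar k p] [ExpChar A p]
    {f : k[X][X]} (hf : f.map (mapRingHom (iterateFrobenius k p e)) = f) (a b : A) :
    aevalAeval (a ^ p ^ e) (b ^ p ^ e) f = (aevalAeval a b f) ^ p ^ e := by
  have : (iterateFrobenius A p e).comp (aevalAeval (R := k) a b).toRingHom =
      (aevalAeval (R := k) (a ^ p ^ e) (b ^ p ^ e)).toRingHom.comp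
        (mapRingHom (mapRingHom (iterateFrobenius k p e))) := by
    refine ringHom_ext' (ringHom_ext (fun c => ?_) ?_) ?_
    · simp [iterateFrobenius_def]
    · simp [iterateFrobenius_def]
    · simp [iterateFrobenius_def]
  have := RingHom.congr_fun this f
  simp only [RingHom.comp_apply, coe_mapRingHom, hf, iterateFrobenius_def] at this
  exact this.symm

end aevalAeval

theorem frobenius_independent {k : Type*} [Field k] [IsAlgClosed k] {p e q : ℕ} (hq : q = p ^ e)
    [ExpChar k p] {f : k[X][X]} (hf : f.Monic)
    (hirr : Irreducible f) (hfix : f.map (mapRingHom (iterateFrobenius k p e)) = f)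
    {E L : ℕ} (hfE : ∀ i, (f.coeff i).natDegree ≤ E) (hLE : L ≤ E)
    (hqE : f.natDegree * (2 * f.natDegree * E + 1) ≤ q)
    (hd : 0 < f.natDegree)
    (c : ℕ → ℕ → k[X][X]) (hc : ∀ i l, c i l = 0 ∨ (c i l).natDegree < f.natDegree)
    (hdvd : f ∣ ∑ i ∈ Finset.range L, ∑ l ∈ Finset.range f.natDegree,
      C X ^ i * X ^ l * aevalAeval (C X ^ q : k[X][X]) (X ^ q) (c i l)) :
    ∀ i < L, ∀ l < f.natDegree, c i l = 0 := by
  by_contra! hne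
  obtain ⟨i₀, hi₀, l₀, hl₀, hc₀⟩ := hne
  have hq0 : 0 < q := hq ▸ pow_pos (expChar_pos k p) e
  obtain ⟨u, v, -, -, huv⟩ := exists_mul_add_mul_eq_C_resultant f (c i₀ l₀) le_rfl le_rfl
    (Or.inl hd.ne')
  have hr := hf.resultant_ne_zero_of_irreducible hirr hc₀ ((hc i₀ l₀).resolve_left hc₀)
  set r := f.resultant (c i₀ l₀)
  obtain ⟨σ', hσ'⟩ : ∃ σ', r.eval σ' ≠ 0 := by
    by_contra! h
    exact hr (Polynomial.funext fun x => by simpa using h x)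
  obtain ⟨η', hη'⟩ : ∃ η', (f.map (evalRingHom σ')).IsRoot η' := by
    apply IsAlgClosed.exists_root
    rw [hf.degree_map, degree_eq_natDegree hf.ne_zero]
    exact_mod_cast hd.ne'
  obtain ⟨σ, hσ⟩ := IsAlgClosed.exists_pow_nat_eq σ' hq0
  obtain ⟨η, hη⟩ := IsAlgClosed.exists_pow_nat_eq η' hq0
  have hpt' : f.evalEval σ' η' = 0 := by
    rw [← map_evalRingHom_eval]; exact hη'
  have hpt : f.evalEval σ η = 0 := by
    have := aevalAeval_pow_expChar_pow hfix σ η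
    rw [← hq, hσ, hη, coe_aevalAeval_eq_evalEval, coe_aevalAeval_eq_evalEval, hpt'] at this
    exact pow_eq_zero_iff (hq0.ne') |>.1 this.symm
  have hcne : (c i₀ l₀).evalEval σ' η' ≠ 0 := by
    intro h0
    have := congrArg (evalEvalRingHom σ' η') huv
    rw [map_add, map_mul, map_mul, coe_evalEvalRingHom, hpt', h0, evalEval_C] at this
    exact hσ' (by rw [← this]; ring)
  set w : ℕ → ℕ → k := fun i l => (c i l).evalEval σ' η' with hw
  set b : k[X][X] := ∑ i ∈ Finset.range L, ∑ l ∈ Finset.range f.natDegree,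
      C X ^ i * X ^ l * C (C (w i l)) with hb
  have hb' : b = ∑ i ∈ Finset.range L, ∑ l ∈ Finset.range f.natDegree,
      monomial l (monomial i (w i l)) := by
    refine Finset.sum_congr rfl fun i _ => Finset.sum_congr rfl fun l _ => ?_
    rw [← C_mul_X_pow_eq_monomial, ← C_mul_X_pow_eq_monomial, C_mul, C_pow]; ring
  have hbc : ∀ l, b.coeff l = if l < f.natDegree then
      ∑ i ∈ Finset.range L, monomial i (w i l) else 0 := by
    intro l
    rw [hb']
    simp [finsetSum_coeff, coeff_monomial, Finset.sum_ite_eq']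
  have hb0 : b ≠ 0 := by
    intro h0
    have h1 := hbc l₀
    rw [if_pos hl₀, h0, coeff_zero] at h1
    have := congrArg (coeff · i₀) h1
    simp [finsetSum_coeff, coeff_monomial, Finset.sum_ite_eq', hi₀] at this
    exact hcne this.symm
  have hbd : b.natDegree < f.natDegree := by
    rw [natDegree_lt_iff_degree_lt hb0, degree_lt_iff_coeff_zero]
    intro m hm
    rw [hbc, if_neg (by omega)]
  have hbE : ∀ i, (b.coeff i).natDegree ≤ E := by
    intro l
    rw [hbc]
    split_ifs
    · refine natDegree_sum_le_of_forall_le _ _ fun i hi => ?_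
      refine (natDegree_monomial_le _).trans ?_
      rw [Finset.mem_range] at hi
      omega
    · simp
  have hdiff : ∀ i l, ∃ U V : k[X][X], aevalAeval (C X ^ q : k[X][X]) (X ^ q) (c i l) =
      C (C (w i l)) + C (X - C σ) ^ q * U + (X - C (C η)) ^ q * V := by
    intro i l
    obtain ⟨U, V, h⟩ := aevalAeval_sub_mem (C X ^ q : k[X][X]) (X ^ q) (C (C σ) ^ q)
      (C (C η) ^ q) (c i l)
    refine ⟨U, V, ?_⟩
    have h1 : (C X ^ q - C (C σ) ^ q : k[X][X]) = C (X - C σ) ^ q := by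
      rw [C_sub, hq, sub_pow_expChar_pow]
    have h2 : (X ^ q - C (C η) ^ q : k[X][X]) = (X - C (C η)) ^ q := by
      rw [hq, sub_pow_expChar_pow]
    have h3 : aevalAeval (C (C σ) ^ q : k[X][X]) (C (C η) ^ q) (c i l) = C (C (w i l)) := by
      have := map_aevalAeval (Algebra.ofId k k[X][X]) σ' η' (c i l)
      rw [coe_aevalAeval_eq_evalEval] at this
      rw [← C_pow, ← C_pow, ← C_pow, ← C_pow, hσ, hη]
      exact this.symm
    rw [h1, h2, h3] at h
    linear_combination h
  choose U V hUV using hdiff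
  obtain ⟨Z, hZ⟩ := hdvd
  refine notMem_frobenius_power hf hirr hb0 hbd hfE hbE hqE hpt
    (∑ i ∈ Finset.range L, ∑ l ∈ Finset.range f.natDegree, C X ^ i * X ^ l * -U i l)
    (∑ i ∈ Finset.range L, ∑ l ∈ Finset.range f.natDegree, C X ^ i * X ^ l * -V i l) Z ?_
  rw [← hZ, hb]
  simp only [hUV, Finset.mul_sum, ← Finset.sum_add_distrib]
  refine Finset.sum_congr rfl fun i _ => Finset.sum_congr rfl fun l _ => ?_
  ring

section filtration

variable {k A : Type*} [CommRing k] [CommRing A] [Algebra k A]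

theorem Polynomial.aevalAeval_eq_sum (a b : A) (c : k[X][X]) :
    aevalAeval a b c = ∑ l ∈ Finset.range (c.natDegree + 1),
      (∑ i ∈ Finset.range ((c.coeff l).natDegree + 1), (c.coeff l).coeff i • a ^ i) * b ^ l := by
  conv_lhs => rw [c.as_sum_range_C_mul_X_pow, map_sum]
  refine Finset.sum_congr rfl fun l _ => ?_
  rw [map_mul, map_pow, aevalAeval_Y, aevalAeval_C, aeval_eq_sum_range]

variable (Φ : AlgFiltration k A)

theorem AlgFiltration.eval_mem {w : ℤ} {a : A} (ha : a ∈ Φ.fil w) {D : ℤ} {c : A[X]}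
    (hc : c ∈ (Φ.poly w).fil D) : c.eval a ∈ Φ.fil D := by
  rw [eval_eq_sum_range]
  refine Submodule.sum_mem _ fun i _ => ?_
  have := Φ.mul_mem (hc i) (Φ.pow_mem ha i)
  convert this using 2
  ring

end filtration

section filtration

variable {k A : Type*} [Field k] [CommRing A] [Algebra k A]

variable (k) in
/-- The total degree filtration on bivariate polynomials. -/
noncomputable abbrev bidegree : AlgFiltration k k[X][X] :=
  ((AlgFiltration.trivial k k).poly 1).poly 1

theorem mem_bidegree {D : ℤ} {c : k[X][X]} :
    c ∈ (bidegree k).fil D ↔ ∀ l i, (c.coeff l).coeff i ≠ 0 → (i : ℤ) + l ≤ D := by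
  rw [AlgFiltration.mem_poly]
  simp only [AlgFiltration.mem_poly_trivial]
  refine forall_congr' fun l => forall_congr' fun i => ?_
  refine imp_congr_right fun _ => ?_
  constructor <;> intro h <;> linarith

theorem AlgFiltration.aevalAeval_mem (Φ : AlgFiltration k A) {a b : A} (ha : a ∈ Φ.fil 1)
    (hb : b ∈ Φ.fil 1) {D : ℤ} {c : k[X][X]} (hc : c ∈ (bidegree k).fil D) :
    aevalAeval a b c ∈ Φ.fil D := by
  rw [mem_bidegree] at hc
  rw [aevalAeval_eq_sum]
  refine Submodule.sum_mem _ fun l _ => ?_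
  rw [Finset.sum_mul]
  refine Submodule.sum_mem _ fun i _ => ?_
  rw [smul_mul_assoc]
  by_cases h0 : (c.coeff l).coeff i = 0
  · simp [h0]
  refine Submodule.smul_mem _ _ ?_
  refine Φ.mono ?_ (Φ.mul_mem (Φ.pow_mem ha i) (Φ.pow_mem hb l))
  simpa using hc l i h0

end filtration

/-- Division by a monic polynomial, as a linear map. -/
noncomputable def Polynomial.divByMonicLinear (k : Type*) {A : Type*} [CommRing k] [CommRing A]
    [Nontrivial A] [Algebra k A] (g : A[X]) (hg : g.Monic) : A[X] →ₗ[k] A[X] where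
  toFun p := p /ₘ g
  map_add' p r := (div_modByMonic_unique _ (p %ₘ g + r %ₘ g) hg ⟨by
    linear_combination modByMonic_add_div p g + modByMonic_add_div r g, by
    rw [← add_modByMonic]; exact degree_modByMonic_lt _ hg⟩).1
  map_smul' c p := (div_modByMonic_unique _ (c • (p %ₘ g)) hg ⟨by
    conv_rhs => rw [← modByMonic_add_div p g]
    rw [RingHom.id_apply, smul_add, mul_smul_comm], 
    (degree_smul_le _ _).trans_lt (degree_modByMonic_lt _ hg)⟩).1

/-- Remainder by a monic polynomial, as a linear map. -/
noncomputable def Polynomial.modByMonicLinear (k : Type*) {A : Type*} [CommRing k] [CommRing A]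
    [Nontrivial A] [Algebra k A] (g : A[X]) (hg : g.Monic) : A[X] →ₗ[k] A[X] where
  toFun p := p %ₘ g
  map_add' p r := add_modByMonic p r
  map_smul' c p := (div_modByMonic_unique (c • (p /ₘ g)) (c • (p %ₘ g)) hg ⟨by
    conv_rhs => rw [← modByMonic_add_div p g]
    rw [smul_add, mul_smul_comm], 
    (degree_smul_le _ _).trans_lt (degree_modByMonic_lt _ hg)⟩).2

section transfer

variable {k R : Type*} [Field k] [CommRing R] [Nontrivial R] [Algebra k R]

/-- The remainder after which a bivariate polynomial can be divided by the first difference. -/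
noncomputable def transferRem (g : R[X]) (hg : g.Monic) (s : R) : R[X][X] →ₗ[k] R[X] :=
  (modByMonicLinear k g hg).comp ((aeval (R := R[X]) (C s)).restrictScalars k).toLinearMap

/-- The operator replacing a multiple of the second difference by one of the first. -/
noncomputable def transfer (g : R[X]) (hg : g.Monic) (s y : R) (W : R[X][X]) :
    R[X][X] →ₗ[k] R[X][X] :=
  (LinearMap.mulLeft k (C (X - C y))).comp (divByMonicLinear k _ (monic_X_sub_C (C s))) -
    (LinearMap.mulRight k W).comp
      (((IsScalarTower.toAlgHom k R[X] R[X][X]).toLinearMap.comp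
        ((divByMonicLinear k g hg).comp
          ((aeval (R := R[X]) (C s)).restrictScalars k).toLinearMap)))

variable (g : R[X]) (hg : g.Monic) (s y : R) (W : R[X][X])

theorem transferRem_apply (B : R[X][X]) :
    transferRem (k := k) g hg s B = (B.eval (C s)) %ₘ g := rfl

theorem transfer_apply (B : R[X][X]) :
    transfer (k := k) g hg s y W B =
      C (X - C y) * (B /ₘ (X - C (C s))) - C ((B.eval (C s)) /ₘ g) * W := rfl

theorem transfer_eq {F : R[X][X]} (hF : F = (X - C (C s)) * W + C ((X - C y) * g)) (B : R[X][X]) :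
    C (X - C y) * B = (X - C (C s)) * transfer (k := k) g hg s y W B +
      C ((B.eval (C s)) /ₘ g) * F + C (X - C y) * C (transferRem (k := k) g hg s B) := by
  rw [transfer_apply, transferRem_apply, hF]
  set B' := B /ₘ (X - C (C s)) with hB'
  set b := B.eval (C s) with hb
  have h1 : C b + (X - C (C s)) * B' = B := by
    rw [hb, ← modByMonic_X_sub_C_eq_C_eval]; exact modByMonic_add_div _ _
  have h2 : b %ₘ g + g * (b /ₘ g) = b := modByMonic_add_div _ _
  have h3 : C (b %ₘ g) + C g * C (b /ₘ g) = C b := by rw [← C_mul, ← C_add, h2]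
  rw [C_mul]
  linear_combination (-C (X - C y)) * h1 - C (X - C y) * h3

theorem transfer_iterate {F : R[X][X]} (hF : F = (X - C (C s)) * W + C ((X - C y) * g))
    (u v : R) (hFuv : F.evalEval v u = 0) (B : R[X][X]) (M : ℕ)
    (hB : ∀ m < M, transferRem (k := k) g hg s ((transfer (k := k) g hg s y W ^ m) B) = 0) :
    (v - y) ^ M * B.evalEval v u =
      (u - s) ^ M * ((transfer (k := k) g hg s y W ^ M) B).evalEval v u := by
  induction M with
  | zero => simp
  | succ M ih =>
    have h1 := ih fun m hm => hB m (by omega)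
    have h2 := transfer_eq (k := k) g hg s y W hF ((transfer (k := k) g hg s y W ^ M) B)
    rw [hB M (by omega), map_zero, mul_zero, add_zero] at h2
    have h3 := congrArg (evalEvalRingHom v u) h2
    simp only [map_add, map_mul, coe_evalEvalRingHom, hFuv, mul_zero, add_zero] at h3
    rw [evalEval_C, eval_sub, eval_X, eval_C, evalEval_sub, evalEval_X, evalEval_C, eval_C] at h3
    rw [pow_succ', mul_assoc, h1, mul_left_comm, h3, pow_succ' (transfer (k := k) g hg s y W) M,
        Module.End.mul_apply]
    ring

variable (Φ : AlgFiltration k R)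

theorem transfer_mem {d : ℕ} {D : ℤ} (hgd : (g.natDegree : ℤ) = d - 1)
    (hgm : g ∈ (Φ.poly 1).fil (d - 1)) (hs : s ∈ Φ.fil 1) (hy : y ∈ Φ.fil 1)
    (hW : W ∈ ((Φ.poly 1).poly 1).fil (d - 1)) {B : R[X][X]}
    (hB : B ∈ ((Φ.poly 1).poly 1).fil D) :
    transfer (k := k) g hg s y W B ∈ ((Φ.poly 1).poly 1).fil D := by
  rw [transfer_apply]
  refine sub_mem ?_ ?_
  · have h1 : X - C y ∈ (Φ.poly 1).fil 1 := sub_mem Φ.X_mem (Φ.C_mem hy)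
    have h2 : X - C (C s) ∈ ((Φ.poly 1).poly 1).fil (1 * (X - C (C s)).natDegree) := by
      rw [natDegree_X_sub_C]
      exact sub_mem (Φ.poly 1).X_mem ((Φ.poly 1).C_mem (Φ.C_mem hs))
    have h3 := (Φ.poly 1).divByMonic_mem (monic_X_sub_C (C s)) h2 hB
    have := ((Φ.poly 1).poly 1).mul_mem ((Φ.poly 1).C_mem (w := 1) h1) h3
    convert this using 2
    rw [natDegree_X_sub_C]; simp
  · have h1 := (Φ.poly 1).eval_mem (Φ.C_mem (w := 1) hs) hB
    have h2 := Φ.divByMonic_mem hg (by rwa [hgd, one_mul]) h1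
    have := ((Φ.poly 1).poly 1).mul_mem ((Φ.poly 1).C_mem (w := 1) h2) hW
    convert this using 2
    rw [hgd]; ring

theorem transferRem_mem {d : ℕ} {D : ℤ} (hgd : (g.natDegree : ℤ) = d - 1)
    (hgm : g ∈ (Φ.poly 1).fil (d - 1)) (hs : s ∈ Φ.fil 1) {B : R[X][X]}
    (hB : B ∈ ((Φ.poly 1).poly 1).fil D) :
    transferRem (k := k) g hg s B ∈ (Φ.poly 1).fil D := by
  rw [transferRem_apply]
  have h1 := (Φ.poly 1).eval_mem (Φ.C_mem (w := 1) hs) hB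
  exact Φ.modByMonic_mem hg (by rwa [hgd, one_mul]) h1

end transfer

theorem IsAlgClosed.exists_of_pow_eq {k κ : Type*} [Field k] [IsAlgClosed k] [CommRing κ]
    [IsDomain κ] [Algebra k κ] {q : ℕ} (hq : 1 < q) {z : κ} (hz : z ^ q = z) :
    ∃ w : k, w ^ q = w ∧ algebraMap k κ w = z := by
  have hinj : Function.Injective (algebraMap k κ) := (algebraMap k κ).injective
  have hne : (X ^ q - X : k[X]) ≠ 0 := by
    have : (X ^ q - X : k[X]).coeff q = 1 := by
      rw [coeff_sub, coeff_X_pow_self, coeff_X_of_ne_one (by omega), sub_zero]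
    intro h
    rw [h] at this
    simp at this
  have h2 : ((X ^ q - X : k[X]).map (algebraMap k κ)).IsRoot z := by
    simp [IsRoot, hz]
  obtain ⟨w, hw⟩ := (IsAlgClosed.splits (X ^ q - X : k[X])).mem_range_of_isRoot hne h2
  refine ⟨w, hinj ?_, hw⟩
  rw [map_pow, hw, hz]

theorem isCoprime_of_no_rational_point {k R : Type*} [Field k] [IsAlgClosed k] [CommRing R]
    [Algebra k R] {f : k[X][X]} {s y : R} (hf : aevalAeval s y f = 0) {q : ℕ} (hq : 1 < q)
    (h : ∀ a b : k, a ^ q = a → b ^ q = b → f.evalEval a b ≠ 0) :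
    IsCoprime (s ^ q - s) (y ^ q - y) := by
  rw [← Ideal.isCoprime_span_singleton_iff, Ideal.isCoprime_iff_sup_eq]
  by_contra hne
  obtain ⟨m, hm, hle⟩ := Ideal.exists_le_maximal _ hne
  let := Ideal.Quotient.field m
  let φ := Ideal.Quotient.mkₐ k m
  have hs : φ s ^ q = φ s := by
    rw [← sub_eq_zero, ← map_pow, ← map_sub]
    exact Ideal.Quotient.eq_zero_iff_mem.2
      (hle (Ideal.mem_sup_left (Ideal.mem_span_singleton_self _)))
  have hy : φ y ^ q = φ y := by
    rw [← sub_eq_zero, ← map_pow, ← map_sub]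
    exact Ideal.Quotient.eq_zero_iff_mem.2
      (hle (Ideal.mem_sup_right (Ideal.mem_span_singleton_self _)))
  obtain ⟨a, ha, has⟩ := IsAlgClosed.exists_of_pow_eq (k := k) hq hs
  obtain ⟨b, hb, hby⟩ := IsAlgClosed.exists_of_pow_eq (k := k) hq hy
  have h1 := map_aevalAeval φ s y f
  rw [hf, map_zero, ← has, ← hby] at h1
  have h2 := map_aevalAeval (Algebra.ofId k (R ⧸ m)) a b f
  simp only [Algebra.ofId_apply] at h2
  rw [← h1, coe_aevalAeval_eq_evalEval] at h2
  exact h a b ha hb ((map_eq_zero_iff _ (algebraMap k (R ⧸ m)).injective).1 h2)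

section

variable {k R : Type*} [Field k] [CommRing R] [Algebra k R]

/-- The filtration on the coordinate ring induced by total degree. -/
noncomputable abbrev coordFiltration (s y : R) : AlgFiltration k R :=
  (bidegree k).map (aevalAeval s y)

theorem X_left_mem_bidegree : (C X : k[X][X]) ∈ (bidegree k).fil 1 :=
  AlgFiltration.C_mem _ (AlgFiltration.X_mem _)

theorem X_right_mem_bidegree : (X : k[X][X]) ∈ (bidegree k).fil 1 :=
  AlgFiltration.X_mem _

theorem left_mem_coordFiltration (s y : R) : s ∈ (coordFiltration (k := k) s y).fil 1 := by
  have := (bidegree k).map_mem (aevalAeval s y) X_left_mem_bidegree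
  rwa [aevalAeval_X] at this

theorem right_mem_coordFiltration (s y : R) : y ∈ (coordFiltration (k := k) s y).fil 1 := by
  have := (bidegree k).map_mem (aevalAeval s y) X_right_mem_bidegree
  rwa [aevalAeval_Y] at this

theorem coordFiltration_le_span {f : k[X][X]} (hf : f.Monic)
    (hfil : f ∈ (bidegree k).fil f.natDegree) {s y : R} (h0 : aevalAeval s y f = 0) (D : ℕ) :
    (coordFiltration (k := k) s y).fil D ≤ Submodule.span k (Set.range
      fun x : Fin f.natDegree × Fin (D + 1) => s ^ (x.2 : ℕ) * y ^ (x.1 : ℕ)) := by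
  rintro _ ⟨c, hc, rfl⟩
  have hc' : c %ₘ f ∈ (bidegree k).fil D :=
    AlgFiltration.modByMonic_mem _ hf (by rwa [one_mul]) hc
  have h1 : aevalAeval s y c = aevalAeval s y (c %ₘ f) := by
    conv_lhs => rw [← modByMonic_add_div c f]
    rw [map_add, map_mul, h0, zero_mul, add_zero]
  change aevalAeval s y c ∈ _
  have hdeg := degree_modByMonic_lt c hf
  rw [degree_eq_natDegree hf.ne_zero, degree_lt_iff_coeff_zero] at hdeg
  rw [mem_bidegree] at hc'
  rw [h1, aevalAeval_eq_sum]
  refine Submodule.sum_mem _ fun l _ => ?_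
  rw [Finset.sum_mul]
  refine Submodule.sum_mem _ fun i _ => ?_
  rw [smul_mul_assoc]
  by_cases hz : ((c %ₘ f).coeff l).coeff i = 0
  · simp [hz]
  refine Submodule.smul_mem _ _ (Submodule.subset_span ?_)
  have hl : l < f.natDegree := by
    by_contra hl
    rw [hdeg l (not_lt.1 hl), coeff_zero] at hz
    exact hz rfl
  have hi := hc' l i hz
  exact ⟨(⟨l, hl⟩, ⟨i, by omega⟩), rfl⟩

theorem finite_coordFiltration {f : k[X][X]} (hf : f.Monic)
    (hfil : f ∈ (bidegree k).fil f.natDegree) {s y : R} (h0 : aevalAeval s y f = 0) (D : ℕ) :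
    FiniteDimensional k ((coordFiltration (k := k) s y).fil D) ∧
    Module.finrank k ((coordFiltration (k := k) s y).fil D) ≤ f.natDegree * (D + 1) := by
  have h1 := coordFiltration_le_span hf hfil h0 D
  have h2 : FiniteDimensional k (Submodule.span k (Set.range
      fun x : Fin f.natDegree × Fin (D + 1) => s ^ (x.2 : ℕ) * y ^ (x.1 : ℕ))) :=
    FiniteDimensional.span_of_finite k (Set.finite_range _)
  refine ⟨Submodule.finiteDimensional_of_le h1, (Submodule.finrank_mono h1).trans ?_⟩
  refine (finrank_range_le_card (R := k) _).trans ?_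
  simp

end

/-- Stepanov's auxiliary polynomial: a nonzero combination of monomials whose value at the
Frobenius powers of the coordinates is divisible by a high power of `s ^ q - s`. -/
theorem exists_auxiliary {k R : Type*} [Field k] [CommRing R] [Nontrivial R]
    [Algebra k R] {f : k[X][X]} (hf : f.Monic) (hfil : f ∈ (bidegree k).fil f.natDegree)
    (hd : 0 < f.natDegree) {s y : R}
    (h0 : aevalAeval s y f = 0) {u v : R} (huv : aevalAeval u v f = 0) {L K M : ℕ}
    (hcount : M * (f.natDegree - 1) * (f.natDegree * (L + K + 2 * f.natDegree + 1)) <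
      L * f.natDegree * (K * f.natDegree)) :
    ∃ β : (Fin L × Fin f.natDegree) × (Fin K × Fin f.natDegree) → k, β ≠ 0 ∧ ∃ Ψ : R,
      (v - y) ^ M * (∑ x, β x • (s ^ (x.1.1 : ℕ) * y ^ (x.1.2 : ℕ) *
        (u ^ (x.2.1 : ℕ) * v ^ (x.2.2 : ℕ)))) = (u - s) ^ M * Ψ := by
  set d := f.natDegree with hd'
  set Φ := coordFiltration (k := k) s y with hΦ
  have hs := left_mem_coordFiltration (k := k) s y
  have hy := right_mem_coordFiltration (k := k) s y
  set fs : R[X] := aevalAeval (C s) X f with hfs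
  have hfs_map : fs = f.map (aeval s : k[X] →ₐ[k] R).toRingHom := by
    have : (aevalAeval (R := k) (C s) (X : R[X])).toRingHom =
        mapRingHom (aeval s : k[X] →ₐ[k] R).toRingHom := by
      refine ringHom_ext' (ringHom_ext (fun c => ?_) ?_) ?_
      · simp [IsScalarTower.algebraMap_apply k R R[X]]
      · simp
      · simp
    exact RingHom.congr_fun this f
  have hfsm : fs.Monic := by rw [hfs_map]; exact hf.map _
  have hfsd : fs.natDegree = d := by rw [hfs_map, hf.natDegree_map]
  have hfs_root : fs.IsRoot y := by
    have := map_aevalAeval ((aeval (R := R) y).restrictScalars k) (C s) X f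
    simp only [AlgHom.restrictScalars_apply, aeval_C, aeval_X] at this
    rw [IsRoot, ← coe_aeval_eq_eval, hfs, this]
    exact h0
  have hfs_mem : fs ∈ (Φ.poly 1).fil d :=
    (Φ.poly 1).aevalAeval_mem (Φ.C_mem hs) Φ.X_mem hfil
  set g := fs /ₘ (X - C y) with hg'
  have hfg : (X - C y) * g = fs := mul_divByMonic_eq_iff_isRoot.2 hfs_root
  have hg : g.Monic := (monic_X_sub_C y).of_mul_monic_left (by rw [hfg]; exact hfsm)
  have hgd : (g.natDegree : ℤ) = d - 1 := by
    rw [hg', natDegree_divByMonic _ (monic_X_sub_C y), hfsd, natDegree_X_sub_C]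
    push_cast [hd]; ring
  have hgm : g ∈ (Φ.poly 1).fil (d - 1) := by
    have h1 : X - C y ∈ (Φ.poly 1).fil (1 * (X - C y).natDegree) := by
      rw [natDegree_X_sub_C]
      exact sub_mem Φ.X_mem (Φ.C_mem hy)
    have := Φ.divByMonic_mem (monic_X_sub_C y) h1 hfs_mem
    rwa [natDegree_X_sub_C, Nat.cast_one, one_mul] at this
  set F : R[X][X] := aevalAeval X (C X) f with hF'
  have hF_mem : F ∈ ((Φ.poly 1).poly 1).fil d :=
    ((Φ.poly 1).poly 1).aevalAeval_mem (Φ.poly 1).X_mem ((Φ.poly 1).C_mem Φ.X_mem) hfil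
  have hF_eval : F.eval (C s) = fs := by
    have := map_aevalAeval ((aeval (R := R[X]) (C s)).restrictScalars k) X (C X) f
    simp only [AlgHom.restrictScalars_apply, aeval_C, aeval_X] at this
    rw [← coe_aeval_eq_eval, hF', this]
    rfl
  set W := F /ₘ (X - C (C s)) with hW'
  have hF : F = (X - C (C s)) * W + C ((X - C y) * g) := by
    rw [hfg, ← hF_eval, ← modByMonic_X_sub_C_eq_C_eval, add_comm]
    exact (modByMonic_add_div _ _).symm
  have hW : W ∈ ((Φ.poly 1).poly 1).fil (d - 1) := by
    have h1 : X - C (C s) ∈ ((Φ.poly 1).poly 1).fil (1 * (X - C (C s)).natDegree) := by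
      rw [natDegree_X_sub_C]
      exact sub_mem (Φ.poly 1).X_mem ((Φ.poly 1).C_mem (Φ.C_mem hs))
    have := (Φ.poly 1).divByMonic_mem (monic_X_sub_C (C s)) h1 hF_mem
    rwa [natDegree_X_sub_C, Nat.cast_one, one_mul] at this
  have hFuv : F.evalEval v u = 0 := by
    have := map_aevalAeval (((aeval (R := R) v).restrictScalars k).comp
      ((aeval (R := R[X]) (C u)).restrictScalars k)) X (C X) f
    simp only [AlgHom.comp_apply, AlgHom.restrictScalars_apply, aeval_C, aeval_X] at this
    rw [evalEval, ← coe_aeval_eq_eval, ← coe_aeval_eq_eval, hF', this]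
    simpa using huv
  set T := transfer (k := k) g hg s y W with hT
  set ρ := transferRem (k := k) g hg s with hρ
  set D := L + K + 2 * d with hD
  let mon : (Fin L × Fin d) × (Fin K × Fin d) → R[X][X] := fun x =>
    C (C (s ^ (x.1.1 : ℕ) * y ^ (x.1.2 : ℕ)) * X ^ (x.2.2 : ℕ)) * X ^ (x.2.1 : ℕ)
  have hmon : ∀ x, mon x ∈ ((Φ.poly 1).poly 1).fil D := by
    intro x
    have h1 := Φ.mul_mem (Φ.pow_mem hs x.1.1) (Φ.pow_mem hy x.1.2)
    have h2 := (Φ.poly 1).mul_mem (Φ.C_mem (w := 1) h1)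
      ((Φ.poly 1).pow_mem Φ.X_mem (x.2.2 : ℕ))
    have h3 := ((Φ.poly 1).poly 1).mul_mem ((Φ.poly 1).C_mem (w := 1) h2)
      (((Φ.poly 1).poly 1).pow_mem (Φ.poly 1).X_mem (x.2.1 : ℕ))
    refine ((Φ.poly 1).poly 1).mono ?_ h3
    have e1 := x.1.1.2
    have e2 := x.1.2.2
    have e3 := x.2.1.2
    have e4 := x.2.2.2
    push_cast [hD]
    omega
  let Bmap : ((Fin L × Fin d) × (Fin K × Fin d) → k) →ₗ[k] R[X][X] :=
    Fintype.linearCombination k mon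
  have hBmap : ∀ β, Bmap β ∈ ((Φ.poly 1).poly 1).fil D := fun β => by
    rw [Fintype.linearCombination_apply]
    exact Submodule.sum_mem _ fun x _ => Submodule.smul_mem _ _ (hmon x)
  have hTm : ∀ (m : ℕ) (β), (T ^ m) (Bmap β) ∈ ((Φ.poly 1).poly 1).fil D := by
    intro m β
    induction m with
    | zero => exact hBmap β
    | succ m ih =>
      rw [pow_succ', Module.End.mul_apply]
      exact transfer_mem g hg s y W Φ hgd hgm hs hy hW ih
  have hρm : ∀ (m : ℕ) (β), ρ ((T ^ m) (Bmap β)) ∈ (Φ.poly 1).fil D := fun m β =>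
    transferRem_mem g hg s Φ hgd hgm hs (hTm m β)
  let Λ : ((Fin L × Fin d) × (Fin K × Fin d) → k) →ₗ[k]
      (Fin M × Fin (d - 1) → Φ.fil D) := LinearMap.pi fun x =>
    LinearMap.codRestrict (Φ.fil D)
      (((lcoeff R (x.2 : ℕ)).restrictScalars k).comp (ρ.comp ((T ^ (x.1 : ℕ)).comp Bmap)))
      fun β => Φ.mono (by simp) (hρm x.1 β x.2)
  obtain ⟨hfin, hrank⟩ := finite_coordFiltration hf hfil h0 D
  have hker : LinearMap.ker Λ ≠ ⊥ := by
    apply LinearMap.ker_ne_bot_of_finrank_lt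
    rw [Module.finrank_pi_fintype, Module.finrank_fintype_fun_eq_card]
    simp only [Finset.sum_const, Finset.card_univ, Fintype.card_prod, Fintype.card_fin,
      smul_eq_mul]
    exact (Nat.mul_le_mul_left _ hrank).trans_lt hcount
  obtain ⟨β, hβ, hβ0⟩ := Submodule.exists_mem_ne_zero_of_ne_bot hker
  refine ⟨β, hβ0, ((T ^ M) (Bmap β)).evalEval v u, ?_⟩
  rw [← transfer_iterate g hg s y W hF u v hFuv (Bmap β) M]
  · congr 1
    have : Bmap β = ∑ x, β x • mon x := Fintype.linearCombination_apply _ _ _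
    rw [this, evalEval_finsetSum]
    refine Finset.sum_congr rfl fun x _ => ?_
    rw [evalEval_smul, evalEval_mul, evalEval_C, evalEval_pow, evalEval_X, eval_mul, eval_C,
      eval_pow, eval_X]
    congr 1
    ring
  · intro m hm
    have hdeg : (ρ ((T ^ m) (Bmap β))).degree < g.degree := degree_modByMonic_lt _ hg
    rw [degree_eq_natDegree hg.ne_zero, degree_lt_iff_coeff_zero] at hdeg
    ext j
    rw [coeff_zero]
    by_cases hj : j < d - 1
    · have h1 := congrFun (LinearMap.mem_ker.1 hβ) (⟨m, hm⟩, ⟨j, hj⟩)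
      exact congrArg Subtype.val h1
    · exact hdeg j (by omega)

theorem stepanov_count {d : ℕ} (hd : 0 < d) :
    (2 * d ^ 2 + d + 1) * (d - 1) * (d * (6 * d ^ 3 + 2 * d ^ 2 + 2 * d + 1)) <
      6 * d ^ 3 * d * (2 * d ^ 2 * d) := by
  obtain ⟨m, rfl⟩ : ∃ m, d = m + 1 := ⟨d - 1, by omega⟩
  rw [Nat.add_sub_cancel]
  ring_nf
  linarith [Nat.zero_le m, Nat.zero_le (m ^ 2), Nat.zero_le (m ^ 3), Nat.zero_le (m ^ 4),
    Nat.zero_le (m ^ 5), Nat.zero_le (m ^ 6)]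

/-- An absolutely irreducible plane curve over `𝔽_q` of degree small compared with `q` has a
rational point (Stepanov's method). -/
theorem exists_rational_point {k : Type*} [Field k] [IsAlgClosed k] {p e q : ℕ} (hq : q = p ^ e)
    (hq1 : 1 < q) [ExpChar k p] {f : k[X][X]} (hf : f.Monic) (hirr : Irreducible f)
    (hfix : f.map (mapRingHom (iterateFrobenius k p e)) = f)
    (hfil : f ∈ (bidegree k).fil f.natDegree) (hd : 0 < f.natDegree)
    (hqd : f.natDegree * (2 * f.natDegree * (6 * f.natDegree ^ 3) + 1) ≤ q)
    (hqL : 6 * f.natDegree ^ 3 + f.natDegree < q) :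
    ∃ s y : k, s ^ q = s ∧ y ^ q = y ∧ f.evalEval s y = 0 := by
  by_contra! hno
  set d := f.natDegree with hdd
  set K := 2 * d ^ 2 with hK
  set L := 6 * d ^ 3 with hL
  set M := K + d + 1 with hM
  have : IsDomain (AdjoinRoot f) := AdjoinRoot.isDomain_of_prime hirr.prime
  have : ExpChar (AdjoinRoot f) p :=
    expChar_of_injective_algebraMap (algebraMap k (AdjoinRoot f)).injective p
  set s : AdjoinRoot f := AdjoinRoot.mk f (C X) with hs
  set y : AdjoinRoot f := AdjoinRoot.mk f X with hy
  have hmk : ∀ c : k[X][X], aevalAeval s y c = AdjoinRoot.mk f c := by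
    intro c
    let φ : k[X][X] →ₐ[k] AdjoinRoot f := AlgHom.mk (AdjoinRoot.mk f) fun r => rfl
    have : aevalAeval s y = φ := by
      ext
      · rw [AlgHom.comp_apply]
        simp [hs]
        rfl
      · simp [hy]
        rfl
    exact DFunLike.congr_fun this c
  have h0 : aevalAeval s y f = 0 := by rw [hmk, AdjoinRoot.mk_self]
  have huv : aevalAeval (s ^ q) (y ^ q) f = 0 := by
    rw [hq, aevalAeval_pow_expChar_pow hfix, h0, zero_pow]
    rw [← hq]; omega
  obtain ⟨β, hβ, Ψ, hΨ⟩ := exists_auxiliary (L := L) (K := K) (M := M) hf hfil hd h0 huv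
    (stepanov_count hd)
  have hcop := isCoprime_of_no_rational_point h0 hq1 hno
  have hdv := (hcop.pow (m := M) (n := M)).dvd_of_dvd_mul_left (Dvd.intro Ψ hΨ.symm)
  set c : ℕ → ℕ → k[X][X] := fun i l => if h : i < L ∧ l < d then
    ∑ j : Fin K × Fin d, C (C (β ((⟨i, h.1⟩, ⟨l, h.2⟩), j)) * X ^ (j.1 : ℕ)) * X ^ (j.2 : ℕ)
      else 0 with hc
  set P : k[X][X] := ∑ i ∈ Finset.range L, ∑ l ∈ Finset.range d,
      C X ^ i * X ^ l * aevalAeval (C X ^ q : k[X][X]) (X ^ q) (c i l) with hP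
  have hPs : P = ∑ x : (Fin L × Fin d) × (Fin K × Fin d), β x •
      (C X ^ (x.1.1 : ℕ) * X ^ (x.1.2 : ℕ) *
        ((C X ^ q) ^ (x.2.1 : ℕ) * (X ^ q) ^ (x.2.2 : ℕ))) := by
    rw [hP, Finset.sum_range, Fintype.sum_prod_type, Fintype.sum_prod_type]
    refine Finset.sum_congr rfl fun i _ => ?_
    rw [Finset.sum_range]
    refine Finset.sum_congr rfl fun l _ => ?_
    rw [hc]
    simp only [i.2, l.2, and_self, dite_true]
    rw [map_sum, Finset.mul_sum]
    refine Finset.sum_congr rfl fun j _ => ?_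
    rw [map_mul, map_pow, aevalAeval_Y, aevalAeval_C, map_mul, map_pow, aeval_X, aeval_C,
      Algebra.smul_def]
    ring
  have hPfil : P ∈ (bidegree k).fil (L + d + q * (K + d) : ℕ) := by
    rw [hPs]
    refine Submodule.sum_mem _ fun x _ => Submodule.smul_mem _ _ ?_
    have hX := X_left_mem_bidegree (k := k)
    have hY := X_right_mem_bidegree (k := k)
    refine (bidegree k).mono ?_ ((bidegree k).mul_mem ((bidegree k).mul_mem
      ((bidegree k).pow_mem hX x.1.1) ((bidegree k).pow_mem hY x.1.2))
      ((bidegree k).mul_mem ((bidegree k).pow_mem ((bidegree k).pow_mem hX q) x.2.1)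
        ((bidegree k).pow_mem ((bidegree k).pow_mem hY q) x.2.2)))
    have e1 := x.1.1.2
    have e2 := x.1.2.2
    have e3 := x.2.1.2.le
    have e4 := x.2.2.2.le
    have e5 : q * ((x.2.1 : ℕ) + (x.2.2 : ℕ)) ≤ q * (K + d) :=
      Nat.mul_le_mul_left _ (by omega)
    have e6 : (x.1.1 : ℕ) * 1 + (x.1.2 : ℕ) * 1 + ((x.2.1 : ℕ) * (q * 1) + (x.2.2 : ℕ) * (q * 1))
        ≤ L + d + q * (K + d) := by linarith
    exact_mod_cast e6
  obtain ⟨U', hU'⟩ := hdv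
  obtain ⟨U, rfl⟩ := AdjoinRoot.mk_surjective U'
  have hPR : AdjoinRoot.mk f P = ∑ x, β x • (s ^ (x.1.1 : ℕ) * y ^ (x.1.2 : ℕ) *
        ((s ^ q) ^ (x.2.1 : ℕ) * (y ^ q) ^ (x.2.2 : ℕ))) := by
    rw [← hmk, hPs, map_sum]
    refine Finset.sum_congr rfl fun x _ => ?_
    rw [map_smul]
    simp only [map_mul, map_pow, aevalAeval_X, aevalAeval_Y]
  rw [← hPR] at hU'
  set w : k[X] := (X ^ q - X) ^ M with hw
  have hdvd : f ∣ P - C w * U := by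
    rw [← AdjoinRoot.mk_eq_zero, map_sub, hU', map_mul, sub_eq_zero]
    congr 1
    rw [hw, C_pow, map_pow, C_sub, map_sub, C_pow, map_pow]
  have hmod : P %ₘ f = C w * (U %ₘ f) := by
    have h1 := (modByMonic_eq_zero_iff_dvd hf).2 hdvd
    rw [sub_modByMonic, sub_eq_zero, ← smul_eq_C_mul, smul_modByMonic, smul_eq_C_mul] at h1
    exact h1
  have hPm : P %ₘ f ∈ (bidegree k).fil (L + d + q * (K + d) : ℕ) :=
    AlgFiltration.modByMonic_mem _ hf (by rwa [one_mul]) hPfil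
  have hwd : w.natDegree = M * q := by
    rw [hw, natDegree_pow]
    congr 1
    rw [natDegree_sub_eq_left_of_natDegree_lt] <;> simp [hq1]
  have hw0 : w ≠ 0 := by
    rintro h
    rw [h, natDegree_zero] at hwd
    have : 0 < M * q := by positivity
    omega
  have hU0 : U %ₘ f = 0 := by
    ext1 l
    rw [coeff_zero]
    by_contra hl
    have h2 := mem_bidegree.1 hPm l ((w * (U %ₘ f).coeff l).natDegree) (by
      rw [hmod, coeff_C_mul]
      exact leadingCoeff_ne_zero.2 (mul_ne_zero hw0 hl))
    rw [natDegree_mul hw0 hl, hwd] at h2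
    have : M * q = q * (K + d) + q := by rw [hM]; ring
    omega
  rw [hU0, mul_zero] at hmod
  have hfP := (modByMonic_eq_zero_iff_dvd hf).1 hmod
  have hcd : ∀ i l, c i l = 0 ∨ (c i l).natDegree < d := by
    intro i l
    right
    rw [hc]
    dsimp only
    split_ifs
    · rw [Nat.lt_iff_le_pred hd]
      refine natDegree_sum_le_of_forall_le _ _ fun j _ => ?_
      have := j.2.2
      exact (natDegree_C_mul_X_pow_le _ _).trans (by change _ ≤ d - 1; omega)
    · simpa using hd
  have hfE : ∀ i, (f.coeff i).natDegree ≤ L := by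
    intro i
    by_contra! hlt
    have hne : f.coeff i ≠ 0 := by rintro h; rw [h] at hlt; simp at hlt
    have := mem_bidegree.1 hfil i _ (leadingCoeff_ne_zero.2 hne)
    have h3 : d ≤ L := by
      rw [hL]
      nlinarith [Nat.le_self_pow (n := 3) (by norm_num) d]
    omega
  have hzero := frobenius_independent hq hf hirr hfix hfE le_rfl hqd hd c hcd hfP
  apply hβ
  ext x
  have h1 := hzero x.1.1 x.1.1.2 x.1.2 x.1.2.2
  have h2 := congrArg (fun r => (coeff r x.2.2).coeff x.2.1) h1
  rw [hc] at h2
  dsimp only at h2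
  rw [dif_pos ⟨x.1.1.2, x.1.2.2⟩] at h2
  simp only [finsetSum_coeff, coeff_C_mul, coeff_X_pow, mul_ite, mul_one, mul_zero] at h2
  rw [Finset.sum_eq_single x.2] at h2
  · simpa using h2
  · rintro j - hj
    split_ifs with h5
    · simp only [coeff_C_mul, coeff_X_pow, mul_ite, mul_one, mul_zero]
      split_ifs with h6
      · exact absurd (Prod.ext (Fin.ext h6.symm) (Fin.ext h5.symm)) hj
      · rfl
    · simp
  · simp

theorem exists_eval_frobenius_ne_zero {F k σ : Type*} [Field F] [Fintype F] [Field k]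
    [Algebra F k] [Fintype σ] {q n : ℕ} (hcard : Fintype.card F = q ^ n)
    (e : σ ≃ Fin n) {T : MvPolynomial σ k} (hT : T ≠ 0) (hdeg : T.totalDegree < q) :
    ∃ b : F, MvPolynomial.eval (fun u => algebraMap F k b ^ q ^ (e u : ℕ)) T ≠ 0 := by
  classical
  by_contra! h
  have hlt : ∀ m ∈ T.support, ∀ u, m u < q := fun m hm u => by
    refine lt_of_le_of_lt ?_ (lt_of_le_of_lt (MvPolynomial.le_totalDegree hm) hdeg)
    by_cases hu : u ∈ m.support
    · exact Finset.single_le_sum (f := fun i => m i) (fun _ _ => Nat.zero_le _) hu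
    · rw [Finsupp.notMem_support_iff.1 hu]; exact Nat.zero_le _
  let wt : (σ →₀ ℕ) → ℕ := fun m => ∑ u, m u * q ^ (e u : ℕ)
  have hwt : ∀ m (hm : ∀ u, m u < q),
      wt m = (finFunctionFinEquiv (fun i : Fin n => (⟨m (e.symm i), hm _⟩ : Fin q)) : ℕ) := by
    intro m hm
    rw [finFunctionFinEquiv_apply]
    exact Fintype.sum_equiv e _ _ fun u => by simp
  let P : k[X] := ∑ m ∈ T.support, C (T.coeff m) * X ^ wt m
  have hP0 : P ≠ 0 := by
    obtain ⟨m₀, hm₀⟩ := MvPolynomial.ne_zero_iff.1 hT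
    have hm₀' := MvPolynomial.mem_support_iff.2 hm₀
    intro hP
    have h1 := congrArg (coeff · (wt m₀)) hP
    simp only [P, finsetSum_coeff, coeff_C_mul, coeff_X_pow, coeff_zero, mul_ite, mul_one,
      mul_zero] at h1
    rw [Finset.sum_eq_single m₀] at h1
    · exact hm₀ (by simpa using h1)
    · intro m hm hne
      rw [if_neg]
      intro heq
      rw [hwt m₀ (hlt m₀ hm₀'), hwt m (hlt m hm)] at heq
      have h2 := finFunctionFinEquiv.injective (Fin.ext heq)
      refine hne (Finsupp.ext fun u => ?_)
      have h3 := congrArg Fin.val (congrFun h2 (e u))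
      simpa using h3.symm
    · exact fun h => absurd hm₀' h
  refine hP0 (eq_zero_of_natDegree_lt_card_of_eval_eq_zero P (f := algebraMap F k)
    (algebraMap F k).injective (fun b => ?_) ?_)
  · have h1 := h b
    rw [MvPolynomial.eval_eq'] at h1
    rw [eval_finsetSum, ← h1]
    refine Finset.sum_congr rfl fun m _ => ?_
    rw [eval_mul, eval_C, eval_pow, eval_X, ← Finset.prod_pow_eq_pow_sum]
    simp only [← pow_mul, mul_comm]
  · rw [hcard]
    have hpos : 0 < q ^ n := by rw [← hcard]; exact Fintype.card_pos
    refine lt_of_le_of_lt (natDegree_sum_le_of_forall_le (n := q ^ n - 1) _ _ fun m hm => ?_)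
      (by omega)
    refine (natDegree_C_mul_X_pow_le _ _).trans ?_
    rw [hwt m (hlt m hm)]
    have := (finFunctionFinEquiv (fun i : Fin n => (⟨m (e.symm i), hlt m hm _⟩ : Fin q))).2
    omega

/-- A combinatorial degeneration of the index set, used to specialise the norm binomial to a
polynomial having a double root. -/
def IsDegeneration {n : ℕ} (I J w a : ZMod n) (φ : ZMod n → ZMod n) : Prop :=
  φ (w + J) = φ w ∧ φ (w - J) = φ w ∧ w ≠ w - J ∧ φ (a + I) = φ a ∧ a ≠ w ∧ a + I ≠ w ∧
    (∀ u, u ≠ a → φ (u + I) ≠ φ u) ∧ ∀ u, u ≠ w → u ≠ w - J → φ (u + J) ≠ φ u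

theorem ZMod.exists_notMem {n : ℕ} [NeZero n] (s : Finset (ZMod n)) (hs : s.card < n) :
    ∃ a, a ∉ s := by
  by_contra! h
  have : s = Finset.univ := Finset.eq_univ_iff_forall.2 h
  rw [this, Finset.card_univ, ZMod.card] at hs
  exact lt_irrefl _ hs

theorem exists_degeneration {n : ℕ} (hn : 5 ≤ n) {I J : ZMod n} (hI : I ≠ 0) (hJ : J ≠ 0)
    (hIJ : I ≠ J) (hIJ' : I ≠ -J) (h2I : I + I ≠ 0) (h : J + J = 0 ∨ J + J + J ≠ 0) :
    ∃ w a φ, IsDegeneration I J w a φ := by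
  have : NeZero n := ⟨by omega⟩
  by_cases h2J : J + J = 0
  · obtain ⟨a, ha⟩ := ZMod.exists_notMem ({0, J, -I, J - I} : Finset (ZMod n))
      (lt_of_le_of_lt Finset.card_le_four (by omega))
    simp only [Finset.mem_insert, Finset.mem_singleton, not_or] at ha
    refine ⟨0, a, fun u => if u = J then 0 else if u = a + I then a else u, ?_⟩
    unfold IsDegeneration
    grind
  have h3J : J + J + J ≠ 0 := h.resolve_left h2J
  by_cases hA : J + J = I
  · refine ⟨0, -J, fun u => if u = J then 0 else if u = -J then 0 else u, ?_⟩
    unfold IsDegeneration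
    grind
  by_cases hB : J + J = -I
  · refine ⟨0, J, fun u => if u = J then 0 else if u = -J then 0 else u, ?_⟩
    unfold IsDegeneration
    grind
  have h7 : 6 < n := by
    by_contra! hn'
    interval_cases n
    · revert I J; decide
    · revert I J; decide
  obtain ⟨a, ha⟩ := ZMod.exists_notMem ({0, J, -J, -I, J - I, - J - I} : Finset (ZMod n))
      (lt_of_le_of_lt Finset.card_le_six h7)
  simp only [Finset.mem_insert, Finset.mem_singleton, not_or] at ha
  refine ⟨0, a, fun u => if u = J then 0 else if u = -J then 0 else if u = a + I then a else u, ?_⟩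
  unfold IsDegeneration
  refine ⟨?_, ?_, ?_, ?_, ?_, ?_, fun u => ?_, fun u => ?_⟩ <;> grind (splits := 20)

theorem no_persistent_coincidence {n : ℕ} {Ω : Type*} [Infinite Ω] [NeZero n] {I J : ZMod n}
    (hI : I ≠ 0) (hJ : J ≠ 0)
    (hIJ : I ≠ J) (hIJ' : I ≠ -J) (h2 : I + I ≠ 0 ∨ J + J ≠ 0) {z : ZMod n → Ω}
    (hz : Function.Injective z) {v w : ZMod n} (hvw : v ≠ w) (ρ : Ω)
    (h : ∀ x, (∃ u, Function.update (Function.update z v ρ) w x (u + I) =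
        Function.update (Function.update z v ρ) w x u) ↔
      ∃ u, Function.update (Function.update z v ρ) w x (u + J) =
        Function.update (Function.update z v ρ) w x u) : False := by
  set y := Function.update z v ρ with hy
  have hyv : ∀ a b, y a = y b → a ≠ b → a = v ∨ b = v := by
    intro a b hab hne
    by_contra! hcon
    rw [hy, Function.update_of_ne hcon.1, Function.update_of_ne hcon.2] at hab
    exact hne (hz hab)
  have hyz : ∀ a b, y v = y a → y v = y b → a ≠ v → b ≠ v → a = b := by
    intro a b ha hb hav hbv
    rw [ha, hy, Function.update_of_ne hav, Function.update_of_ne hbv] at hb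
    exact hz hb
  have hcoin : ∀ a b c d, y a = y b → y c = y d → a ≠ b → c ≠ d → (a = c ∧ b = d) ∨
      (a = d ∧ b = c) := by
    intro a b c d h1 h2 h3 h4
    have := hyv a b h1 h3
    have := hyv c d h2 h4
    grind
  classical
  obtain ⟨x₀, hx₀⟩ := Infinite.exists_notMem_finset (Finset.univ.image y)
  simp only [Finset.mem_image, Finset.mem_univ, true_and, not_exists] at hx₀
  have hstep : ∀ x K, (∃ u, Function.update y w x (u + K) = Function.update y w x u) → K ≠ 0 →
      (∃ u, u ≠ w ∧ u + K ≠ w ∧ y (u + K) = y u) ∨ y (w + K) = x ∨ y (w - K) = x := by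
    rintro x K ⟨u, hu⟩ hK
    by_cases h1 : u = w
    · subst h1
      rw [Function.update_self, Function.update_of_ne (by simpa using hK)] at hu
      tauto
    by_cases h2 : u + K = w
    · rw [h2, Function.update_self, Function.update_of_ne h1] at hu
      rw [← h2, add_sub_cancel_right]
      tauto
    rw [Function.update_of_ne h1, Function.update_of_ne h2] at hu
    exact Or.inl ⟨u, h1, h2, hu⟩
  have hmk : ∀ x K, (∃ u, u ≠ w ∧ u + K ≠ w ∧ y (u + K) = y u) →
      ∃ u, Function.update y w x (u + K) = Function.update y w x u := by
    rintro x K ⟨u, h1, h2, hu⟩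
    exact ⟨u, by rwa [Function.update_of_ne h1, Function.update_of_ne h2]⟩
  have hnone : ∀ K K', (∀ x, (∃ u, Function.update y w x (u + K) = Function.update y w x u) ↔
      ∃ u, Function.update y w x (u + K') = Function.update y w x u) → K ≠ 0 → K' ≠ 0 →
      K ≠ K' → K ≠ -K' → ¬ ∃ u, u ≠ w ∧ u + K ≠ w ∧ y (u + K) = y u := by
    rintro K K' hKK hK hK' h1 h2 ⟨u, h3, h4, h5⟩
    rcases hstep x₀ K' ((hKK x₀).1 (hmk x₀ K ⟨u, h3, h4, h5⟩)) hK' with ⟨u', h6, h7, h8⟩ | h8 | h8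
    · have := hcoin _ _ _ _ h5 h8 (by simpa using hK) (by simpa using hK')
      grind
    · exact hx₀ _ h8
    · exact hx₀ _ h8
  have hpair : ∀ K K', (∀ x, (∃ u, Function.update y w x (u + K) = Function.update y w x u) ↔
      ∃ u, Function.update y w x (u + K') = Function.update y w x u) → K ≠ 0 → K' ≠ 0 →
      K ≠ K' → K ≠ -K' → (y (w + K') = y (w + K) ∨ y (w - K') = y (w + K)) ∧
        (y (w + K') = y (w - K) ∨ y (w - K') = y (w - K)) := by
    intro K K' hKK hK hK' h1 h2
    have hno := hnone K' K (fun x => (hKK x).symm) hK' hK h1.symm (by grind)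
    constructor
    · refine (hstep _ K' ((hKK (y (w + K))).1 ⟨w, ?_⟩) hK').resolve_left hno
      rw [Function.update_self, Function.update_of_ne (by simpa using hK)]
    · refine (hstep _ K' ((hKK (y (w - K))).1 ⟨w - K, ?_⟩) hK').resolve_left hno
      rw [sub_add_cancel, Function.update_self, Function.update_of_ne (by simpa using hK)]
  have hfin : ∀ K K', K ≠ 0 → K' ≠ 0 → K ≠ K' → K ≠ -K' → K + K ≠ 0 →
      ((y (w + K') = y (w + K) ∨ y (w - K') = y (w + K)) ∧
        (y (w + K') = y (w - K) ∨ y (w - K') = y (w - K))) → False := by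
    rintro K K' hK hK' h1 h2 h3 ⟨h4, h5⟩
    have e1 : w + K ≠ w - K := by grind
    have e2 : w + K' ≠ w + K := by grind
    have e3 : w + K' ≠ w - K := by grind
    have e4 : w - K' ≠ w + K := by grind
    have e5 : w - K' ≠ w - K := by grind
    rcases h4 with h4 | h4 <;> rcases h5 with h5 | h5
    all_goals
      have := hcoin _ _ _ _ h4 h5 (by assumption) (by assumption)
      grind
  rcases h2 with h2 | h2
  · exact hfin I J hI hJ hIJ hIJ' h2 (hpair I J h hI hJ hIJ hIJ')
  · have hJI : J ≠ -I := by grind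
    exact hfin J I hJ hI hIJ.symm hJI h2 (hpair J I (fun x => (h x).symm) hJ hI hIJ.symm hJI)

section slice

variable {k σ : Type*} [Field k] [DecidableEq σ]

/-- The restriction of a polynomial to the line through `z` in the direction of the `w`-th
coordinate. -/
noncomputable def slice (z : σ → k) (w : σ) : MvPolynomial σ k →ₐ[k] k[X] :=
  MvPolynomial.aeval (Function.update (fun u => C (z u)) w X)

theorem slice_X_self (z : σ → k) (w : σ) : slice z w (MvPolynomial.X w) = X := by
  simp [slice]

theorem slice_X_of_ne (z : σ → k) {w u : σ} (h : u ≠ w) :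
    slice z w (MvPolynomial.X u) = C (z u) := by
  simp [slice, h]

theorem eval_slice (z : σ → k) (w : σ) (t : k) (H : MvPolynomial σ k) :
    (slice z w H).eval t = MvPolynomial.eval (Function.update z w t) H := by
  have : (aeval t : k[X] →ₐ[k] k).comp (slice z w) =
      MvPolynomial.aeval (Function.update z w t) := by
    ext u
    by_cases h : u = w
    · subst h; simp [slice]
    · simp [slice, h]
  have := DFunLike.congr_fun this H
  rwa [AlgHom.comp_apply, coe_aeval_eq_eval, MvPolynomial.aeval_eq_eval] at this

theorem natDegree_slice_le (z : σ → k) (w : σ) (H : MvPolynomial σ k) :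
    (slice z w H).natDegree ≤ H.degreeOf w := by
  rw [slice, MvPolynomial.aeval_def, MvPolynomial.eval₂_eq]
  refine natDegree_sum_le_of_forall_le _ _ fun m hm => ?_
  refine (natDegree_C_mul_le _ _).trans ((natDegree_prod_le _ _).trans ?_)
  refine (Finset.sum_le_sum (g := fun i => if i = w then m w else 0) fun i _ => ?_).trans ?_
  · refine natDegree_pow_le.trans ?_
    split_ifs with h
    · subst h; simp
    · simp [h]
  · rw [Finset.sum_ite_eq']
    split_ifs
    · exact MvPolynomial.monomial_le_degreeOf w hm
    · exact Nat.zero_le _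

theorem eval_update_of_degreeOf_eq_zero {H : MvPolynomial σ k} {w : σ} (h : H.degreeOf w = 0)
    (z : σ → k) (t : k) :
    MvPolynomial.eval (Function.update z w t) H = MvPolynomial.eval z H := by
  refine MvPolynomial.eval₂Hom_congr' rfl (fun i hi _ => ?_) rfl
  have : i ≠ w := by
    rintro rfl
    exact MvPolynomial.mem_vars_iff_degreeOf_ne_zero.1 hi h
  rw [Function.update_of_ne this]

theorem degreeOf_eq_zero_of_eval_update [Infinite k] [Fintype σ] {H : MvPolynomial σ k} {w : σ}
    (h : ∀ z : σ → k, Function.Injective z →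
      MvPolynomial.eval (Function.update z w 0) H = MvPolynomial.eval z H) : H.degreeOf w = 0 := by
  set H' := MvPolynomial.bind₁ (Function.update MvPolynomial.X w 0) H with hH'
  have hev : ∀ z, MvPolynomial.eval z H' = MvPolynomial.eval (Function.update z w 0) H := by
    intro z
    rw [hH', ← MvPolynomial.aeval_eq_eval, MvPolynomial.aeval_bind₁,
      ← MvPolynomial.aeval_eq_eval]
    congr 2
    ext u
    by_cases hu : u = w
    · subst hu; simp
    · simp [hu]
  have hw : H'.degreeOf w = 0 := by
    by_contra hne
    have := MvPolynomial.vars_bind₁ _ _ (MvPolynomial.mem_vars_iff_degreeOf_ne_zero.2 hne)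
    rw [Finset.mem_biUnion] at this
    obtain ⟨u, -, hu⟩ := this
    by_cases huw : u = w
    · subst huw; simp at hu
    · rw [Function.update_of_ne huw, MvPolynomial.vars_X, Finset.mem_singleton] at hu
      exact huw hu.symm
  set V : MvPolynomial σ k := ∏ a, ∏ b ∈ Finset.univ.erase a, (MvPolynomial.X a - MvPolynomial.X b)
  have hV : V ≠ 0 := by
    refine Finset.prod_ne_zero_iff.2 fun a _ => Finset.prod_ne_zero_iff.2 fun b hb => ?_
    rw [sub_ne_zero]
    exact fun h => Finset.ne_of_mem_erase hb (MvPolynomial.X_injective h).symm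
  have h0 : (H' - H) * V = 0 := by
    refine MvPolynomial.funext fun z => ?_
    rw [map_mul, map_zero]
    by_cases hz : Function.Injective z
    · rw [map_sub, hev, h z hz, sub_self, zero_mul]
    · have : ∃ a b, z a = z b ∧ a ≠ b := by
        simpa [Function.Injective] using hz
      obtain ⟨a, b, hab, hne⟩ := this
      have : MvPolynomial.eval z V = 0 := by
        simp only [V, map_prod, map_sub, MvPolynomial.eval_X]
        exact Finset.prod_eq_zero (Finset.mem_univ a) (Finset.prod_eq_zero
          (Finset.mem_erase.2 ⟨hne.symm, Finset.mem_univ b⟩) (sub_eq_zero.2 hab))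
      rw [this, mul_zero]
  rw [← sub_eq_zero.1 ((mul_eq_zero.1 h0).resolve_right hV)]
  exact hw

end slice

section normBinomial

variable {k : Type*} [Field k] {n : ℕ} [NeZero n]

/-- A linear combination of the norms of `λ ^ (q ^ I) - λ` and `λ ^ (q ^ J) - λ`, in coordinates
given by the conjugates of `λ`. -/
noncomputable def normBinomial (I J : ZMod n) (A B : k) : MvPolynomial (ZMod n) k :=
  MvPolynomial.C A * ∏ u, (MvPolynomial.X (u + I) - MvPolynomial.X u) +
    MvPolynomial.C B * ∏ u, (MvPolynomial.X (u + J) - MvPolynomial.X u)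

theorem normBinomial_comm (I J : ZMod n) (A B : k) :
    normBinomial I J A B = normBinomial J I B A := add_comm _ _

theorem eval_normBinomial (I J : ZMod n) (A B : k) (z : ZMod n → k) :
    MvPolynomial.eval z (normBinomial I J A B) =
      A * ∏ u, (z (u + I) - z u) + B * ∏ u, (z (u + J) - z u) := by
  simp [normBinomial, map_prod]

theorem degreeOf_prod_sub_le (I w : ZMod n) :
    (∏ u, (MvPolynomial.X (u + I) - MvPolynomial.X u) : MvPolynomial (ZMod n) k).degreeOf w
      ≤ 2 := by
  classical
  refine (MvPolynomial.degreeOf_prod_le _ _ _).trans ?_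
  refine (Finset.sum_le_sum (g := fun u => (if u = w - I then 1 else 0) + if u = w then 1 else 0)
    fun u _ => ?_).trans ?_
  · refine (MvPolynomial.degreeOf_sub_le _ _ _).trans ?_
    rw [MvPolynomial.degreeOf_X, MvPolynomial.degreeOf_X]
    have : w = u + I ↔ u = w - I := by grind
    simp only [this, eq_comm (a := w)]
    exact max_le (Nat.le_add_right _ _) (Nat.le_add_left _ _)
  · rw [Finset.sum_add_distrib]
    simp

theorem degreeOf_normBinomial_le (I J w : ZMod n) (A B : k) :
    (normBinomial I J A B).degreeOf w ≤ 2 :=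
  (MvPolynomial.degreeOf_add_le _ _ _).trans (max_le
    ((MvPolynomial.degreeOf_C_mul_le _ _ _).trans (degreeOf_prod_sub_le I w))
    ((MvPolynomial.degreeOf_C_mul_le _ _ _).trans (degreeOf_prod_sub_le J w)))

theorem eq_C_of_dvd_normBinomial [IsAlgClosed k] {I J : ZMod n} (hI : I ≠ 0) (hJ : J ≠ 0)
    (hIJ : I ≠ J) (hIJ' : I ≠ -J) (h2 : I + I ≠ 0 ∨ J + J ≠ 0) {A B : k} (hA : A ≠ 0)
    (hB : B ≠ 0) {H : MvPolynomial (ZMod n) k} (hdvd : H ∣ normBinomial I J A B) {w : ZMod n}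
    (hw : H.degreeOf w = 0) : ∃ c, H = MvPolynomial.C c := by
  classical
  refine ⟨_, MvPolynomial.vars_eq_empty_iff_eq_C.1 ?_⟩
  rw [Finset.eq_empty_iff_forall_notMem]
  intro v hv
  rw [MvPolynomial.mem_vars_iff_degreeOf_ne_zero] at hv
  apply hv
  apply degreeOf_eq_zero_of_eval_update
  intro z hz
  by_contra hne
  have hdeg : (slice z v H).degree ≠ 0 := by
    intro h0
    have e1 := eval_slice z v 0 H
    have e2 := eval_slice z v (z v) H
    rw [eq_C_of_degree_eq_zero h0, eval_C] at e1 e2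
    rw [Function.update_eq_self] at e2
    exact hne (e1.symm.trans e2)
  obtain ⟨ρ, hρ⟩ := IsAlgClosed.exists_root _ hdeg
  rw [IsRoot, eval_slice] at hρ
  have hvw : v ≠ w := by rintro rfl; exact hv hw
  refine no_persistent_coincidence hI hJ hIJ hIJ' h2 hz hvw ρ fun x => ?_
  have h1 := eval_update_of_degreeOf_eq_zero hw (Function.update z v ρ) x
  rw [hρ] at h1
  obtain ⟨H', hH'⟩ := hdvd
  have h3 := congrArg (MvPolynomial.eval (Function.update (Function.update z v ρ) w x)) hH'
  rw [map_mul, h1, zero_mul, eval_normBinomial] at h3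
  have key : ∀ K, (∃ u, Function.update (Function.update z v ρ) w x (u + K) =
      Function.update (Function.update z v ρ) w x u) ↔
      ∏ u, (Function.update (Function.update z v ρ) w x (u + K) -
        Function.update (Function.update z v ρ) w x u) = 0 := by
    intro K
    rw [Finset.prod_eq_zero_iff]
    simp [sub_eq_zero]
  rw [key, key]
  constructor
  · intro h4
    rw [h4, mul_zero, zero_add] at h3
    exact (mul_eq_zero.1 h3).resolve_left hB
  · intro h4
    rw [h4, mul_zero, add_zero] at h3
    exact (mul_eq_zero.1 h3).resolve_left hA

/-- At a point given by a degeneration, the norm binomial is smooth, but it has a double root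
along one of the coordinate lines. -/
theorem IsDegeneration.exists_point [Infinite k] {I J w a : ZMod n} {φ : ZMod n → ZMod n}
    (h : IsDegeneration I J w a φ) (hI : I ≠ 0) {A B : k} (hA : A ≠ 0) (hB : B ≠ 0) :
    ∃ z : ZMod n → k, (∃ κ : k, κ ≠ 0 ∧
      slice z w (normBinomial I J A B) = C κ * (X - C (z w)) ^ 2) ∧
      MvPolynomial.eval z (MvPolynomial.pderiv a (normBinomial I J A B)) ≠ 0 := by
  classical
  obtain ⟨h1, h2, h3, h4, h5, h6, h7, h8⟩ := h
  obtain ⟨ι⟩ : Nonempty (ZMod n ↪ k) :=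
    ⟨(Fintype.equivFin (ZMod n)).toEmbedding.trans
      (Fin.valEmbedding.trans (Infinite.natEmbedding k))⟩
  set z : ZMod n → k := fun u => ι (φ u) with hz
  have hI0 : a + I ≠ a := by
    simpa using hI
  have hJ0 : w + J ≠ w := by
    intro h
    apply h3
    rw [eq_sub_iff_add_eq, h]
  refine ⟨z, ⟨-B * ∏ u ∈ (Finset.univ.erase w).erase (w - J), (z (u + J) - z u), ?_, ?_⟩, ?_⟩
  · refine mul_ne_zero (neg_ne_zero.2 hB) (Finset.prod_ne_zero_iff.2 fun u hu => ?_)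
    rw [Finset.mem_erase, Finset.mem_erase] at hu
    exact sub_ne_zero.2 fun h => h8 u hu.2.1 hu.1 (ι.injective h)
  · rw [normBinomial, map_add, map_mul, map_mul, map_prod, map_prod,
      Finset.prod_eq_zero (Finset.mem_univ a), mul_zero, zero_add,
      ← Finset.mul_prod_erase _ _ (Finset.mem_univ w),
      ← Finset.mul_prod_erase _ _ (Finset.mem_erase.2 ⟨h3.symm, Finset.mem_univ (w - J)⟩)]
    · rw [Finset.prod_congr rfl (g := fun u => C (z (u + J) - z u)) fun u hu => ?_]
      · rw [← map_prod]
        simp only [map_sub, sub_add_cancel]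
        rw [slice_X_self, slice_X_of_ne z hJ0, slice_X_of_ne z h3.symm]
        have e1 : z (w + J) = z w := congrArg ι h1
        have e2 : z (w - J) = z w := congrArg ι h2
        rw [e1, e2, ← MvPolynomial.algebraMap_eq, AlgHom.commutes, ← C_eq_algebraMap, C_mul, C_neg]
        ring
      · rw [Finset.mem_erase, Finset.mem_erase] at hu
        rw [map_sub, C_sub, slice_X_of_ne z hu.2.1, slice_X_of_ne]
        rintro h
        exact hu.1 (by rw [← h, add_sub_cancel_right])
    · rw [map_sub, slice_X_of_ne z h5, slice_X_of_ne z h6, sub_eq_zero]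
      exact congrArg (fun x => C (ι x)) h4
  · have e1 : z (w + J) = z w := congrArg ι h1
    have e2 : z (w - J) = z w := congrArg ι h2
    have e4 : z (a + I) = z a := congrArg ι h4
    rw [normBinomial, map_add, map_add, MvPolynomial.pderiv_C_mul, MvPolynomial.pderiv_C_mul,
      map_mul (MvPolynomial.eval z), map_mul (MvPolynomial.eval z), MvPolynomial.eval_C,
      MvPolynomial.eval_C,
      ← Finset.mul_prod_erase _ _ (Finset.mem_univ a),
      ← Finset.mul_prod_erase _ _ (Finset.mem_univ w),
      ← Finset.mul_prod_erase _ _ (Finset.mem_erase.2 ⟨h3.symm, Finset.mem_univ (w - J)⟩)]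
    simp only [Derivation.leibniz, smul_eq_mul, map_add, map_mul, map_sub, MvPolynomial.eval_X,
      MvPolynomial.pderiv_X_self, MvPolynomial.pderiv_X_of_ne hI0, sub_add_cancel, e1, e2, e4,
      sub_self, zero_mul, mul_zero, add_zero, zero_add, map_zero, map_one]
    refine mul_ne_zero hA (mul_ne_zero ?_ (by simp))
    rw [map_prod]
    refine Finset.prod_ne_zero_iff.2 fun u hu => ?_
    rw [map_sub, MvPolynomial.eval_X, MvPolynomial.eval_X]
    exact sub_ne_zero.2 fun h => h7 u (Finset.ne_of_mem_erase hu) (ι.injective h)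

theorem irreducible_normBinomial_of_isDegeneration [IsAlgClosed k] {I J : ZMod n} (hI : I ≠ 0)
    (hJ : J ≠ 0) (hIJ : I ≠ J) (hIJ' : I ≠ -J) (h2 : I + I ≠ 0 ∨ J + J ≠ 0) {A B : k} (hA : A ≠ 0)
    (hB : B ≠ 0) {w a : ZMod n} {φ : ZMod n → ZMod n} (h : IsDegeneration I J w a φ) :
    Irreducible (normBinomial I J A B) ∧
      ∃ a, MvPolynomial.pderiv a (normBinomial I J A B) ≠ 0 := by
  classical
  obtain ⟨z, ⟨κ, hκ, hs⟩, hd⟩ := h.exists_point hI hA hB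
  have hne : C κ * (X - C (z w)) ^ 2 ≠ 0 :=
    mul_ne_zero (C_ne_zero.2 hκ) (pow_ne_zero _ (X_sub_C_ne_zero _))
  have hG0 : normBinomial I J A B ≠ 0 := by
    intro h0
    rw [h0, map_zero] at hs
    exact hne hs.symm
  refine ⟨⟨?_, ?_⟩, a, ?_⟩
  · intro hu
    have := hu.map (slice z w)
    rw [hs] at this
    have := (isUnit_of_mul_isUnit_right this)
    exact not_isUnit_X_sub_C _ ((isUnit_pow_iff two_ne_zero).1 this)
  · intro H H' hHH
    by_contra! hcon
    have hH0 : H ≠ 0 := by rintro rfl; rw [zero_mul] at hHH; exact hG0 hHH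
    have hH'0 : H' ≠ 0 := by rintro rfl; rw [mul_zero] at hHH; exact hG0 hHH
    have hunit : ∀ K : MvPolynomial (ZMod n) k, K ≠ 0 → K ∣ normBinomial I J A B → ¬ IsUnit K →
        K.degreeOf w ≠ 0 := by
      intro K hK hKd hKu hKw
      obtain ⟨c, rfl⟩ := eq_C_of_dvd_normBinomial hI hJ hIJ hIJ' h2 hA hB hKd hKw
      apply hKu
      have : c ≠ 0 := by rintro rfl; simp at hK
      exact (isUnit_iff_ne_zero.2 this).map MvPolynomial.C
    have d1 := hunit H hH0 (Dvd.intro _ hHH.symm) hcon.1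
    have d2 := hunit H' hH'0 (Dvd.intro_left _ hHH.symm) hcon.2
    have d3 := degreeOf_normBinomial_le I J w A B
    rw [hHH, MvPolynomial.degreeOf_mul_eq hH0 hH'0] at d3
    have s1 := natDegree_slice_le z w H
    have s2 := natDegree_slice_le z w H'
    rw [hHH, map_mul] at hs
    have hs0 : slice z w H * slice z w H' ≠ 0 := hs ▸ hne
    have s3 := congrArg natDegree hs
    rw [natDegree_mul (left_ne_zero_of_mul hs0) (right_ne_zero_of_mul hs0), natDegree_C_mul hκ,
      natDegree_pow, natDegree_X_sub_C] at s3
    have hroot : ∀ K K' : MvPolynomial (ZMod n) k, slice z w K * slice z w K' =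
        C κ * (X - C (z w)) ^ 2 → (slice z w K).natDegree ≠ 0 → MvPolynomial.eval z K = 0 := by
      intro K K' hKK hK
      obtain ⟨t, ht⟩ := IsAlgClosed.exists_root (slice z w K)
        (fun h => hK (natDegree_eq_of_degree_eq_some h))
      have h1 := congrArg (eval t) hKK
      rw [eval_mul, ht.eq_zero, zero_mul] at h1
      simp only [eval_mul, eval_C, eval_pow, eval_sub, eval_X] at h1
      have h2 := (mul_eq_zero.1 h1.symm).resolve_left hκ
      have h3 : t = z w := sub_eq_zero.1 (pow_eq_zero_iff two_ne_zero |>.1 h2)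
      have h4 := eval_slice z w t K
      rw [ht.eq_zero, h3, Function.update_eq_self] at h4
      exact h4.symm
    apply hd
    rw [hHH, Derivation.leibniz, smul_eq_mul, smul_eq_mul, map_add, map_mul, map_mul,
      hroot H H' hs (by omega), hroot H' H (by rw [mul_comm]; exact hs) (by omega), zero_mul,
      zero_mul, add_zero]
  · intro h0
    rw [h0, map_zero] at hd
    exact hd rfl

theorem irreducible_normBinomial [IsAlgClosed k] (hn : 5 ≤ n) {I J : ZMod n} (hI : I ≠ 0)
    (hJ : J ≠ 0) (hIJ : I ≠ J) (hIJ' : I ≠ -J) (h2 : I + I ≠ 0 ∨ J + J ≠ 0)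
    (h3 : I + I + I ≠ 0 ∨ J + J + J ≠ 0) {A B : k} (hA : A ≠ 0) (hB : B ≠ 0) :
    Irreducible (normBinomial I J A B) ∧
      ∃ a, MvPolynomial.pderiv a (normBinomial I J A B) ≠ 0 := by
  have hJI : J ≠ -I := by grind
  by_cases hcase : I + I ≠ 0 ∧ (J + J = 0 ∨ J + J + J ≠ 0)
  · obtain ⟨w, a, φ, h⟩ := exists_degeneration hn hI hJ hIJ hIJ' hcase.1 hcase.2
    exact irreducible_normBinomial_of_isDegeneration hI hJ hIJ hIJ' h2 hA hB h
  · obtain ⟨w, a, φ, h⟩ := exists_degeneration hn hJ hI hIJ.symm hJI (by grind) (by grind)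
    rw [normBinomial_comm]
    exact irreducible_normBinomial_of_isDegeneration hJ hI hIJ.symm hJI h2.symm hB hA h

end normBinomial

theorem AlgFiltration.exists_root_lift {k A : Type*} [Field k] [CommRing A] [Algebra k A]
    (Φ : AlgFiltration k A) {f : A[X][X]} (hf : f ∈ ((Φ.poly (-1)).poly 0).fil 0) {η κ : k}
    (hκ : κ ≠ 0) (h0 : X ∣ f.eval (C (algebraMap k A η)))
    (h1 : X ∣ f.derivative.eval (C (algebraMap k A η)) - C (algebraMap k A κ)) (N : ℕ) :
    ∃ Y ∈ (Φ.poly (-1)).fil 0, X ∣ Y - C (algebraMap k A η) ∧ X ^ N ∣ f.eval Y := by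
  have hη : C (algebraMap k A η) ∈ (Φ.poly (-1)).fil 0 := Φ.C_mem (Φ.algebraMap_mem η)
  induction N with
  | zero => exact ⟨_, hη, by simp, by simp⟩
  | succ N ih =>
    rcases Nat.eq_zero_or_pos N with rfl | hN
    · exact ⟨_, hη, by simp, by simpa using h0⟩
    obtain ⟨Y, hY, hYη, hYN⟩ := ih
    have hev : f.eval Y ∈ (Φ.poly (-1)).fil 0 := by
      rw [eval_eq_sum_range]
      refine Submodule.sum_mem _ fun i _ => ?_
      have h2 := (Φ.poly (-1)).mul_mem (hf i) ((Φ.poly (-1)).pow_mem hY i)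
      simpa using h2
    set c := (f.eval Y).coeff N with hc
    have hcm : c ∈ Φ.fil N := by
      have := hev N
      simpa using this
    have hkm : C (algebraMap k A κ⁻¹ * c) * X ^ N ∈ (Φ.poly (-1)).fil 0 := by
      refine Φ.C_mul_X_pow_mem ?_
      have := Φ.mul_mem (Φ.algebraMap_mem κ⁻¹) hcm
      simpa using this
    refine ⟨Y - C (algebraMap k A κ⁻¹ * c) * X ^ N, sub_mem hY hkm, ?_, ?_⟩
    · have : X ∣ C (algebraMap k A κ⁻¹ * c) * X ^ N := (dvd_pow_self _ hN.ne').mul_left _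
      have := dvd_sub hYη this
      convert this using 1
      ring
    · obtain ⟨z, hz⟩ := f.binomExpansion Y (-(C (algebraMap k A κ⁻¹ * c) * X ^ N))
      rw [sub_eq_add_neg, hz]
      have e1 : X ^ (N + 1) ∣ f.eval Y - C c * X ^ N := by
        rw [X_pow_dvd_iff] at hYN ⊢
        intro d hd
        rw [coeff_sub, coeff_C_mul_X_pow]
        split_ifs with h
        · rw [h, ← hc, sub_self]
        · rw [hYN d (by omega), sub_zero]
      have e2 : X ∣ f.derivative.eval Y - C (algebraMap k A κ) := by
        have := (hYη.trans (sub_dvd_eval_sub Y (C (algebraMap k A η)) f.derivative)).add h1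
        simpa using this
      obtain ⟨u, hu⟩ := e1
      obtain ⟨v, hv⟩ := e2
      rw [sub_eq_iff_eq_add] at hu hv
      rw [hu, hv]
      have hcan : C (algebraMap k A κ) * C (algebraMap k A κ⁻¹ * c) = C c := by
        rw [← C_mul, ← mul_assoc, ← map_mul, mul_inv_cancel₀ hκ, map_one, one_mul]
      obtain ⟨M, rfl⟩ : ∃ M, N = M + 1 := ⟨N - 1, by omega⟩
      refine ⟨u - v * C (algebraMap k A κ⁻¹ * c) +
        z * C (algebraMap k A κ⁻¹ * c) ^ 2 * X ^ M, ?_⟩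
      linear_combination -X ^ (M + 1) * hcan

theorem Polynomial.Monic.eq_prod_X_sub_C_of_isUnit_sub {R ι : Type*} [CommRing R] {p : R[X]}
    (hp : p.Monic) (s : Finset ι) (y : ι → R) (hs : p.natDegree = s.card)
    (hy : ∀ r ∈ s, p.eval (y r) = 0) (hu : ∀ r ∈ s, ∀ t ∈ s, r ≠ t → IsUnit (y r - y t)) :
    p = ∏ r ∈ s, (X - C (y r)) := by
  nontriviality R
  have hm : (∏ r ∈ s, (X - C (y r))).Monic := monic_prod_of_monic _ _ fun r _ => monic_X_sub_C _
  refine (eq_of_monic_of_dvd_of_natDegree_le hm hp ?_ ?_)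
  · refine Finset.prod_dvd_of_coprime ?_ fun r hr => dvd_iff_isRoot.2 (hy r hr)
    intro r hr t ht hrt
    exact isCoprime_X_sub_C_of_isUnit_sub (hu r hr t ht hrt)
  · rw [hs, natDegree_prod_of_monic _ _ fun r _ => monic_X_sub_C _]
    simp

theorem isUnit_mk_X_pow {k A : Type*} [Field k] [CommRing A] [Algebra k A] {Y : A[X]} {κ : k}
    (hκ : κ ≠ 0) (h : X ∣ Y - C (algebraMap k A κ)) (N : ℕ) :
    IsUnit (Ideal.Quotient.mk (Ideal.span {(X : A[X]) ^ N}) Y) := by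
  obtain ⟨v, hv⟩ := h
  rw [sub_eq_iff_eq_add'] at hv
  rw [hv, map_add]
  refine IsNilpotent.isUnit_add_left_of_commute ?_ ?_ (Commute.all _ _)
  · refine ⟨N, ?_⟩
    rw [← map_pow, Ideal.Quotient.eq_zero_iff_mem, Ideal.mem_span_singleton, mul_pow]
    exact dvd_mul_right _ _
  · exact (((isUnit_iff_ne_zero.2 hκ).map (algebraMap k A)).map C).map _

theorem Polynomial.Bivariate.coeff_coeff_swap {R : Type*} [CommRing R] (p : R[X][X]) (i j : ℕ) :
    ((Bivariate.swap p).coeff i).coeff j = (p.coeff j).coeff i := by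
  induction p using Polynomial.induction_on' with
  | add p r hp hr => simp [hp, hr]
  | monomial m a =>
    induction a using Polynomial.induction_on' with
    | add p r hp hr => simp only [map_add, coeff_add, hp, hr]
    | monomial l a =>
      rw [Bivariate.swap_monomial_monomial]
      simp only [coeff_monomial]
      split_ifs <;> simp_all [coeff_monomial]

theorem Polynomial.natDegree_coeff_le_of_dvd {R : Type*} [CommRing R] [IsDomain R] {h f : R[X][X]}
    (hd : h ∣ f) (hf : f ≠ 0) {n : ℕ} (hn : ∀ l, (f.coeff l).natDegree ≤ n) (l : ℕ) :
    (h.coeff l).natDegree ≤ n := by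
  have key : ∀ p : R[X][X], (∀ l, (p.coeff l).natDegree ≤ n) ↔
      (Bivariate.swap p).natDegree ≤ n := by
    intro p
    simp only [natDegree_le_iff_coeff_eq_zero]
    constructor
    · intro h N hN
      ext j
      rw [Bivariate.coeff_coeff_swap, h j N hN, coeff_zero]
    · intro h j N hN
      rw [← Bivariate.coeff_coeff_swap, h N hN, coeff_zero]
  obtain ⟨g, rfl⟩ := hd
  refine (key h).2 (le_trans ?_ ((key _).1 hn)) l
  rw [map_mul, natDegree_mul]
  · exact Nat.le_add_right _ _
  · rw [Ne, EmbeddingLike.map_eq_zero_iff]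
    exact left_ne_zero_of_mul hf
  · rw [Ne, EmbeddingLike.map_eq_zero_iff]
    exact right_ne_zero_of_mul hf

theorem map_mk_eq_prod {k A ι : Type*} [Field k] [CommRing A] [Algebra k A] {p : A[X][X]}
    (hp : p.Monic) (s : Finset ι) (hs : p.natDegree = s.card) {η : ι → k}
    (hη : Function.Injective η) {Y : ι → A[X]} (hY : ∀ r, X ∣ Y r - C (algebraMap k A (η r)))
    {N : ℕ} (hN : ∀ r ∈ s, X ^ N ∣ p.eval (Y r)) :
    p.map (Ideal.Quotient.mk (Ideal.span {(X : A[X]) ^ N})) =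
      (∏ r ∈ s, (X - C (Y r))).map (Ideal.Quotient.mk (Ideal.span {(X : A[X]) ^ N})) := by
  rcases subsingleton_or_nontrivial (A[X] ⧸ Ideal.span {(X : A[X]) ^ N}) with h | h
  · exact Subsingleton.elim _ _
  rw [Polynomial.map_prod]
  simp only [Polynomial.map_sub, map_X, map_C]
  refine (hp.map _).eq_prod_X_sub_C_of_isUnit_sub s _ ?_ ?_ ?_
  · rw [hp.natDegree_map, hs]
  · intro r hr
    rw [eval_map_apply, Ideal.Quotient.eq_zero_iff_mem, Ideal.mem_span_singleton]
    exact hN r hr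
  · intro r _ t _ hrt
    rw [← map_sub]
    refine isUnit_mk_X_pow (sub_ne_zero.2 (hη.ne hrt)) ?_ N
    have := dvd_sub (hY r) (hY t)
    convert this using 1
    rw [map_sub, C_sub]; ring

theorem coeff_coeff_eq_of_map_mk_eq {A : Type*} [CommRing A] {p r : A[X][X]} {N : ℕ}
    (h : p.map (Ideal.Quotient.mk (Ideal.span {(X : A[X]) ^ N})) =
      r.map (Ideal.Quotient.mk (Ideal.span {(X : A[X]) ^ N}))) (l : ℕ) {m : ℕ} (hm : m < N) :
    (p.coeff l).coeff m = (r.coeff l).coeff m := by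
  have h1 := congrArg (coeff · l) h
  simp only [coeff_map] at h1
  rw [Ideal.Quotient.eq, Ideal.mem_span_singleton, X_pow_dvd_iff] at h1
  have := h1 m hm
  rwa [coeff_sub, sub_eq_zero] at this

/-- A monic bivariate polynomial is irreducible as soon as no proper subproduct of its power series
factorization is a polynomial of small degree. -/
theorem irreducible_of_forall_subproduct {k ι : Type*} [Field k] [Fintype ι] [Nonempty ι]
    {f : k[X][X]} (hf : f.Monic) (hd : f.natDegree = Fintype.card ι) {n N : ℕ} (hN : 0 < N)
    (hn : ∀ l, (f.coeff l).natDegree ≤ n) {η : ι → k} (hη : Function.Injective η)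
    {Y : ι → k[X]} (hY : ∀ r, X ∣ Y r - C (η r)) (hfY : ∀ r, X ^ N ∣ f.eval (Y r))
    (hT : ∀ s : Finset ι, s.Nonempty → s ≠ Finset.univ → ∃ l m, n < m ∧ m < N ∧
      ((∏ r ∈ s, (X - C (Y r))).coeff l).coeff m ≠ 0) : Irreducible f := by
  classical
  rw [hf.irreducible_iff_natDegree']
  refine ⟨?_, ?_⟩
  · rintro rfl
    rw [natDegree_one] at hd
    exact Fintype.card_ne_zero hd.symm
  rintro g h hg hh hgh hmem
  rw [Finset.mem_Ioc] at hmem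
  have hdeg : g.natDegree + h.natDegree = Fintype.card ι := by
    rw [← hd, ← hgh, hg.natDegree_mul hh]
  have heval : ∀ (p : k[X][X]) (r : ι), (p.eval (Y r)).coeff 0 =
      (p.map (evalRingHom 0)).eval (η r) := by
    intro p r
    have h1 := (hY r).trans (sub_dvd_eval_sub (Y r) (C (η r)) p)
    rw [X_dvd_iff, coeff_sub, sub_eq_zero] at h1
    rw [h1, coeff_zero_eq_eval_zero, ← coe_evalRingHom, ← eval_map_apply]
    simp
  set S : k[X][X] → Finset ι := fun p =>
    Finset.univ.filter fun r => (p.map (evalRingHom 0)).eval (η r) = 0 with hS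
  have hcard : ∀ p : k[X][X], p.Monic → (S p).card ≤ p.natDegree := by
    intro p hp
    rw [← hp.natDegree_map (evalRingHom 0), ← Finset.card_image_of_injective _ hη]
    refine card_le_degree_of_subset_roots ?_
    intro x hx
    rw [Finset.mem_val, Finset.mem_image] at hx
    obtain ⟨r, hr, rfl⟩ := hx
    rw [mem_roots (hp.map _).ne_zero]
    exact (Finset.mem_filter.1 hr).2
  have hunion : S g ∪ S h = Finset.univ := by
    ext r
    simp only [hS, Finset.mem_union, Finset.mem_filter, Finset.mem_univ, true_and, iff_true]
    rw [← mul_eq_zero, ← eval_mul, ← Polynomial.map_mul, hgh, ← heval]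
    have := hfY r
    rw [X_pow_dvd_iff] at this
    exact this 0 hN
  have hc := Finset.card_union_add_card_inter (S g) (S h)
  rw [hunion, Finset.card_univ] at hc
  have c1 := hcard g hg
  have c2 := hcard h hh
  have hinter : S g ∩ S h = ∅ := Finset.card_eq_zero.1 (by omega)
  have hSh : h.natDegree = (S h).card := by omega
  obtain ⟨l, m, hm1, hm2, hne⟩ := hT (S h) (Finset.card_pos.1 (by omega)) (by
    rintro heq
    rw [heq, Finset.card_univ] at hSh
    omega)
  apply hne
  rw [← coeff_coeff_eq_of_map_mk_eq (map_mk_eq_prod hh (S h) hSh hη hY ?_) l hm2]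
  · exact coeff_eq_zero_of_natDegree_lt
      (lt_of_le_of_lt (natDegree_coeff_le_of_dvd (Dvd.intro_left _ hgh) hf.ne_zero hn l) hm1)
  · intro r hr
    have hg0 : ¬ X ∣ g.eval (Y r) := by
      rw [X_dvd_iff, heval]
      intro h0
      have : r ∈ S g ∩ S h := Finset.mem_inter.2 ⟨by simp [hS, h0], hr⟩
      rw [hinter] at this
      simp at this
    have h1 := hfY r
    rw [← hgh, eval_mul] at h1
    exact ((Prime.coprime_iff_not_dvd prime_X).2 hg0).pow_left.dvd_of_dvd_mul_left h1

section restriction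

variable {k σ : Type*} [Field k]

/-- The filtration of a multivariate polynomial ring by total degree. -/
noncomputable def totalDegreeFiltration (k σ : Type*) [Field k] :
    AlgFiltration k (MvPolynomial σ k) where
  fil D :=
    { carrier := {p | ∀ m, p.coeff m ≠ 0 → (m.degree : ℤ) ≤ D}
      add_mem' := fun {p r} hp hr m hm => by
        by_cases h : p.coeff m = 0
        · refine hr m fun h' => hm ?_
          rw [MvPolynomial.coeff_add, h, h', add_zero]
        · exact hp m h
      zero_mem' := fun m hm => by simp at hm
      smul_mem' := fun c p hp m hm => hp m fun h => hm (by
        rw [MvPolynomial.coeff_smul, h, smul_zero]) }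
  mono h p hp m hm := (hp m hm).trans h
  one_mem m hm := by
    classical
    rw [MvPolynomial.coeff_one] at hm
    have : 0 = m := by by_contra h; simp [h] at hm
    subst this
    simp
  mul_mem {a b p r} hp hr m hm := by
    classical
    rw [MvPolynomial.coeff_mul] at hm
    obtain ⟨x, hx, hne⟩ := Finset.exists_ne_zero_of_sum_ne_zero hm
    rw [Finset.HasAntidiagonal.mem_antidiagonal] at hx
    have h1 := hp x.1 (left_ne_zero_of_mul hne)
    have h2 := hr x.2 (right_ne_zero_of_mul hne)
    rw [← hx, map_add]
    push_cast
    exact add_le_add h1 h2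

theorem X_mem_totalDegreeFiltration (u : σ) :
    (MvPolynomial.X u : MvPolynomial σ k) ∈ (totalDegreeFiltration k σ).fil 1 := by
  classical
  intro m hm
  rw [MvPolynomial.coeff_X] at hm
  have : Finsupp.single u 1 = m := by by_contra h; simp [h] at hm
  subst this
  simp

theorem totalDegree_le_of_mem_filtration {D : ℕ} {p : MvPolynomial σ k}
    (h : p ∈ (totalDegreeFiltration k σ).fil D) : p.totalDegree ≤ D := by
  refine Finset.sup_le fun m hm => ?_
  have := h m (MvPolynomial.mem_support_iff.1 hm)
  rw [Finsupp.degree_apply] at this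
  exact_mod_cast this

theorem AlgFiltration.aeval_mvPolynomial_mem {B : Type*} [CommRing B] [Algebra k B]
    (Φ : AlgFiltration k B) {w : ℕ} {z : σ → B} (hz : ∀ u, z u ∈ Φ.fil w)
    {G : MvPolynomial σ k} {D : ℕ} (hG : G.totalDegree ≤ D) :
    MvPolynomial.aeval z G ∈ Φ.fil (w * D) := by
  rw [MvPolynomial.aeval_def, MvPolynomial.eval₂_eq]
  refine Submodule.sum_mem _ fun m hm => ?_
  have h1 := Φ.mul_mem (Φ.algebraMap_mem (G.coeff m))
    (Φ.prod_mem m.support (fun u => z u ^ m u) (fun u => m u * w) fun u _ => Φ.pow_mem (hz u) _)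
  refine Φ.mono ?_ h1
  rw [zero_add, ← Finset.sum_mul, mul_comm]
  refine mul_le_mul_of_nonneg_left ?_ (by positivity)
  have := (MvPolynomial.le_totalDegree hm).trans hG
  rw [Finsupp.sum] at this
  exact_mod_cast this

/-- Restriction of a polynomial to the line through `a` in direction `d`. -/
noncomputable def restrictLine (a d : σ → k) : MvPolynomial σ k →ₐ[k] k[X] :=
  MvPolynomial.aeval fun u => C (a u) + C (d u) * X

/-- Restriction of a polynomial to the plane through `a` with directions `b` and `d`. -/
noncomputable def restrictPlane (a b d : σ → k) : MvPolynomial σ k →ₐ[k] k[X][X] :=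
  MvPolynomial.aeval fun u => C (C (a u) + C (b u) * X) + C (C (d u)) * X

/-- Restriction of a polynomial to the plane through `a` with directions a generic vector
and `d`. -/
noncomputable def restrictGenericPlane (a d : σ → k) :
    MvPolynomial σ k →ₐ[k] (MvPolynomial σ k)[X][X] :=
  MvPolynomial.aeval fun u => C (C (MvPolynomial.C (a u)) + C (MvPolynomial.X u) * X) +
    C (C (MvPolynomial.C (d u))) * X

theorem map_restrictGenericPlane (a b d : σ → k) (G : MvPolynomial σ k) :
    (restrictGenericPlane a d G).map (mapRingHom (MvPolynomial.eval b)) =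
      restrictPlane a b d G := by
  have : (mapRingHom (mapRingHom (MvPolynomial.eval b))).comp
      (restrictGenericPlane a d : MvPolynomial σ k →+* (MvPolynomial σ k)[X][X]) =
      (restrictPlane a b d : MvPolynomial σ k →+* k[X][X]) := by
    refine MvPolynomial.ringHom_ext (fun c => ?_) fun u => ?_
    · simp [restrictGenericPlane, restrictPlane, MvPolynomial.algebraMap_eq,
        Polynomial.algebraMap_apply]
    · simp [restrictGenericPlane, restrictPlane]
  exact congrArg (· G) this

theorem map_eval_zero_restrictGenericPlane (a d : σ → k) (G : MvPolynomial σ k) :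
    (restrictGenericPlane a d G).map (evalRingHom 0) =
      (restrictLine a d G).map (algebraMap k (MvPolynomial σ k)) := by
  have : (mapRingHom (evalRingHom 0)).comp
      (restrictGenericPlane a d : MvPolynomial σ k →+* (MvPolynomial σ k)[X][X]) =
      (mapRingHom (algebraMap k (MvPolynomial σ k))).comp
        (restrictLine a d : MvPolynomial σ k →+* k[X]) := by
    refine MvPolynomial.ringHom_ext (fun c => ?_) fun u => ?_
    · simp [restrictGenericPlane, restrictLine, MvPolynomial.algebraMap_eq,
        Polynomial.algebraMap_apply]
    · simp [restrictGenericPlane, restrictLine, MvPolynomial.algebraMap_eq]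
  exact congrArg (· G) this

theorem restrictGenericPlane_mem (a d : σ → k) {n : ℕ} {G : MvPolynomial σ k}
    (hG : G.totalDegree ≤ n) {w : ℕ} (hw : 1 ≤ w) :
    restrictGenericPlane a d G ∈
      (((AlgFiltration.trivial k (MvPolynomial σ k)).poly 1).poly w).fil (w * n) := by
  refine AlgFiltration.aeval_mvPolynomial_mem _ (fun u => ?_) hG
  have hC : ∀ (x : MvPolynomial σ k) (D : ℤ), 0 ≤ D →
      x ∈ (AlgFiltration.trivial k (MvPolynomial σ k)).fil D := fun x D hD =>
    AlgFiltration.mem_trivial.2 fun _ => hD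
  refine add_mem (AlgFiltration.C_mem _ (add_mem (AlgFiltration.C_mem _ (hC _ _ (by omega))) ?_)) ?_
  · rw [← pow_one (X : (MvPolynomial σ k)[X])]
    exact AlgFiltration.C_mul_X_pow_mem _ (hC _ _ (by push_cast; omega))
  · rw [← pow_one (X : (MvPolynomial σ k)[X][X])]
    exact AlgFiltration.C_mul_X_pow_mem _ (AlgFiltration.C_mem _ (hC _ _ (by push_cast; omega)))

theorem restrictGenericPlane_mem_totalDegree (a d : σ → k) (G : MvPolynomial σ k) :
    restrictGenericPlane a d G ∈ (((totalDegreeFiltration k σ).poly (-1)).poly 0).fil 0 := by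
  have := AlgFiltration.aeval_mvPolynomial_mem
    (((totalDegreeFiltration k σ).poly (-1)).poly 0) (w := 0) (z := fun u =>
      C (C (MvPolynomial.C (a u)) + C (MvPolynomial.X u) * X) +
        C (C (MvPolynomial.C (d u))) * X) (fun u => ?_) (le_refl G.totalDegree)
  · simpa [restrictGenericPlane] using this
  · have hC : ∀ c : k, MvPolynomial.C c ∈ (totalDegreeFiltration k σ).fil 0 := fun c => by
      rw [← MvPolynomial.algebraMap_eq]; exact AlgFiltration.algebraMap_mem _ c
    refine add_mem (AlgFiltration.C_mem _ (add_mem (AlgFiltration.C_mem _ (hC _)) ?_)) ?_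
    · rw [← pow_one (X : (MvPolynomial σ k)[X])]
      exact AlgFiltration.C_mul_X_pow_mem _ (by simpa using X_mem_totalDegreeFiltration u)
    · rw [← pow_one (X : (MvPolynomial σ k)[X][X])]
      exact AlgFiltration.C_mul_X_pow_mem _ (AlgFiltration.C_mem _ (by simpa using hC _))

theorem restrictPlane_mem_bidegree (a b d : σ → k) {n : ℕ} {G : MvPolynomial σ k}
    (hG : G.totalDegree ≤ n) : restrictPlane a b d G ∈ (bidegree k).fil n := by
  have := AlgFiltration.aeval_mvPolynomial_mem (bidegree k) (w := 1) (z := fun u =>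
      C (C (a u) + C (b u) * X) + C (C (d u)) * X) (fun u => ?_) hG
  · simpa [restrictPlane] using this
  · rw [mem_bidegree]
    intro l i h
    rcases l with _ | _ | l
    · rcases i with _ | _ | i
      · simp
      · simp
      · simp [coeff_C, coeff_X] at h
    · rcases i with _ | i
      · simp
      · simp [coeff_C] at h
    · simp at h

end restriction

theorem Polynomial.exists_truncation {A : Type*} [CommRing A] {H : A[X][X]} (hH : H.Monic)
    {n N : ℕ} (hT : ∀ l m, n < m → m < N → (H.coeff l).coeff m = 0) :
    ∃ P : A[X][X], P.Monic ∧ P.natDegree = H.natDegree ∧ (∀ l, (P.coeff l).natDegree ≤ n) ∧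
      P.map (Ideal.Quotient.mk (Ideal.span {(X : A[X]) ^ N})) =
        H.map (Ideal.Quotient.mk (Ideal.span {(X : A[X]) ^ N})) := by
  nontriviality A
  set tr : A[X] → A[X] := fun p => ∑ i ∈ Finset.range (n + 1), C (p.coeff i) * X ^ i with htr
  have hcoeff : ∀ p i, (tr p).coeff i = if i < n + 1 then p.coeff i else 0 := by
    intro p i
    simp [htr, finsetSum_coeff, coeff_C_mul, coeff_X_pow]
  have tr0 : tr 0 = 0 := by simp [htr]
  have tr1 : tr 1 = 1 := by
    ext i
    rw [hcoeff, coeff_one]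
    split_ifs <;> first | rfl | omega
  set P : A[X][X] := ∑ l ∈ Finset.range (H.natDegree + 1), C (tr (H.coeff l)) * X ^ l with hP
  have hPc : ∀ l, P.coeff l = tr (H.coeff l) := by
    intro l
    simp only [hP, finsetSum_coeff, coeff_C_mul, coeff_X_pow, mul_ite, mul_one, mul_zero,
      Finset.sum_ite_eq, Finset.mem_range]
    split_ifs with h
    · rfl
    · rw [coeff_eq_zero_of_natDegree_lt (by omega), tr0]
  have hle : P.natDegree ≤ H.natDegree := natDegree_le_iff_coeff_eq_zero.2 fun l hl => by
    rw [hPc, coeff_eq_zero_of_natDegree_lt hl, tr0]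
  have hlead : P.coeff H.natDegree = 1 := by rw [hPc, hH.coeff_natDegree, tr1]
  refine ⟨P, monic_of_natDegree_le_of_coeff_eq_one _ hle hlead, ?_, ?_, ?_⟩
  · exact le_antisymm hle (le_natDegree_of_ne_zero (by rw [hlead]; exact one_ne_zero))
  · intro l
    rw [hPc]
    refine natDegree_le_iff_coeff_eq_zero.2 fun i hi => ?_
    rw [hcoeff, if_neg (by omega)]
  · ext l
    rw [coeff_map, coeff_map, hPc, Ideal.Quotient.eq, Ideal.mem_span_singleton, X_pow_dvd_iff]
    intro m hm
    rw [coeff_sub, hcoeff]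
    split_ifs with h
    · rw [sub_self]
    · rw [hT l m (by omega) hm, sub_zero]

/-- A partial product of the power series factors of a bivariate polynomial of bounded degree is
a divisor if it is congruent to a polynomial of bounded degree. -/
theorem dvd_of_map_mk_dvd {k A : Type*} [Field k] [CommRing A] [Algebra k A]
    {f P H : A[X][X]} {n N : ℕ}
    (hf : f ∈ (((AlgFiltration.trivial k A).poly 1).poly n).fil (n * n)) (hP : P.Monic)
    (hPn : ∀ l, (P.coeff l).natDegree ≤ n)
    (hN : n * n < N)
    (hPH : P.map (Ideal.Quotient.mk (Ideal.span {(X : A[X]) ^ N})) =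
      H.map (Ideal.Quotient.mk (Ideal.span {(X : A[X]) ^ N})))
    (hHf : H.map (Ideal.Quotient.mk (Ideal.span {(X : A[X]) ^ N})) ∣
      f.map (Ideal.Quotient.mk (Ideal.span {(X : A[X]) ^ N}))) : P ∣ f := by
  nontriviality A
  rw [← modByMonic_eq_zero_iff_dvd hP]
  have h1 : (f %ₘ P).map (Ideal.Quotient.mk (Ideal.span {(X : A[X]) ^ N})) = 0 := by
    rw [map_modByMonic _ hP, modByMonic_eq_zero_iff_dvd (hP.map _), hPH]
    exact hHf
  have h2 := AlgFiltration.modByMonic_mem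
    (Φ := (AlgFiltration.trivial k A).poly 1) (w := n) hP (fun l => ?_) hf
  · ext l m
    rw [coeff_zero, coeff_zero]
    by_contra hne
    have h3 := AlgFiltration.mem_poly_trivial.1 (h2 l) m hne
    have h4 : m < N := by
      have : (m : ℤ) ≤ n * n := by nlinarith
      have : m ≤ n * n := by exact_mod_cast this
      omega
    have h5 := coeff_coeff_eq_of_map_mk_eq (r := 0) (by rw [h1, Polynomial.map_zero]) l h4
    simp only [coeff_zero] at h5
    exact hne h5
  · rw [AlgFiltration.mem_poly_trivial]
    intro m hm
    rcases lt_trichotomy l P.natDegree with hl | rfl | hl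
    · have h3 := (le_natDegree_of_ne_zero hm).trans (hPn l)
      have : (l : ℤ) + 1 ≤ P.natDegree := by exact_mod_cast hl
      have : (m : ℤ) ≤ n := by exact_mod_cast h3
      nlinarith
    · rw [hP.coeff_natDegree, coeff_one] at hm
      have : m = 0 := by by_contra h; simp [h] at hm
      subst this
      simp
    · rw [coeff_eq_zero_of_natDegree_lt hl] at hm
      simp at hm

section genericPlane

variable {k σ : Type*} [Field k]

/-- The change of variables inverse to passing to the generic plane. -/
noncomputable def fromGenericPlane (a d : σ → k) :
    (MvPolynomial σ k)[X][X] →+* (MvPolynomial σ k)[X] :=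
  eval₂RingHom (eval₂RingHom (MvPolynomial.aeval (R := k) fun u =>
    C (MvPolynomial.X u - MvPolynomial.C (a u)) -
      C (MvPolynomial.C (d u)) * X : MvPolynomial σ k →+* (MvPolynomial σ k)[X]) 1) X

theorem fromGenericPlane_restrictGenericPlane (a d : σ → k) (G : MvPolynomial σ k) :
    fromGenericPlane a d (restrictGenericPlane a d G) = C G := by
  have : (fromGenericPlane a d).comp
      (restrictGenericPlane a d : MvPolynomial σ k →+* (MvPolynomial σ k)[X][X]) = C := by
    refine MvPolynomial.ringHom_ext (fun c => ?_) fun u => ?_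
    · simp [restrictGenericPlane, fromGenericPlane, MvPolynomial.algebraMap_eq,
        Polynomial.algebraMap_apply]
    · simp only [restrictGenericPlane, fromGenericPlane, RingHom.comp_apply, RingHom.coe_coe,
        MvPolynomial.aeval_X, map_add, map_mul, coe_eval₂RingHom, eval₂_C, eval₂_X,
        map_sub, MvPolynomial.aeval_C, Polynomial.algebraMap_apply, MvPolynomial.algebraMap_eq]
      ring
  exact congrArg (· G) this

theorem isUnit_map_of_isUnit_fromGenericPlane (a d : σ → k) {P : (MvPolynomial σ k)[X][X]}
    (h : IsUnit (fromGenericPlane a d P)) :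
    IsUnit (P.map (eval₂RingHom (MvPolynomial.eval 0) 1 : (MvPolynomial σ k)[X] →+* k)) := by
  have key : (eval₂RingHom (restrictLine a d : MvPolynomial σ k →+* k[X]) X).comp
      (fromGenericPlane a d) =
      mapRingHom (eval₂RingHom (MvPolynomial.eval 0) 1 : (MvPolynomial σ k)[X] →+* k) := by
    refine ringHom_ext' (ringHom_ext' (MvPolynomial.ringHom_ext (fun c => ?_) fun u => ?_) ?_) ?_
    · simp [restrictLine, fromGenericPlane, Polynomial.algebraMap_apply,
        MvPolynomial.algebraMap_eq]
    · simp [restrictLine, fromGenericPlane]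
    · simp [fromGenericPlane]
    · simp [fromGenericPlane]
  have := h.map (eval₂RingHom (restrictLine a d : MvPolynomial σ k →+* k[X]) X)
  rw [← RingHom.comp_apply, key] at this
  exact this

theorem exists_coeff_subproduct_ne_zero {ι : Type*} [Fintype ι] {G : MvPolynomial σ k}
    (hG : Irreducible G) {a d : σ → k} (hf : (restrictGenericPlane a d G).Monic)
    (hd : (restrictGenericPlane a d G).natDegree = Fintype.card ι)
    (hdeg : G.totalDegree ≤ Fintype.card ι) {N : ℕ}
    (hN : Fintype.card ι * Fintype.card ι < N) {η : ι → k}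
    (hη : Function.Injective η) {Y : ι → (MvPolynomial σ k)[X]}
    (hY : ∀ r, X ∣ Y r - C (algebraMap k _ (η r)))
    (hfY : ∀ r, X ^ N ∣ (restrictGenericPlane a d G).eval (Y r)) {s : Finset ι}
    (hs : s.Nonempty) (hs' : s ≠ Finset.univ) :
    ∃ l m, Fintype.card ι < m ∧ m < N ∧
      ((∏ r ∈ s, (X - C (Y r))).coeff l).coeff m ≠ 0 := by
  classical
  by_contra! hcon
  set f := restrictGenericPlane a d G with hfdef
  set n := Fintype.card ι with hn
  have hHm : (∏ r ∈ s, (X - C (Y r))).Monic := monic_prod_of_monic _ _ fun r _ => monic_X_sub_C _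
  have hHd : (∏ r ∈ s, (X - C (Y r))).natDegree = s.card := by
    rw [natDegree_prod_of_monic _ _ fun r _ => monic_X_sub_C _]
    simp
  obtain ⟨P, hPm, hPd, hPn, hPH⟩ := exists_truncation hHm hcon
  rw [hHd] at hPd
  have hscard : 0 < s.card := Finset.card_pos.2 hs
  have hscard' : s.card < n := by
    rw [hn]; exact (Finset.card_lt_iff_ne_univ s).2 hs'
  have hfac : P ∣ f := by
    refine dvd_of_map_mk_dvd (k := k) (n := n) (N := N)
      (restrictGenericPlane_mem a d hdeg (w := n) (by omega)) hPm hPn hN hPH ?_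
    rw [map_mk_eq_prod hf Finset.univ hd hη hY fun r _ => hfY r]
    exact Polynomial.map_dvd _ (Finset.prod_dvd_prod_of_subset _ _ _ (Finset.subset_univ s))
  obtain ⟨U, hU⟩ := hfac
  have hUm : U.Monic := hPm.of_mul_monic_left (hU ▸ hf)
  have hUd : s.card + U.natDegree = n := by
    rw [← hd, hU, hPm.natDegree_mul hUm, hPd]
  have hfrom := fromGenericPlane_restrictGenericPlane a d G
  rw [← hfdef, hU, map_mul] at hfrom
  have hne : fromGenericPlane a d P * fromGenericPlane a d U ≠ 0 := by
    rw [hfrom]; exact C_ne_zero.2 hG.ne_zero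
  have hdeg0 := congrArg natDegree hfrom
  rw [natDegree_mul (left_ne_zero_of_mul hne) (right_ne_zero_of_mul hne), natDegree_C] at hdeg0
  obtain ⟨P', hP'⟩ := natDegree_eq_zero.1 (show (fromGenericPlane a d P).natDegree = 0 by omega)
  obtain ⟨U', hU'⟩ := natDegree_eq_zero.1 (show (fromGenericPlane a d U).natDegree = 0 by omega)
  rw [← hP', ← hU', ← C_mul] at hfrom
  have hnu : ∀ (Q : (MvPolynomial σ k)[X][X]) (Q' : MvPolynomial σ k), Q.Monic → 0 < Q.natDegree →
      C Q' = fromGenericPlane a d Q → ¬ IsUnit Q' := by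
    intro Q Q' hQ hQd hQQ hu
    have h1 := isUnit_map_of_isUnit_fromGenericPlane a d (hQQ ▸ hu.map C)
    have h2 := natDegree_eq_zero_of_isUnit h1
    rw [hQ.natDegree_map] at h2
    omega
  rcases hG.isUnit_or_isUnit (C_injective hfrom).symm with h | h
  · exact hnu P P' hPm (by omega) hP' h
  · exact hnu U U' hUm (by omega) hU' h

end genericPlane

/-- An explicit Bertini theorem: the planes containing a given line which is transverse to an
irreducible hypersurface meet it in an irreducible curve, outside a hypersurface of
bounded degree. -/
theorem exists_forall_irreducible_restrictPlane {k σ : Type*} [Field k] [IsAlgClosed k]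
    {G : MvPolynomial σ k}
    (hG : Irreducible G) {a d : σ → k} {n : ℕ} (hn : 0 < n)
    (hf : (restrictGenericPlane a d G).Monic) (hd : (restrictGenericPlane a d G).natDegree = n)
    (hdeg : G.totalDegree ≤ n) (hsep : (restrictLine a d G).Separable) :
    ∃ T : MvPolynomial σ k, T ≠ 0 ∧ T.totalDegree ≤ 2 ^ n * (n * n) ∧
      ∀ b, MvPolynomial.eval b T ≠ 0 → Irreducible (restrictPlane a b d G) := by
  classical
  set f := restrictGenericPlane a d G with hfdef
  set g := restrictLine a d G with hg
  have hfg : f.map (evalRingHom 0) = g.map (algebraMap k (MvPolynomial σ k)) :=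
    map_eval_zero_restrictGenericPlane a d G
  have hgd : g.natDegree = n := by
    rw [← hd, ← hf.natDegree_map (evalRingHom 0), hfg,
      natDegree_map_eq_of_injective (algebraMap k (MvPolynomial σ k)).injective]
  have hcard : Fintype.card g.roots.toFinset = n := by
    rw [Fintype.card_coe, Multiset.toFinset_card_of_nodup (nodup_roots hsep), ← hgd]
    exact (splits_iff_card_roots.1 (IsAlgClosed.splits g))
  have hX : ∀ (p : (MvPolynomial σ k)[X][X]) (x : k),
      X ∣ p.eval (C (algebraMap k (MvPolynomial σ k) x)) -
        C ((p.map (evalRingHom 0)).eval (algebraMap k (MvPolynomial σ k) x)) := by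
    intro p x
    rw [X_dvd_iff, coeff_sub, coeff_C_zero, coeff_zero_eq_eval_zero, ← coe_evalRingHom,
      ← eval_map_apply]
    simp
  have hev : ∀ (p : k[X]) (x : k),
      (p.map (algebraMap k (MvPolynomial σ k))).eval (algebraMap k (MvPolynomial σ k) x) =
        algebraMap k _ (p.eval x) := fun p x => by
    rw [eval_map_apply]
  have hlift : ∀ r : g.roots.toFinset, ∃ Y ∈ ((totalDegreeFiltration k σ).poly (-1)).fil 0,
      X ∣ Y - C (algebraMap k (MvPolynomial σ k) r) ∧ X ^ (n * n + 1) ∣ f.eval Y := by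
    rintro ⟨x, hx⟩
    have hx0 : g.eval x = 0 := by
      rw [Multiset.mem_toFinset] at hx
      exact (mem_roots'.1 hx).2
    have hx1 : g.derivative.eval x ≠ 0 := hsep.eval₂_derivative_ne_zero (RingHom.id k) hx0
    refine AlgFiltration.exists_root_lift _ (restrictGenericPlane_mem_totalDegree a d G) hx1
      ?_ ?_ _
    · have := hX f x
      rwa [hfg, hev, hx0, map_zero, C_0, sub_zero] at this
    · have := hX (derivative f) x
      rwa [← derivative_map, hfg, derivative_map, hev] at this
  choose Y hYf hYη hYN using hlift
  have hcoeff : ∀ s : Finset g.roots.toFinset, s.Nonempty → s ≠ Finset.univ →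
      ∃ l m, n < m ∧ m < n * n + 1 ∧ ((∏ r ∈ s, (X - C (Y r))).coeff l).coeff m ≠ 0 := by
    intro s hs hs'
    have := exists_coeff_subproduct_ne_zero (ι := g.roots.toFinset) hG hf (by rw [hcard, hd])
      (by rw [hcard]; exact hdeg) (N := n * n + 1) (by rw [hcard]; omega)
      (η := fun r => (r : k)) Subtype.val_injective hYη hYN hs hs'
    rwa [hcard] at this
  have htot : ∀ (s : Finset g.roots.toFinset) (l m : ℕ),
      (((∏ r ∈ s, (X - C (Y r))).coeff l).coeff m).totalDegree ≤ m := by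
    intro s l m
    refine totalDegree_le_of_mem_filtration ?_
    have h1 := (((totalDegreeFiltration k σ).poly (-1)).poly 0).prod_mem s
      (fun r => X - C (Y r)) (fun _ => 0) fun r _ =>
      sub_mem (AlgFiltration.X_mem _) (AlgFiltration.C_mem _ (hYf r))
    have h2 := h1 l m
    simpa using h2
  choose! l m hm1 hm2 hne using hcoeff
  set S : Finset (Finset g.roots.toFinset) :=
    Finset.univ.filter fun s => s.Nonempty ∧ s ≠ Finset.univ with hS
  have hScard : S.card ≤ 2 ^ n := by
    refine (Finset.card_le_univ _).trans ?_
    rw [Fintype.card_finset, hcard]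
  refine ⟨∏ s ∈ S, ((∏ r ∈ s, (X - C (Y r))).coeff (l s)).coeff (m s), ?_, ?_, ?_⟩
  · refine Finset.prod_ne_zero_iff.2 fun s hs => ?_
    rw [hS, Finset.mem_filter] at hs
    exact hne s hs.2.1 hs.2.2
  · refine (MvPolynomial.totalDegree_finsetProd _ _).trans ?_
    refine (Finset.sum_le_card_nsmul S _ (n * n) fun s hs => ?_).trans ?_
    · rw [hS, Finset.mem_filter] at hs
      have := hm2 s hs.2.1 hs.2.2
      exact (htot s _ _).trans (by omega)
    · rw [smul_eq_mul]
      exact Nat.mul_le_mul_right _ hScard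
  · intro b hb
    rw [map_prod, Finset.prod_ne_zero_iff] at hb
    have hmap : f.map (mapRingHom (MvPolynomial.eval b)) = restrictPlane a b d G :=
      map_restrictGenericPlane a b d G
    have : Nonempty g.roots.toFinset := Fintype.card_pos_iff.1 (by omega)
    refine irreducible_of_forall_subproduct (ι := g.roots.toFinset) (n := n) (N := n * n + 1)
      (η := fun r => (r : k)) (Y := fun r => (Y r).map (MvPolynomial.eval b)) ?_ ?_ (by omega) ?_
      Subtype.val_injective ?_ ?_ ?_
    · rw [← hmap]; exact hf.map _
    · rw [← hmap, hf.natDegree_map, hd, hcard]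
    · intro l
      have h1 := mem_bidegree.1 (restrictPlane_mem_bidegree a b d hdeg) l
      refine natDegree_le_iff_coeff_eq_zero.2 fun i hi => ?_
      by_contra hne
      have := h1 i hne
      omega
    · intro r
      have := map_dvd (mapRingHom (MvPolynomial.eval b)) (hYη r)
      simpa [MvPolynomial.algebraMap_eq] using this
    · intro r
      have := map_dvd (mapRingHom (MvPolynomial.eval b)) (hYN r)
      rw [map_pow, coe_mapRingHom, map_X] at this
      rwa [← hmap, map_mapRingHom_eval_map]
    · intro s hs hs'
      refine ⟨l s, m s, hm1 s hs hs', hm2 s hs hs', ?_⟩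
      have h1 := hb s (Finset.mem_filter.2 ⟨Finset.mem_univ s, hs, hs'⟩)
      have h2 : ∏ r ∈ s, (X - C ((Y r).map (MvPolynomial.eval b))) =
          (∏ r ∈ s, (X - C (Y r))).map (mapRingHom (MvPolynomial.eval b)) := by
        simp [Polynomial.map_prod]
      rw [h2, coeff_map, coe_mapRingHom, coeff_map]
      exact h1

section genericLine

variable {k σ : Type*} [Field k]

/-- Restriction of a polynomial to the line in direction `d` through a generic point. -/
noncomputable def restrictGenericLine (d : σ → k) :
    MvPolynomial σ k →ₐ[k] (MvPolynomial σ k)[X] :=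
  MvPolynomial.aeval fun u => C (MvPolynomial.X u) + C (MvPolynomial.C (d u)) * X

theorem map_eval_restrictGenericLine (a d : σ → k) (G : MvPolynomial σ k) :
    (restrictGenericLine d G).map (MvPolynomial.eval a) = restrictLine a d G := by
  have : (mapRingHom (MvPolynomial.eval a)).comp
      (restrictGenericLine d : MvPolynomial σ k →+* (MvPolynomial σ k)[X]) =
      (restrictLine a d : MvPolynomial σ k →+* k[X]) := by
    refine MvPolynomial.ringHom_ext (fun c => ?_) fun u => ?_
    · simp [restrictGenericLine, restrictLine, MvPolynomial.algebraMap_eq,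
        Polynomial.algebraMap_apply]
    · simp [restrictGenericLine, restrictLine]
  exact congrArg (· G) this

theorem map_aeval_restrictGenericLine (a d : σ → k) (G : MvPolynomial σ k) :
    (restrictGenericLine d G).map (MvPolynomial.aeval fun u =>
      C (MvPolynomial.C (a u)) + C (MvPolynomial.X u) * X :
        MvPolynomial σ k →ₐ[k] (MvPolynomial σ k)[X]).toRingHom = restrictGenericPlane a d G := by
  have : (mapRingHom (MvPolynomial.aeval fun u =>
      C (MvPolynomial.C (a u)) + C (MvPolynomial.X u) * X :
        MvPolynomial σ k →ₐ[k] (MvPolynomial σ k)[X]).toRingHom).comp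
      (restrictGenericLine d : MvPolynomial σ k →+* (MvPolynomial σ k)[X]) =
      (restrictGenericPlane a d : MvPolynomial σ k →+* (MvPolynomial σ k)[X][X]) := by
    refine MvPolynomial.ringHom_ext (fun c => ?_) fun u => ?_
    · simp [restrictGenericLine, restrictGenericPlane, MvPolynomial.algebraMap_eq,
        Polynomial.algebraMap_apply]
    · simp [restrictGenericLine, restrictGenericPlane, Polynomial.algebraMap_apply,
        MvPolynomial.algebraMap_eq]
  exact congrArg (· G) this

/-- The automorphism translating the coordinates along `d` by a multiple of the variable. -/
noncomputable def shear (d : σ → k) : (MvPolynomial σ k)[X] →+* (MvPolynomial σ k)[X] :=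
  eval₂RingHom (restrictGenericLine d : MvPolynomial σ k →+* (MvPolynomial σ k)[X]) X

theorem shear_comp_shear (d : σ → k) : (shear d).comp (shear (-d)) = RingHom.id _ := by
  refine ringHom_ext' (MvPolynomial.ringHom_ext (fun c => ?_) fun u => ?_) ?_
  · simp [shear, restrictGenericLine, MvPolynomial.algebraMap_eq,
        Polynomial.algebraMap_apply]
  · simp [shear, restrictGenericLine, MvPolynomial.algebraMap_eq,
        Polynomial.algebraMap_apply]
    ring
  · simp [shear]

theorem irreducible_restrictGenericLine {G : MvPolynomial σ k} (hG : Irreducible G) (d : σ → k) :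
    Irreducible (restrictGenericLine d G) := by
  have h2 := shear_comp_shear (-d)
  rw [neg_neg] at h2
  let e : (MvPolynomial σ k)[X] ≃+* (MvPolynomial σ k)[X] :=
    RingEquiv.ofRingHom (shear d) (shear (-d)) (shear_comp_shear d) h2
  have h1 : e (C G) = restrictGenericLine d G := by
    simp [e, shear]
  rw [← h1, MulEquiv.irreducible_iff]
  exact (prime_C_iff.2 hG.prime).irreducible

theorem eval_zero_derivative_restrictGenericLine [Fintype σ] (d : σ → k) (G : MvPolynomial σ k) :
    (derivative (restrictGenericLine d G)).eval 0 =
      ∑ u, MvPolynomial.C (d u) * MvPolynomial.pderiv u G := by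
  classical
  have h0 : ∀ p : MvPolynomial σ k, (restrictGenericLine d p).eval 0 = p := by
    intro p
    have : (evalRingHom 0).comp
        (restrictGenericLine d : MvPolynomial σ k →+* (MvPolynomial σ k)[X]) = RingHom.id _ := by
      refine MvPolynomial.ringHom_ext (fun c => ?_) fun u => ?_
      · simp [restrictGenericLine, MvPolynomial.algebraMap_eq, Polynomial.algebraMap_apply]
      · simp [restrictGenericLine]
    exact congrArg (· p) this
  induction G using MvPolynomial.induction_on with
  | C c => simp [restrictGenericLine, Polynomial.algebraMap_apply]
  | add p r hp hr => simp [hp, hr, mul_add, Finset.sum_add_distrib]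
  | mul_X p v hp =>
    rw [map_mul, derivative_mul, eval_add, eval_mul, eval_mul, hp, h0, h0]
    have h1 : (derivative (restrictGenericLine d (MvPolynomial.X v))).eval 0 =
        MvPolynomial.C (d v) := by
      simp [restrictGenericLine]
    rw [h1]
    simp only [Derivation.leibniz, smul_eq_mul, mul_add, Finset.sum_add_distrib,
      MvPolynomial.pderiv_X, Pi.single_apply, mul_ite, mul_one, mul_zero, Finset.sum_ite_eq,
      Finset.mem_univ, if_true]
    rw [Finset.sum_mul, add_comm]
    congr 1
    · simp [mul_comm]
    · exact Finset.sum_congr rfl fun u _ => by ring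

/-- Lines in a direction `d` along which an irreducible polynomial is not constant are generically
transverse to the hypersurface. -/
theorem exists_forall_separable_restrictLine [Fintype σ] {G : MvPolynomial σ k}
    (hG : Irreducible G) {d : σ → k} {n : ℕ} (hf : (restrictGenericLine d G).Monic)
    (hd : (restrictGenericLine d G).natDegree = n) (hdeg : G.totalDegree ≤ n)
    (hder : ∑ u, MvPolynomial.C (d u) * MvPolynomial.pderiv u G ≠ 0) :
    ∃ T : MvPolynomial σ k, T ≠ 0 ∧ T.totalDegree ≤ 2 * n * n ∧
      ∀ a, MvPolynomial.eval a T ≠ 0 → (restrictLine a d G).Separable := by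
  set f := restrictGenericLine d G with hfdef
  have hder0 : derivative f ≠ 0 := by
    intro h
    rw [← eval_zero_derivative_restrictGenericLine, ← hfdef, h, eval_zero] at hder
    exact hder rfl
  have hpos : f.natDegree ≠ 0 := fun h => hder0 (derivative_of_natDegree_zero h)
  have hlt : (derivative f).natDegree < f.natDegree := natDegree_derivative_lt hpos
  have hcoeff : ∀ i, f.coeff i ∈ (totalDegreeFiltration k σ).fil n := by
    intro i
    have := AlgFiltration.aeval_mvPolynomial_mem ((totalDegreeFiltration k σ).poly 0) (w := 1)
      (z := fun u => C (MvPolynomial.X u) + C (MvPolynomial.C (d u)) * X) (fun u => ?_) hdeg i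
    · simpa [hfdef, restrictGenericLine] using this
    · refine add_mem (AlgFiltration.C_mem _ (by simpa using X_mem_totalDegreeFiltration u)) ?_
      rw [← pow_one (X : (MvPolynomial σ k)[X])]
      refine AlgFiltration.C_mul_X_pow_mem _ (AlgFiltration.mono _ (a := 0) (by simp) ?_)
      rw [← MvPolynomial.algebraMap_eq]
      exact AlgFiltration.algebraMap_mem _ _
  have hcoeff' : ∀ i, (derivative f).coeff i ∈ (totalDegreeFiltration k σ).fil n := by
    intro i
    rw [coeff_derivative, mul_comm]
    have : ((i : MvPolynomial σ k) + 1) * f.coeff (i + 1) = (i + 1) • f.coeff (i + 1) := by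
      simp [nsmul_eq_mul]
    rw [this]
    exact nsmul_mem (hcoeff _) _
  refine ⟨f.resultant (derivative f), hf.resultant_ne_zero_of_irreducible
    (irreducible_restrictGenericLine hG d) hder0 hlt, ?_, ?_⟩
  · refine totalDegree_le_of_mem_filtration
      ((totalDegreeFiltration k σ).mono ?_ (AlgFiltration.resultant_mem _ _ _ hcoeff hcoeff'))
    rw [← Nat.cast_mul, Nat.cast_le]
    exact Nat.mul_le_mul_right _ (by omega)
  · intro a ha
    obtain ⟨p, r, -, -, h⟩ := exists_mul_add_mul_eq_C_resultant f (derivative f) le_rfl le_rfl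
      (Or.inl hpos)
    have h1 := congrArg (Polynomial.map (MvPolynomial.eval a)) h
    rw [Polynomial.map_add, Polynomial.map_mul, Polynomial.map_mul, ← derivative_map,
      map_eval_restrictGenericLine, map_C] at h1
    refine ⟨C (MvPolynomial.eval a (f.resultant (derivative f)))⁻¹ *
      p.map (MvPolynomial.eval a), C (MvPolynomial.eval a (f.resultant (derivative f)))⁻¹ *
      r.map (MvPolynomial.eval a), ?_⟩
    have h2 : C (MvPolynomial.eval a (f.resultant (derivative f)))⁻¹ *
        C (MvPolynomial.eval a (f.resultant (derivative f))) = 1 := by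
      rw [← C_mul, inv_mul_cancel₀ ha, C_1]
    rw [← h1] at h2
    linear_combination h2

end genericLine

section normBinomial

variable {k : Type*} [Field k] {n : ℕ} [NeZero n]

theorem aeval_normBinomial {R : Type*} [CommRing R] [Algebra k R] (I J : ZMod n) (A B : k)
    (z : ZMod n → R) : MvPolynomial.aeval z (normBinomial I J A B) =
      algebraMap k R A * ∏ u, (z (u + I) - z u) + algebraMap k R B * ∏ u, (z (u + J) - z u) := by
  simp [normBinomial, map_prod]

theorem totalDegree_normBinomial_le (I J : ZMod n) (A B : k) :
    (normBinomial I J A B).totalDegree ≤ n := by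
  have key : ∀ (c : k) (K : ZMod n),
      (MvPolynomial.C c * ∏ u, (MvPolynomial.X (u + K) - MvPolynomial.X u) :
        MvPolynomial (ZMod n) k).totalDegree ≤ n := by
    intro c K
    refine (MvPolynomial.totalDegree_mul _ _).trans ?_
    rw [MvPolynomial.totalDegree_C, zero_add]
    refine (MvPolynomial.totalDegree_finsetProd _ _).trans ?_
    refine (Finset.sum_le_card_nsmul _ _ 1 fun u _ => ?_).trans ?_
    · refine (MvPolynomial.totalDegree_sub _ _).trans ?_
      simp
    · simp
  exact (MvPolynomial.totalDegree_add _ _).trans (max_le (key _ _) (key _ _))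

theorem restrictGenericLine_normBinomial_monic (I J : ZMod n) (A B : k) {d : ZMod n → k}
    (hd : MvPolynomial.eval d (normBinomial I J A B) = 1) :
    (restrictGenericLine d (normBinomial I J A B)).Monic ∧
      (restrictGenericLine d (normBinomial I J A B)).natDegree = n := by
  have hlin : ∀ (K u : ZMod n), (C (MvPolynomial.X (u + K)) + C (MvPolynomial.C (d (u + K))) * X -
      (C (MvPolynomial.X u) + C (MvPolynomial.C (d u)) * X) : (MvPolynomial (ZMod n) k)[X]) =
      C (MvPolynomial.C (d (u + K) - d u)) * X + C (MvPolynomial.X (u + K) - MvPolynomial.X u) := by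
    intro K u
    simp only [map_sub]
    ring
  have hdeg : ∀ (K u : ZMod n), (C (MvPolynomial.X (u + K)) + C (MvPolynomial.C (d (u + K))) * X -
      (C (MvPolynomial.X u) + C (MvPolynomial.C (d u)) * X) :
        (MvPolynomial (ZMod n) k)[X]).natDegree ≤ 1 := by
    intro K u
    rw [hlin]
    exact natDegree_linear_le
  have hcoeff : ∀ K : ZMod n, (∏ u, (C (MvPolynomial.X (u + K)) +
      C (MvPolynomial.C (d (u + K))) * X - (C (MvPolynomial.X u) + C (MvPolynomial.C (d u)) * X) :
        (MvPolynomial (ZMod n) k)[X])).coeff n = MvPolynomial.C (∏ u, (d (u + K) - d u)) := by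
    intro K
    have := coeff_prod_of_natDegree_le (Finset.univ : Finset (ZMod n)) _ 1 fun u _ => hdeg K u
    rw [Finset.card_univ, ZMod.card, mul_one] at this
    rw [this, map_prod]
    refine Finset.prod_congr rfl fun u _ => ?_
    rw [hlin]
    simp [coeff_C]
  have hdeg' : ∀ K : ZMod n, (∏ u, (C (MvPolynomial.X (u + K)) +
      C (MvPolynomial.C (d (u + K))) * X - (C (MvPolynomial.X u) + C (MvPolynomial.C (d u)) * X) :
        (MvPolynomial (ZMod n) k)[X])).natDegree ≤ n := by
    intro K
    refine (natDegree_prod_le _ _).trans ((Finset.sum_le_card_nsmul _ _ 1 fun u _ =>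
      hdeg K u).trans ?_)
    simp
  have hlead : (restrictGenericLine d (normBinomial I J A B)).coeff n = 1 := by
    rw [restrictGenericLine, aeval_normBinomial, coeff_add, Polynomial.algebraMap_apply,
      Polynomial.algebraMap_apply, coeff_C_mul, coeff_C_mul, hcoeff, hcoeff,
      MvPolynomial.algebraMap_eq, ← map_mul, ← map_mul, ← map_add, ← eval_normBinomial, hd, map_one]
  have hle : (restrictGenericLine d (normBinomial I J A B)).natDegree ≤ n := by
    rw [restrictGenericLine, aeval_normBinomial, Polynomial.algebraMap_apply,
      Polynomial.algebraMap_apply]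
    exact natDegree_add_le_of_degree_le ((natDegree_C_mul_le _ _).trans (hdeg' _))
      ((natDegree_C_mul_le _ _).trans (hdeg' _))
  exact ⟨monic_of_natDegree_le_of_coeff_eq_one _ hle hlead,
    le_antisymm hle (le_natDegree_of_ne_zero (by rw [hlead]; exact one_ne_zero))⟩

/-- The norm binomial is invariant under a twist of the coefficients combined with a cyclic shift
of the coordinates. -/
theorem map_restrictPlane_normBinomial (τ : k →+* k) (I J : ZMod n) {A B : k} (hA : τ A = A)
    (hB : τ B = B) {a b d : ZMod n → k} (ha : ∀ u, τ (a u) = a (u + 1))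
    (hb : ∀ u, τ (b u) = b (u + 1)) (hd : ∀ u, τ (d u) = d (u + 1)) :
    (restrictPlane a b d (normBinomial I J A B)).map (mapRingHom τ) =
      restrictPlane a b d (normBinomial I J A B) := by
  have hC : ∀ c : k, algebraMap k k[X][X] c = C (C c) := fun c => by
    simp [Polynomial.algebraMap_apply]
  have key : ∀ K : ZMod n, ∏ u, (C (C (τ (a (u + K))) + C (τ (b (u + K))) * X) +
        C (C (τ (d (u + K)))) * X - (C (C (τ (a u)) + C (τ (b u)) * X) + C (C (τ (d u))) * X)) =
      ∏ u, (C (C (a (u + K)) + C (b (u + K)) * X) + C (C (d (u + K))) * X -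
        (C (C (a u) + C (b u) * X) + C (C (d u)) * X)) := by
    intro K
    refine Fintype.prod_equiv (Equiv.addRight 1) _ _ fun u => ?_
    simp only [ha, hb, hd, Equiv.coe_addRight, add_right_comm u K 1]
  have hmap : (restrictPlane a b d (normBinomial I J A B)).map (mapRingHom τ) =
      C (C A) * ∏ u, (C (C (τ (a (u + I))) + C (τ (b (u + I))) * X) +
        C (C (τ (d (u + I)))) * X - (C (C (τ (a u)) + C (τ (b u)) * X) + C (C (τ (d u))) * X)) +
      C (C B) * ∏ u, (C (C (τ (a (u + J))) + C (τ (b (u + J))) * X) +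
        C (C (τ (d (u + J)))) * X -
          (C (C (τ (a u)) + C (τ (b u)) * X) + C (C (τ (d u))) * X)) := by
    rw [restrictPlane, aeval_normBinomial, hC, hC]
    simp [Polynomial.map_prod, hA, hB]
  rw [hmap, key, key, restrictPlane, aeval_normBinomial, hC, hC]

end normBinomial

theorem evalEval_restrictPlane {k σ : Type*} [Field k] (a b d : σ → k) (G : MvPolynomial σ k) (s y
    : k) :
    (restrictPlane a b d G).evalEval s y =
      MvPolynomial.eval (fun u => a u + b u * s + d u * y) G := by
  have : (evalEvalRingHom s y).comp
      (restrictPlane a b d : MvPolynomial σ k →+* k[X][X]) =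
      MvPolynomial.eval (fun u => a u + b u * s + d u * y) := by
    refine MvPolynomial.ringHom_ext (fun c => ?_) fun u => ?_
    · simp [restrictPlane, Polynomial.algebraMap_apply]
    · simp [restrictPlane]
  exact congrArg (· G) this

/-- The vector of conjugates of `x` under the powers of the `q`-Frobenius. -/
def conjugates {n : ℕ} {K : Type*} [Monoid K] (q : ℕ) (x : K) (u : ZMod n) : K :=
  x ^ q ^ u.val

section conjugates

variable {n q : ℕ} {K : Type*} [CommRing K]

theorem pow_pow_mod_eq {x : K} (hx : x ^ q ^ n = x) (m : ℕ) : x ^ q ^ (m % n) = x ^ q ^ m := by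
  have h1 : ∀ j : ℕ, x ^ q ^ (n * j) = x := by
    intro j
    induction j with
    | zero => simp
    | succ j ih => rw [Nat.mul_succ, pow_add, pow_mul, ih, hx]
  conv_rhs => rw [← Nat.div_add_mod m n, pow_add, pow_mul, h1]

theorem conjugates_add_natCast [NeZero n] {x : K} (hx : x ^ q ^ n = x) (u : ZMod n) (m : ℕ) :
    conjugates q x (u + (m : ZMod n)) = (x ^ q ^ m) ^ q ^ u.val := by
  rw [conjugates, ZMod.val_add, ZMod.val_natCast, Nat.add_mod_mod, pow_pow_mod_eq hx,
    ← pow_mul, ← pow_add, add_comm]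

theorem conjugates_natCast [NeZero n] {x : K} (hx : x ^ q ^ n = x) (m : ℕ) :
    conjugates q x (m : ZMod n) = x ^ q ^ m := by
  rw [conjugates, ZMod.val_natCast, pow_pow_mod_eq hx]

theorem conjugates_add_one [NeZero n] {x : K} (hx : x ^ q ^ n = x) (u : ZMod n) :
    conjugates q x u ^ q = conjugates q x (u + 1) := by
  have := conjugates_add_natCast hx u 1
  rw [Nat.cast_one] at this
  rw [this, conjugates, pow_one, ← pow_mul, ← pow_mul, mul_comm]

theorem conjugates_add {p e : ℕ} [ExpChar K p] (hq : q = p ^ e) (x y : K) (u : ZMod n) :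
    conjugates q (x + y) u = conjugates q x u + conjugates q y u := by
  rw [conjugates, conjugates, conjugates, hq, ← pow_mul, add_pow_expChar_pow]

theorem conjugates_mul (x y : K) (u : ZMod n) :
    conjugates q (x * y) u = conjugates q x u * conjugates q y u := mul_pow _ _ _

theorem conjugates_of_pow_eq {x : K} (hx : x ^ q = x) (u : ZMod n) : conjugates q x u = x := by
  rw [conjugates]
  induction u.val with
  | zero => simp
  | succ m ih => rw [pow_succ, pow_mul, ih, hx]

end conjugates

theorem exists_eval_conjugates_ne_zero {F k : Type*} [Field F] [Fintype F] [Field k]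
    [Algebra F k] {q n : ℕ} [NeZero n] (hcard : Fintype.card F = q ^ n)
    {T : MvPolynomial (ZMod n) k} (hT : T ≠ 0) (hdeg : T.totalDegree < q) :
    ∃ b : F, MvPolynomial.eval (conjugates q (algebraMap F k b)) T ≠ 0 :=
  exists_eval_frobenius_ne_zero hcard
    { toFun := fun u => ⟨u.val, ZMod.val_lt u⟩
      invFun := fun i => (i : ℕ)
      left_inv := fun u => ZMod.natCast_zmod_val u
      right_inv := fun i => Fin.ext (ZMod.val_natCast_of_lt i.2) } hT hdeg

theorem exists_algebraMap_eq_of_pow_eq {F k : Type*} [Field F] [Fintype F] [Field k]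
    [Algebra F k] {q n : ℕ} [NeZero n] (hcard : Fintype.card F = q ^ n) {s : k} (hs : s ^ q = s) :
    ∃ t : F, algebraMap F k t = s := by
  have h1 : s ^ q ^ n = s := by
    have := conjugates_of_pow_eq (n := n + 1) hs (n : ZMod (n + 1))
    rwa [conjugates, ZMod.val_natCast_of_lt (Nat.lt_succ_self n)] at this
  have h2 : (aeval s) (X ^ Fintype.card F - X : F[X]) = 0 := by
    rw [hcard]; simp [h1]
  have hm : (X ^ Fintype.card F - X : F[X]).Monic :=
    monic_X_pow_sub (by simpa using Fintype.one_lt_card (α := F))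
  rw [← prod_multiset_X_sub_C_of_monic_of_roots_card_eq hm (by
    rw [FiniteField.roots_X_pow_card_sub_X,
      FiniteField.X_pow_card_sub_X_natDegree_eq F Fintype.one_lt_card]; rfl),
    FiniteField.roots_X_pow_card_sub_X] at h2
  change aeval s (∏ t : F, (X - C t)) = 0 at h2
  rw [map_prod, Finset.prod_eq_zero_iff] at h2
  obtain ⟨t, -, ht⟩ := h2
  refine ⟨t, ?_⟩
  rw [map_sub, aeval_X, aeval_C, sub_eq_zero] at ht
  exact ht.symm

theorem exists_eval_conjugates_ne_zero_and {F k : Type*} [Field F] [Fintype F] [Field k]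
    [Algebra F k] {q n : ℕ} [NeZero n] (hcard : Fintype.card F = q ^ n)
    {T L : MvPolynomial (ZMod n) k} (hT : T ≠ 0) (hL : L ≠ 0)
    (hdeg : T.totalDegree + L.totalDegree < q) :
    ∃ b : F, MvPolynomial.eval (conjugates q (algebraMap F k b)) T ≠ 0 ∧
      MvPolynomial.eval (conjugates q (algebraMap F k b)) L ≠ 0 := by
  obtain ⟨b, hb⟩ := exists_eval_conjugates_ne_zero hcard (mul_ne_zero hT hL)
    ((MvPolynomial.totalDegree_mul _ _).trans_lt hdeg)
  rw [map_mul] at hb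
  exact ⟨b, left_ne_zero_of_mul hb, right_ne_zero_of_mul hb⟩

theorem exists_conjugates_direction {F k : Type*} [Field F] [Fintype F] [Field k] [Infinite k]
    [Algebra F k] {q n : ℕ} [NeZero n] (hcard : Fintype.card F = q ^ n)
    {G : MvPolynomial (ZMod n) k} {w : ZMod n} (hG : MvPolynomial.pderiv w G ≠ 0)
    (hdeg : G.totalDegree + 1 < q) :
    ∃ d : F, MvPolynomial.eval (conjugates q (algebraMap F k d)) G ≠ 0 ∧
      ∑ u, MvPolynomial.C (conjugates q (algebraMap F k d) u) * MvPolynomial.pderiv u G ≠ 0 := by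
  classical
  obtain ⟨z, hz⟩ : ∃ z, MvPolynomial.eval z (MvPolynomial.pderiv w G) ≠ 0 := by
    by_contra! h
    exact hG (MvPolynomial.funext fun z => by rw [h z, map_zero])
  let L : MvPolynomial (ZMod n) k :=
    ∑ u, MvPolynomial.C (MvPolynomial.eval z (MvPolynomial.pderiv u G)) * MvPolynomial.X u
  have hL : L ≠ 0 := by
    intro h
    have := congrArg (MvPolynomial.eval (Pi.single w 1)) h
    simp only [L, map_sum, map_mul, MvPolynomial.eval_C, MvPolynomial.eval_X, map_zero] at this
    rw [Finset.sum_eq_single w (fun u _ hu => by simp [hu]) (by simp)] at this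
    exact hz (by simpa using this)
  have hLdeg : L.totalDegree ≤ 1 := by
    refine MvPolynomial.totalDegree_finsetSum_le fun u _ => ?_
    refine (MvPolynomial.totalDegree_mul _ _).trans ?_
    simp
  have hG0 : G ≠ 0 := by rintro rfl; simp at hG
  obtain ⟨d, hd, hd'⟩ := exists_eval_conjugates_ne_zero_and hcard hG0 hL (by omega)
  refine ⟨d, hd, fun h => hd' ?_⟩
  have := congrArg (MvPolynomial.eval z) h
  simp only [map_sum, map_mul, MvPolynomial.eval_C, map_zero] at this
  rw [← this]
  simp [L, map_sum, mul_comm]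

theorem ZMod.natCast_ne_natCast {n : ℕ} {i j : ℕ} (hi : i < n) (hj : j < n) (h : i ≠ j) :
    (i : ZMod n) ≠ j := by
  rw [Ne, ZMod.natCast_eq_natCast_iff', Nat.mod_eq_of_lt hi, Nat.mod_eq_of_lt hj]
  exact h

section differences

variable {k : Type*} [Field k] {n : ℕ}

theorem exists_conjugates_minor_two {F : Type*} [Field F] [Fintype F] [Algebra F k] {q : ℕ}
    [NeZero n] (hn : 5 ≤ n) (hcard : Fintype.card F = q ^ n) {T : MvPolynomial (ZMod n) k}
    (hT : T ≠ 0) (hdeg : T.totalDegree + 1 < q) {v₀ v₁ : k} (hv : v₀ ≠ 0) :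
    ∃ a : F, MvPolynomial.eval (conjugates q (algebraMap F k a)) T ≠ 0 ∧
      (conjugates q (algebraMap F k a) ((1 : ℕ) : ZMod n) -
          conjugates q (algebraMap F k a) ((0 : ℕ) : ZMod n)) * v₁ -
        (conjugates q (algebraMap F k a) ((2 : ℕ) : ZMod n) -
          conjugates q (algebraMap F k a) ((1 : ℕ) : ZMod n)) * v₀ ≠ 0 := by
  classical
  let x : ℕ → MvPolynomial (ZMod n) k := fun i => MvPolynomial.X (i : ZMod n)
  let L : MvPolynomial (ZMod n) k := MvPolynomial.C v₁ * (x 1 - x 0) - MvPolynomial.C v₀ * (x 2 - x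
      1)
  have hx : ∀ (i j : ℕ) (c : k), (MvPolynomial.C c * (x i - x j)).totalDegree ≤ 1 := fun i j c =>
    (MvPolynomial.totalDegree_mul _ _).trans (by
      rw [MvPolynomial.totalDegree_C, zero_add]
      exact (MvPolynomial.totalDegree_sub _ _).trans (by simp [x]))
  have hLdeg : L.totalDegree ≤ 1 :=
    (MvPolynomial.totalDegree_sub _ _).trans (max_le (hx _ _ _) (hx _ _ _))
  have hL : L ≠ 0 := by
    intro h
    have := congrArg (MvPolynomial.eval (Pi.single ((2 : ℕ) : ZMod n) 1)) h
    simp only [L, x, map_sub, map_mul, MvPolynomial.eval_C, MvPolynomial.eval_X, map_zero,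
      Pi.single_eq_same, Pi.single_eq_of_ne
        (ZMod.natCast_ne_natCast (n := n) (i := 1) (j := 2) (by omega) (by omega) (by omega)),
      Pi.single_eq_of_ne
        (ZMod.natCast_ne_natCast (n := n) (i := 0) (j := 2) (by omega) (by omega) (by omega))]
      at this
    exact hv (by simpa using this)
  obtain ⟨a, ha, ha'⟩ := exists_eval_conjugates_ne_zero_and hcard hT hL (by omega)
  refine ⟨a, ha, ?_⟩
  simpa only [L, x, map_sub, map_mul, MvPolynomial.eval_C, MvPolynomial.eval_X, mul_comm] using ha'

theorem exists_conjugates_minor_three {F : Type*} [Field F] [Fintype F] [Algebra F k] {q : ℕ}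
    [NeZero n] (hn : 5 ≤ n) (hcard : Fintype.card F = q ^ n) {T : MvPolynomial (ZMod n) k}
    (hT : T ≠ 0) (hdeg : T.totalDegree + 1 < q) {m₀ m₁ m₂ : k} (hm : m₂ ≠ 0) :
    ∃ b : F, MvPolynomial.eval (conjugates q (algebraMap F k b)) T ≠ 0 ∧
      (conjugates q (algebraMap F k b) ((1 : ℕ) : ZMod n) -
          conjugates q (algebraMap F k b) ((0 : ℕ) : ZMod n)) * m₀ +
        (conjugates q (algebraMap F k b) ((2 : ℕ) : ZMod n) -
          conjugates q (algebraMap F k b) ((1 : ℕ) : ZMod n)) * m₁ +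
        (conjugates q (algebraMap F k b) ((3 : ℕ) : ZMod n) -
          conjugates q (algebraMap F k b) ((2 : ℕ) : ZMod n)) * m₂ ≠ 0 := by
  classical
  let x : ℕ → MvPolynomial (ZMod n) k := fun i => MvPolynomial.X (i : ZMod n)
  let L : MvPolynomial (ZMod n) k := MvPolynomial.C m₀ * (x 1 - x 0) +
    MvPolynomial.C m₁ * (x 2 - x 1) + MvPolynomial.C m₂ * (x 3 - x 2)
  have hx : ∀ (i j : ℕ) (c : k), (MvPolynomial.C c * (x i - x j)).totalDegree ≤ 1 := fun i j c =>
    (MvPolynomial.totalDegree_mul _ _).trans (by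
      rw [MvPolynomial.totalDegree_C, zero_add]
      exact (MvPolynomial.totalDegree_sub _ _).trans (by simp [x]))
  have hLdeg : L.totalDegree ≤ 1 :=
    (MvPolynomial.totalDegree_add _ _).trans (max_le ((MvPolynomial.totalDegree_add _ _).trans
      (max_le (hx _ _ _) (hx _ _ _))) (hx _ _ _))
  have hL : L ≠ 0 := by
    intro h
    have := congrArg (MvPolynomial.eval (Pi.single ((3 : ℕ) : ZMod n) 1)) h
    simp only [L, x, map_sub, map_add, map_mul, MvPolynomial.eval_C, MvPolynomial.eval_X, map_zero,
      Pi.single_eq_same, Pi.single_eq_of_ne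
        (ZMod.natCast_ne_natCast (n := n) (i := 1) (j := 3) (by omega) (by omega) (by omega)),
      Pi.single_eq_of_ne
        (ZMod.natCast_ne_natCast (n := n) (i := 2) (j := 3) (by omega) (by omega) (by omega)),
      Pi.single_eq_of_ne
        (ZMod.natCast_ne_natCast (n := n) (i := 0) (j := 3) (by omega) (by omega) (by omega))]
      at this
    exact hm (by simpa using this)
  obtain ⟨a, ha, ha'⟩ := exists_eval_conjugates_ne_zero_and hcard hT hL (by omega)
  refine ⟨a, ha, ?_⟩
  simpa only [L, x, map_sub, map_add, map_mul, MvPolynomial.eval_C, MvPolynomial.eval_X, mul_comm]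
    using ha'

end differences

theorem normBinomial_smul {k : Type*} [Field k] {n : ℕ} [NeZero n] (I J : ZMod n) (A B r : k) :
    normBinomial I J (r * A) (r * B) = MvPolynomial.C r * normBinomial I J A B := by
  simp only [normBinomial, map_mul]
  ring

theorem eval_conjugates_normBinomial_pow {k : Type*} [Field k] {n q p e : ℕ} [NeZero n]
    [ExpChar k p] (hq : q = p ^ e) (I J : ZMod n) {A B : k} (hA : A ^ q = A) (hB : B ^ q = B)
    {x : k} (hx : x ^ q ^ n = x) :
    MvPolynomial.eval (conjugates q x) (normBinomial I J A B) ^ q =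
      MvPolynomial.eval (conjugates q x) (normBinomial I J A B) := by
  have key : ∀ K : ZMod n, (∏ u, (conjugates q x (u + K) - conjugates q x u)) ^ q =
      ∏ u, (conjugates q x (u + K) - conjugates q x u) := by
    intro K
    rw [← Finset.prod_pow]
    refine Fintype.prod_equiv (Equiv.addRight 1) _ _ fun u => ?_
    rw [Equiv.coe_addRight, add_right_comm, ← conjugates_add_one hx, ← conjugates_add_one hx, hq,
      sub_pow_expChar_pow]
  rw [eval_normBinomial]
  conv_lhs => rw [hq, add_pow_expChar_pow, ← hq, mul_pow, mul_pow, key, key, hA, hB]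

theorem pow_five_le_sixteen_pow {n : ℕ} (hn : 5 ≤ n) : n ^ 5 ≤ 16 ^ n := by
  induction n, hn using Nat.le_induction with
  | base => norm_num
  | succ n hn ih =>
    have h1 : (5 * (n + 1)) ^ 5 ≤ (6 * n) ^ 5 := Nat.pow_le_pow_left (by omega) 5
    rw [mul_pow, mul_pow] at h1
    rw [pow_succ 16]
    omega

theorem frobenius_zero_bounds {n q : ℕ} (hn : 5 ≤ n) (hq : 2 ^ (4 * n + 4) ≤ q) :
    n * (2 * n * (6 * n ^ 3) + 1) ≤ q ∧ 6 * n ^ 3 + n < q ∧ 2 ^ n * (n * n) + 1 < q ∧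
      2 * n * n + 1 < q ∧ n + 1 < q := by
  have h5 := pow_five_le_sixteen_pow hn
  have hq' : 16 * 16 ^ n ≤ q := by
    refine le_trans (le_of_eq ?_) hq
    rw [pow_add, pow_mul]; norm_num [mul_comm]
  have h2 : n * n ≤ 2 ^ n * 2 ^ n := Nat.mul_le_mul (Nat.lt_two_pow_self).le
      (Nat.lt_two_pow_self).le
  have h8 : 2 ^ n * (n * n) ≤ 16 ^ n := by
    calc 2 ^ n * (n * n) ≤ 2 ^ n * (2 ^ n * 2 ^ n) := Nat.mul_le_mul_left _ h2
      _ = 8 ^ n := by rw [← mul_pow, ← mul_pow]; norm_num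
      _ ≤ 16 ^ n := Nat.pow_le_pow_left (by norm_num) n
  have h1 : 1 ≤ n := by omega
  have e1 : n ≤ n ^ 5 := Nat.le_self_pow (by norm_num) n
  have e3 : n ^ 3 ≤ n ^ 5 := Nat.pow_le_pow_right h1 (by norm_num)
  have e2 : n ^ 2 ≤ n ^ 5 := Nat.pow_le_pow_right h1 (by norm_num)
  refine ⟨?_, by omega, by omega, ?_, by omega⟩
  · have : n * (2 * n * (6 * n ^ 3) + 1) = 12 * n ^ 5 + n := by ring
    omega
  · have : 2 * n * n = 2 * n ^ 2 := by ring
    omega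

/-- Over `𝔽_{q ^ n}` with `q` large, the norms of `x ^ q ^ I - x` and of `c * (x ^ q ^ J - x)`
agree for some `x` outside `𝔽_q`. -/
theorem exists_prod_conjugates_sub_eq {F : Type*} [Field F] [Fintype F] {p e q n : ℕ}
    [Fact p.Prime] [CharP F p] [NeZero n] (hq : q = p ^ e) (hn : 5 ≤ n)
    (hbig : 2 ^ (4 * n + 4) ≤ q) (hcard : Fintype.card F = q ^ n) {I J : ZMod n} (hI : I ≠ 0)
    (hJ : J ≠ 0) (hIJ : I ≠ J) (hIJ' : I ≠ -J) (h2 : I + I ≠ 0 ∨ J + J ≠ 0)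
    (h3 : I + I + I ≠ 0 ∨ J + J + J ≠ 0) {c : F} (hc : c ≠ 0) (hcq : c ^ q = c) :
    ∃ x : F, x ^ q ≠ x ∧ ∏ u, (conjugates q x (u + I) - conjugates q x u) =
      c * ∏ u, (conjugates q x (u + J) - conjugates q x u) := by
  classical
  obtain ⟨b1, b2, b3, b4, b5⟩ := frobenius_zero_bounds hn hbig
  let k := AlgebraicClosure F
  have : CharP k p := charP_of_injective_algebraMap (algebraMap F k).injective p
  have : ExpChar k p := ExpChar.prime Fact.out
  let φ : F → ZMod n → k := fun x => conjugates q (algebraMap F k x)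
  have hfix : ∀ x : F, algebraMap F k x ^ q ^ n = algebraMap F k x := fun x => by
    rw [← map_pow, ← hcard, FiniteField.pow_card]
  have hφ : ∀ (x : F) u, φ x u ^ q = φ x (u + 1) := fun x u => conjugates_add_one (hfix x) u
  have hφq : ∀ (x : F) (i : ℕ), φ x (i : ZMod n) = algebraMap F k x ^ q ^ i := fun x i =>
    conjugates_natCast (hfix x) i
  have heval : ∀ (A B : k) (x : F), MvPolynomial.eval (φ x) (normBinomial I J A B) =
      A * algebraMap F k (∏ u, (conjugates q x (u + I) - conjugates q x u)) +
      B * algebraMap F k (∏ u, (conjugates q x (u + J) - conjugates q x u)) := fun A B x => by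
    rw [eval_normBinomial]
    simp [φ, conjugates, map_prod]
  let c' : k := algebraMap F k c
  have hc' : -c' ≠ 0 := neg_ne_zero.2 ((_root_.map_ne_zero _).2 hc)
  have hc'q : (-c') ^ q = -c' := by
    have : (-c') ^ q = -(c' ^ q) := by
      have h := sub_pow_expChar_pow (R := k) (p := p) (n := e) 0 c'
      rw [← hq, zero_pow (by omega)] at h
      simpa using h
    rw [this, ← map_pow, hcq]
  obtain ⟨hirr, w, hw⟩ := irreducible_normBinomial hn hI hJ hIJ hIJ' h2 h3
    (one_ne_zero (α := k)) hc'
  have hdegG := totalDegree_normBinomial_le I J (1 : k) (-c')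
  obtain ⟨d, hd, hd'⟩ := exists_conjugates_direction hcard hw (by omega)
  let r : k := MvPolynomial.eval (φ d) (normBinomial I J 1 (-c'))
  have hr : r ≠ 0 := hd
  have hrq : r⁻¹ ^ q = r⁻¹ := by
    rw [inv_pow]
    exact congrArg _ (eval_conjugates_normBinomial_pow hq I J (one_pow q) hc'q (hfix d))
  let G : MvPolynomial (ZMod n) k := normBinomial I J (r⁻¹ * 1) (r⁻¹ * -c')
  have hG : G = MvPolynomial.C r⁻¹ * normBinomial I J 1 (-c') := normBinomial_smul I J 1 (-c') r⁻¹
  have hGd : MvPolynomial.eval (φ d) G = 1 := by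
    rw [hG, map_mul, MvPolynomial.eval_C]
    exact inv_mul_cancel₀ hr
  have hGirr : Irreducible G := (irreducible_normBinomial hn hI hJ hIJ hIJ' h2 h3
    (mul_ne_zero (inv_ne_zero hr) one_ne_zero) (mul_ne_zero (inv_ne_zero hr) hc')).1
  have hGdeg : G.totalDegree ≤ n := totalDegree_normBinomial_le _ _ _ _
  have hGder : ∑ u, MvPolynomial.C (φ d u) * MvPolynomial.pderiv u G ≠ 0 := by
    have : ∑ u, MvPolynomial.C (φ d u) * MvPolynomial.pderiv u G = MvPolynomial.C r⁻¹ *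
        ∑ u, MvPolynomial.C (φ d u) * MvPolynomial.pderiv u (normBinomial I J 1 (-c')) := by
      rw [hG, Finset.mul_sum]
      refine Finset.sum_congr rfl fun u _ => ?_
      rw [MvPolynomial.pderiv_C_mul]
      ring
    rw [this]
    exact mul_ne_zero (by simpa using hr) hd'
  obtain ⟨hmon, hnat⟩ := restrictGenericLine_normBinomial_monic I J _ _ hGd
  have hv : φ d ((1 : ℕ) : ZMod n) - φ d ((0 : ℕ) : ZMod n) ≠ 0 := by
    intro h
    have hdq : d ^ q = d := by
      rw [hφq, hφq, ← map_pow, ← map_pow, ← map_sub, map_eq_zero] at h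
      simpa [sub_eq_zero] using h
    apply hr
    change MvPolynomial.eval (φ d) _ = 0
    rw [heval, Finset.prod_eq_zero (Finset.mem_univ 0), Finset.prod_eq_zero (Finset.mem_univ 0)]
    · simp
    all_goals rw [conjugates_of_pow_eq hdq, conjugates_of_pow_eq hdq, sub_self]
  let δ : F → ℕ → k := fun x i => φ x ((i + 1 : ℕ) : ZMod n) - φ x (i : ZMod n)
  obtain ⟨S, hS, hSdeg, hSsep⟩ := exists_forall_separable_restrictLine hGirr hmon hnat hGdeg hGder
  obtain ⟨a, ha, ha'⟩ : ∃ a : F, MvPolynomial.eval (φ a) S ≠ 0 ∧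
      δ a 0 * δ d 1 - δ a 1 * δ d 0 ≠ 0 :=
    exists_conjugates_minor_two hn hcard hS (by omega) hv
  have hmonP : (restrictGenericPlane (φ a) (φ d) G).Monic := by
    rw [← map_aeval_restrictGenericLine]; exact hmon.map _
  have hnatP : (restrictGenericPlane (φ a) (φ d) G).natDegree = n := by
    rw [← map_aeval_restrictGenericLine, hmon.natDegree_map, hnat]
  obtain ⟨T, hT, hTdeg, hTirr⟩ := exists_forall_irreducible_restrictPlane hGirr (by omega) hmonP
    hnatP hGdeg (hSsep _ ha)
  obtain ⟨b, hb, hb'⟩ : ∃ b : F, MvPolynomial.eval (φ b) T ≠ 0 ∧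
      δ b 0 * (δ a 1 * δ d 2 - δ a 2 * δ d 1) + δ b 1 * (δ a 2 * δ d 0 - δ a 0 * δ d 2) +
        δ b 2 * (δ a 0 * δ d 1 - δ a 1 * δ d 0) ≠ 0 :=
    exists_conjugates_minor_three hn hcard hT (by omega) ha'
  have hmonf : (restrictPlane (φ a) (φ b) (φ d) G).Monic := by
    rw [← map_restrictGenericPlane]; exact hmonP.map _
  have hnatf : (restrictPlane (φ a) (φ b) (φ d) G).natDegree = n := by
    rw [← map_restrictGenericPlane, hmonP.natDegree_map, hnatP]
  have hτ : ∀ x : k, iterateFrobenius k p e x = x ^ q := fun x => by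
    rw [iterateFrobenius_def, hq]
  obtain ⟨s, y, hs, hy, hzero⟩ := exists_rational_point hq (by omega) hmonf (hTirr _ hb)
    (map_restrictPlane_normBinomial (iterateFrobenius k p e) I J
      (by rw [hτ, mul_pow, hrq, one_pow]) (by rw [hτ, mul_pow, hrq, hc'q])
      (fun u => by rw [hτ, hφ]) (fun u => by rw [hτ, hφ]) (fun u => by rw [hτ, hφ]))
    (by rw [hnatf]; exact restrictPlane_mem_bidegree _ _ _ hGdeg) (by omega)
    (by rw [hnatf]; exact b1) (by rw [hnatf]; exact b2)
  obtain ⟨s, rfl⟩ := exists_algebraMap_eq_of_pow_eq hcard hs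
  obtain ⟨y, rfl⟩ := exists_algebraMap_eq_of_pow_eq hcard hy
  have hφx : ∀ u, φ (a + b * s + d * y) u =
      φ a u + φ b u * algebraMap F k s + φ d u * algebraMap F k y := fun u => by
    simp only [φ, map_add, map_mul, conjugates_add hq, conjugates_mul, conjugates_of_pow_eq hs,
      conjugates_of_pow_eq hy]
  rw [evalEval_restrictPlane] at hzero
  simp only [← hφx] at hzero
  refine ⟨a + b * s + d * y, fun hx => ?_, ?_⟩
  · have hδ : ∀ i : ℕ, δ a i + δ b i * algebraMap F k s + δ d i * algebraMap F k y = 0 := by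
      intro i
      have h1 : ∀ u, φ (a + b * s + d * y) u = algebraMap F k (a + b * s + d * y) := fun u =>
        conjugates_of_pow_eq (by rw [← map_pow, hx]) u
      have h2 := (h1 ((i + 1 : ℕ) : ZMod n)).trans (h1 (i : ZMod n)).symm
      rw [hφx, hφx] at h2
      linear_combination h2
    have e0 := hδ 0
    have e1 := hδ 1
    have e2 := hδ 2
    generalize algebraMap F k s = s at e0 e1 e2
    generalize algebraMap F k y = y at e0 e1 e2
    have hs0 : s ≠ 0 := by
      rintro rfl
      apply ha'
      linear_combination δ d 1 * e0 - δ d 0 * e1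
    apply mul_ne_zero hs0 hb'
    linear_combination (δ a 1 * δ d 2 - δ a 2 * δ d 1) * e0 +
      (δ a 2 * δ d 0 - δ a 0 * δ d 2) * e1 + (δ a 0 * δ d 1 - δ a 1 * δ d 0) * e2
  · change MvPolynomial.eval (φ (a + b * s + d * y)) G = 0 at hzero
    rw [hG, map_mul, MvPolynomial.eval_C, heval] at hzero
    have h := (mul_eq_zero.1 hzero).resolve_left (inv_ne_zero hr)
    apply (algebraMap F k).injective
    rw [map_mul]
    linear_combination h

section norm

variable {F : Type*} [Field F] [Fintype F] {q n : ℕ}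

theorem card_units_eq (hcard : Fintype.card F = q ^ n) :
    Nat.card Fˣ = q ^ n - 1 := by
  rw [Nat.card_units, Nat.card_eq_fintype_card, hcard]

theorem norm_exponent_mul (q n : ℕ) : (q ^ n - 1) / (q - 1) * (q - 1) = q ^ n - 1 :=
  Nat.div_mul_cancel (by simpa using Nat.sub_dvd_pow_sub_pow q 1 n)

theorem norm_exponent_pos (hq : 1 < q) (hn : n ≠ 0) : 0 < (q ^ n - 1) / (q - 1) :=
  Nat.div_pos (Nat.sub_le_sub_right (Nat.le_self_pow hn q) 1) (by omega)

theorem norm_pow_eq (hq : 1 < q) (hn : n ≠ 0) (hcard : Fintype.card F = q ^ n) (z : F) (m : ℕ) :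
    (z ^ ((q ^ n - 1) / (q - 1))) ^ q ^ m = z ^ ((q ^ n - 1) / (q - 1)) := by
  have h1 : (z ^ ((q ^ n - 1) / (q - 1))) ^ q = z ^ ((q ^ n - 1) / (q - 1)) := by
    by_cases hz : z = 0
    · rw [hz, zero_pow (norm_exponent_pos hq hn).ne', zero_pow (by omega)]
    · have : q = (q - 1) + 1 := by omega
      conv_lhs => rw [this, pow_succ, ← pow_mul, ← this, norm_exponent_mul, ← hcard,
        FiniteField.pow_card_sub_one_eq_one z hz, one_mul, hcard]
  induction m with
  | zero => simp
  | succ m ih => rw [pow_succ, pow_mul, ih, h1]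

/-- A weak form of Hilbert's theorem 90 for finite fields. -/
theorem exists_pow_eq_mul_of_norm_eq_one {m : ℕ} (hq : 1 < q)
    (hcard : Fintype.card F = q ^ n) (hm : Nat.gcd m n = 1) {w : F} (hw : w ≠ 0)
    (hw1 : w ^ ((q ^ n - 1) / (q - 1)) = 1) : ∃ z : F, z ≠ 0 ∧ z ^ q ^ m = w * z := by
  obtain ⟨g, hg⟩ := IsCyclic.exists_generator (α := Fˣ)
  have hgord : orderOf g = q ^ n - 1 := by
    rw [orderOf_eq_card_of_forall_mem_zpowers hg, card_units_eq hcard]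
  have hn : n ≠ 0 := by
    rintro rfl
    have := Fintype.one_lt_card (α := F)
    simp [hcard] at this
  obtain ⟨t, ht⟩ := (mem_powers_iff_mem_zpowers (y := Units.mk0 w hw)).2 (hg _)
  have ht1 : (q - 1) ∣ t := by
    have h1 : g ^ (t * ((q ^ n - 1) / (q - 1))) = 1 := by
      rw [pow_mul]
      simp only at ht
      rw [ht]
      ext
      simpa using hw1
    have h2 := orderOf_dvd_of_pow_eq_one h1
    rw [hgord, mul_comm t] at h2
    nth_rewrite 1 [← norm_exponent_mul q n] at h2
    exact Nat.dvd_of_mul_dvd_mul_left (norm_exponent_pos hq hn) h2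
  obtain ⟨s, rfl⟩ := ht1
  have hgcd : Nat.gcd (q ^ m - 1) (q ^ n - 1) = q - 1 := by
    rw [Nat.pow_sub_one_gcd_pow_sub_one, hm, pow_one]
  have hbez := Nat.gcd_eq_gcd_ab (q ^ m - 1) (q ^ n - 1)
  rw [hgcd] at hbez
  let z : Fˣ := (g ^ s) ^ Nat.gcdA (q ^ m - 1) (q ^ n - 1)
  have hz : z ^ (q ^ m - 1) = Units.mk0 w hw := by
    rw [← ht]
    have h3 : (g ^ s) ^ (((q - 1 : ℕ)) : ℤ) = g ^ ((q - 1) * s) := by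
      rw [zpow_natCast, ← pow_mul, mul_comm]
    simp only
    rw [← h3, hbez, zpow_add, zpow_mul (g ^ s) ((q ^ n - 1 : ℕ) : ℤ), zpow_natCast (g ^ s),
      ← pow_mul g, mul_comm s, pow_mul g, ← hgord, pow_orderOf_eq_one, one_pow, one_zpow, mul_one,
      mul_comm, zpow_mul, zpow_natCast, hgord]
  refine ⟨z, z.ne_zero, ?_⟩
  have h4 := congrArg Units.val hz
  rw [Units.val_pow_eq_pow_val, Units.val_mk0] at h4
  have : q ^ m = (q ^ m - 1) + 1 := by
    have : 0 < q ^ m := by positivity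
    omega
  rw [this, pow_succ, h4]

theorem prod_conjugates_sub_eq_norm [NeZero n] {p e : ℕ} [ExpChar F p] (hqp : q = p ^ e)
    (hq : 1 < q) (hcard : Fintype.card F = q ^ n) (x : F) (I : ℕ) :
    ∏ u : ZMod n, (conjugates q x (u + (I : ZMod n)) - conjugates q x u) =
      (x ^ q ^ I - x) ^ ((q ^ n - 1) / (q - 1)) := by
  have hx : x ^ q ^ n = x := by rw [← hcard, FiniteField.pow_card]
  have h1 : ∀ u : ZMod n, conjugates q x (u + (I : ZMod n)) - conjugates q x u =
      (x ^ q ^ I - x) ^ q ^ u.val := fun u => by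
    rw [conjugates_add_natCast hx, conjugates, hqp, ← pow_mul p e u.val, sub_pow_expChar_pow]
  rw [Finset.prod_congr rfl fun u _ => h1 u, Finset.prod_pow_eq_pow_sum, ← Nat.geomSum_eq hq,
    ← Fin.sum_univ_eq_sum_range]
  congr 1
  exact Fintype.sum_equiv
    { toFun := fun u : ZMod n => (⟨u.val, ZMod.val_lt u⟩ : Fin n)
      invFun := fun i => (i : ℕ)
      left_inv := fun u => ZMod.natCast_zmod_val u
      right_inv := fun i => Fin.ext (ZMod.val_natCast_of_lt i.2) } _ _ fun u => rfl

theorem pow_eq_self_of_coprime (hcard : Fintype.card F = q ^ n) (hq : 1 < q) {m : ℕ}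
    (hm : Nat.gcd m n = 1) {x : F} (hx : x ^ q ^ m = x) : x ^ q = x := by
  by_cases h0 : x = 0
  · rw [h0, zero_pow (by omega)]
  have h1 : x ^ (q ^ m - 1) = 1 := by
    have : q ^ m = (q ^ m - 1) + 1 := by
      have : 0 < q ^ m := by positivity
      omega
    rw [this, pow_succ] at hx
    exact mul_right_cancel₀ h0 (by rw [hx, one_mul])
  have h2 : x ^ (q ^ n - 1) = 1 := by
    rw [← hcard, FiniteField.pow_card_sub_one_eq_one x h0]
  have h3 := pow_gcd_eq_one.2 ⟨h1, h2⟩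
  rw [Nat.pow_sub_one_gcd_pow_sub_one, hm, pow_one] at h3
  have : q = (q - 1) + 1 := by omega
  rw [this, pow_succ, h3, one_mul]

theorem exists_pow_ne_self (hcard : Fintype.card F = q ^ n) (hq : 1 < q) (hn : 1 < n) :
    ∃ x : F, x ^ q ≠ x := by
  by_contra! h
  have hdeg := FiniteField.X_pow_card_sub_X_natDegree_eq F hq
  have h1 : (X ^ q - X : F[X]) = 0 :=
    eq_zero_of_natDegree_lt_card_of_eval_eq_zero _ (f := id) Function.injective_id
      (fun x => by simp [h x]) (by
        rw [hdeg, hcard]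
        exact lt_self_pow₀ hq hn)
  exact FiniteField.X_pow_card_sub_X_ne_zero F hq h1

/-- A binomial fails to be scattered exactly when a suitable equality of norms has a solution
outside the ground field. -/
theorem not_isScattered_binomial_iff {p e : ℕ} [ExpChar F p] (hqp : q = p ^ e) (hq : 1 < q)
    (hcard : Fintype.card F = q ^ n) {I J : ℕ} (hIJ : I < J) (hIn : I ≤ n)
    (hgcd : Nat.gcd (J - I) n = 1) (α : F) :
    ¬ IsScattered q (fun x : F => x ^ q ^ I + α * x ^ q ^ J) ↔
      ∃ x : F, x ^ q ≠ x ∧ (x ^ q ^ I - x) ^ ((q ^ n - 1) / (q - 1)) =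
        (-α) ^ ((q ^ n - 1) / (q - 1)) * (x ^ q ^ J - x) ^ ((q ^ n - 1) / (q - 1)) := by
  have hn : n ≠ 0 := by
    rintro rfl
    have := Fintype.one_lt_card (α := F)
    simp [hcard] at this
  have hM := norm_exponent_pos hq hn
  have hN := norm_pow_eq hq hn hcard
  constructor
  · intro h
    rw [IsScattered] at h
    push Not at h
    obtain ⟨x, y, hx, hy, hxy, hne⟩ := h
    refine ⟨x / y, hne, ?_⟩
    obtain ⟨l, rfl⟩ : ∃ l, x = l * y := ⟨x / y, (div_mul_cancel₀ x hy).symm⟩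
    have hl : l ≠ 0 := left_ne_zero_of_mul hx
    rw [mul_div_cancel_right₀ l hy]
    have h1 : y ^ q ^ I * (l ^ q ^ I - l) = y ^ q ^ J * (-α * (l ^ q ^ J - l)) := by
      rw [div_eq_div_iff hx hy, mul_pow, mul_pow] at hxy
      apply mul_right_cancel₀ hy
      linear_combination hxy
    have h2 := congrArg (· ^ ((q ^ n - 1) / (q - 1))) h1
    simp only [mul_pow] at h2
    rw [pow_right_comm y, hN, pow_right_comm y, hN] at h2
    exact mul_left_cancel₀ (pow_ne_zero _ hy) h2
  · rintro ⟨l, hl, h⟩ hsc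
    obtain ⟨z, hz, hzl⟩ : ∃ z : F, z ≠ 0 ∧
        z ^ q ^ I * (l ^ q ^ I - l) = z ^ q ^ J * (-α * (l ^ q ^ J - l)) := by
      rw [← mul_pow] at h
      by_cases hB : -α * (l ^ q ^ J - l) = 0
      · refine ⟨1, one_ne_zero, ?_⟩
        rw [hB, zero_pow hM.ne'] at h
        rw [eq_zero_of_pow_eq_zero h, hB, mul_zero, mul_zero]
      · have hA : l ^ q ^ I - l ≠ 0 := by
          intro h0
          rw [h0, zero_pow hM.ne'] at h
          exact hB (eq_zero_of_pow_eq_zero h.symm)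
        obtain ⟨t, ht, htw⟩ := exists_pow_eq_mul_of_norm_eq_one hq hcard hgcd (div_ne_zero hA hB)
          (by rw [div_pow, h, div_self (pow_ne_zero _ hB)])
        have htI : (t ^ q ^ (n - I)) ^ q ^ I = t := by
          rw [← pow_mul, ← pow_add, Nat.sub_add_cancel hIn, ← hcard, FiniteField.pow_card]
        refine ⟨t ^ q ^ (n - I), pow_ne_zero _ ht, ?_⟩
        have hJ : q ^ J = q ^ I * q ^ (J - I) := by rw [← pow_add, Nat.add_sub_cancel' hIJ.le]
        rw [hJ, pow_mul, htI, htw, ← hJ, mul_right_comm, div_mul_cancel₀ _ hB, mul_comm]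
    have hl0 : l ≠ 0 := by
      rintro rfl
      exact hl (zero_pow (by omega))
    refine hl ?_
    have := hsc (l * z) z (mul_ne_zero hl0 hz) hz (by
      rw [div_eq_div_iff (mul_ne_zero hl0 hz) hz]
      simp only [mul_pow]
      linear_combination z * hzl)
    rwa [mul_div_cancel_right₀ l hz] at this

end norm

theorem two_pow_le_of_two_rpow_le {n q : ℕ}
    (h : (2 : ℝ) ^ ((13 / 3 : ℝ) * (n : ℝ) + 4) ≤ (q : ℝ)) : 2 ^ (4 * n + 4) ≤ q := by
  have h1 : (2 : ℝ) ^ ((4 * n + 4 : ℕ) : ℝ) ≤ (2 : ℝ) ^ ((13 / 3 : ℝ) * (n : ℝ) + 4) := by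
    refine Real.rpow_le_rpow_of_exponent_le (by norm_num) ?_
    push_cast
    have : (0 : ℝ) ≤ n := Nat.cast_nonneg n
    linarith
  rw [Real.rpow_natCast] at h1
  exact_mod_cast h1.trans h

/-- Let `q` be a prime power, `n ≥ 5`, `1 ≤ I < J ≤ n - 1` with `gcd (J - I) n = 1`.
Suppose `q ≥ 2 ^ ((13/3) * n + 4)` and `α ∈ F_{q^n} \ {0}`. Then
`f x = x ^ q ^ I + α * x ^ q ^ J` is scattered over `F_{q^n}` iff `I + J = n` and
`N_{q^n/q}(α) = α ^ ((q ^ n - 1) / (q - 1)) ≠ 1`. -/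
theorem stmt_0 (p e : ℕ) (hp : p.Prime) (he : 0 < e) (q : ℕ) (hq : q = p ^ e)
    (n I J : ℕ) (hn : 5 ≤ n) (hI : 1 ≤ I) (hIJ : I < J) (hJ : J ≤ n - 1)
    (hgcd : Nat.gcd (J - I) n = 1)
    (hqbig : (2 : ℝ) ^ ((13 / 3 : ℝ) * (n : ℝ) + 4) ≤ (q : ℝ))
    (F : Type*) [Field F] [Fintype F] (hcard : Fintype.card F = q ^ n)
    (α : F) (hα : α ≠ 0) :
    IsScattered q (fun x : F => x ^ q ^ I + α * x ^ q ^ J) ↔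
      I + J = n ∧ α ^ ((q ^ n - 1) / (q - 1)) ≠ 1 := by
  have : Fact p.Prime := ⟨hp⟩
  have : NeZero n := ⟨by omega⟩
  have : CharP F p := charP_of_card_eq_prime_pow (f := e * n) (by
    rw [hcard, hq, pow_mul])
  have : ExpChar F p := ExpChar.prime hp
  have hbig := two_pow_le_of_two_rpow_le hqbig
  have hq1 : 1 < q := hq ▸ Nat.one_lt_pow he.ne' hp.one_lt
  have hM := norm_exponent_pos hq1 (n := n) (by omega)
  have hN := norm_pow_eq hq1 (by omega) hcard
  rw [← not_iff_not, not_isScattered_binomial_iff hq hq1 hcard hIJ (by omega) hgcd α]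
  by_cases hsum : I + J = n
  · have hnorm : ∀ x : F, (-α) ^ ((q ^ n - 1) / (q - 1)) * (x ^ q ^ J - x) ^ ((q ^ n - 1) / (q -
      1)) =
        α ^ ((q ^ n - 1) / (q - 1)) * (x ^ q ^ I - x) ^ ((q ^ n - 1) / (q - 1)) := fun x => by
      have h1 : (x ^ q ^ J - x) ^ q ^ I = -(x ^ q ^ I - x) := by
        rw [hq, ← pow_mul p e I, sub_pow_expChar_pow, pow_mul p e I, ← hq, ← pow_mul, ← pow_add,
          add_comm J I, hsum, ← hcard, FiniteField.pow_card, neg_sub]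
      rw [← hN (x ^ q ^ J - x) I, pow_right_comm, h1, ← mul_pow, ← mul_pow, neg_mul_neg]
    have hIn : Nat.gcd I n = 1 := by
      refine Nat.dvd_one.1 (hgcd ▸ Nat.dvd_gcd ?_ (Nat.gcd_dvd_right I n))
      have h1 : J = n - I := by omega
      rw [h1]
      exact Nat.dvd_sub (Nat.dvd_sub (Nat.gcd_dvd_right I n) (Nat.gcd_dvd_left I n))
        (Nat.gcd_dvd_left I n)
    simp only [hsum, true_and, not_not, hnorm]
    constructor
    · rintro ⟨x, hx, h⟩
      have hA : x ^ q ^ I - x ≠ 0 := fun h0 =>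
        hx (pow_eq_self_of_coprime hcard hq1 hIn (sub_eq_zero.1 h0))
      exact (mul_right_cancel₀ (pow_ne_zero _ hA) ((one_mul _).trans h)).symm
    · intro h
      obtain ⟨x, hx⟩ := exists_pow_ne_self hcard hq1 (by omega)
      exact ⟨x, hx, by rw [h, one_mul]⟩
  · simp only [hsum, false_and, not_false_eq_true, iff_true]
    have hcast : ∀ m : ℕ, (m : ZMod n) = 0 ↔ n ∣ m := fun m => ZMod.natCast_eq_zero_iff m n
    have hcop : ∀ m : ℕ, n ∣ m * (J - I) → n ∣ m := fun m h =>
      (Nat.Coprime.symm hgcd).dvd_of_dvd_mul_right h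
    have hmul : ∀ m : ℕ, 0 < m → m < n → (m * I : ZMod n) ≠ 0 ∨ (m * J : ZMod n) ≠ 0 := by
      intro m hm hmn
      by_contra! h
      have h1 : ((m * (J - I) : ℕ) : ZMod n) = 0 := by
        rw [Nat.cast_mul, Nat.cast_sub hIJ.le, mul_sub, h.1, h.2, sub_zero]
      exact Nat.not_dvd_of_pos_of_lt hm hmn (hcop m ((hcast _).1 h1))
    obtain ⟨x, hx, h⟩ := exists_prod_conjugates_sub_eq hq hn hbig hcard
      (I := (I : ZMod n)) (J := (J : ZMod n)) (c := (-α) ^ ((q ^ n - 1) / (q - 1)))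
      (by rw [Ne, hcast]; exact Nat.not_dvd_of_pos_of_lt hI (by omega))
      (by rw [Ne, hcast]; exact Nat.not_dvd_of_pos_of_lt (by omega) (by omega))
      (ZMod.natCast_ne_natCast (by omega) (by omega) hIJ.ne)
      (by
        rw [Ne, eq_neg_iff_add_eq_zero, ← Nat.cast_add, hcast]
        rintro ⟨t, ht⟩
        have h1 : 0 < t := Nat.pos_of_ne_zero (by rintro rfl; omega)
        have h2 : t < 2 := by
          by_contra! h2
          have := Nat.mul_le_mul_left n h2
          omega
        obtain rfl : t = 1 := by omega
        omega)
      (by simpa [two_mul] using hmul 2 (by omega) (by omega))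
      (by
        have := hmul 3 (by omega) (by omega)
        convert this using 2 <;> · push_cast; ring_nf)
      (pow_ne_zero _ (neg_ne_zero.2 hα)) (by simpa using hN (-α) 1)
    rw [prod_conjugates_sub_eq_norm hq hq1 hcard, prod_conjugates_sub_eq_norm hq hq1 hcard] at h
    exact ⟨x, hx, h⟩
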